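/- Let G be a 2-connected finite simple graph. Then G has spaghetti treewidth equal to two if and only if the cell completion G̃ of G is a chain tree of cycles. -/

import Mathlib

open SimpleGraph

/-- The cycle graph on `ZMod n` (for `3 ≤ n` this is a cycle of length `n`). -/
def cycGraph (n : ℕ) : SimpleGraph (ZMod n) :=
  SimpleGraph.fromRel (fun x y => x = y + 1)

/-- The set `s` of nodes induces a path in the graph `H`. -/
def IsPathSet {ι : Type} (H : SimpleGraph ι) (s : Set ι) : Prop :=
  (H.induce s).Connected ∧ ∀ x ∈ s, {y | y ∈ s ∧ H.Adj x y}.ncard ≤ 2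

/-- The set `s` of nodes induces a directed path in `H` with respect to the
orientation `o` of the edges of `H`. -/
def IsDirPathSet {ι : Type} (H : SimpleGraph ι) (o : ι → ι → Prop) (s : Set ι) : Prop :=
  IsPathSet H s ∧ (∀ x ∈ s, {y | y ∈ s ∧ o x y}.ncard ≤ 1) ∧
    (∀ x ∈ s, {y | y ∈ s ∧ o y x}.ncard ≤ 1)

/-- A tree decomposition of a finite simple graph `G`. -/
structure TreeDecomp {V : Type} (G : SimpleGraph V) where
  ι : Type
  finι : Finite ι
  tree : SimpleGraph ι
  isTree : tree.IsTree
  bag : ι → Set V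
  bag_cover : ∀ v : V, ∃ x, v ∈ bag x
  bag_edge : ∀ ⦃u v : V⦄, G.Adj u v → ∃ x, u ∈ bag x ∧ v ∈ bag x
  bag_conn : ∀ v : V, (tree.induce {x | v ∈ bag x}).Connected

/-- A spaghetti tree decomposition: for every vertex `v` of `G`, the nodes whose
bags contain `v` induce a path in the tree. -/
structure SpaghettiTD {V : Type} (G : SimpleGraph V) extends TreeDecomp G where
  bag_path : ∀ v : V, IsPathSet tree {x | v ∈ bag x}

/-- A directed spaghetti tree decomposition: the tree edges are oriented, and for
every vertex `v` of `G` the nodes whose bags contain `v` induce a directed path. -/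
structure DirSpaghettiTD {V : Type} (G : SimpleGraph V) extends TreeDecomp G where
  orient : ι → ι → Prop
  orient_iff : ∀ x y : ι, tree.Adj x y ↔ (orient x y ∨ orient y x)
  orient_asymm : ∀ x y : ι, orient x y → ¬ orient y x
  bag_dirpath : ∀ v : V, IsDirPathSet tree orient {x | v ∈ bag x}

/-- A special tree decomposition: the tree is rooted, and for every vertex `v` of
`G` the nodes whose bags contain `v` induce a vertical path, i.e. a directed path
with respect to the orientation of every tree edge towards the root. -/
structure SpecialTD {V : Type} (G : SimpleGraph V) extends TreeDecomp G where
  root : ι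
  bag_vertical : ∀ v : V,
    IsDirPathSet tree (fun x y => tree.Adj x y ∧ tree.dist y root < tree.dist x root)
      {x | v ∈ bag x}

/-- A path decomposition of a finite simple graph `G`. -/
structure PathDecomp {V : Type} (G : SimpleGraph V) where
  m : ℕ
  hm : 0 < m
  bag : Fin m → Set V
  bag_cover : ∀ v : V, ∃ i, v ∈ bag i
  bag_edge : ∀ ⦃u v : V⦄, G.Adj u v → ∃ i, u ∈ bag i ∧ v ∈ bag i
  bag_convex : ∀ (v : V) (i j k : Fin m), i ≤ j → j ≤ k → v ∈ bag i → v ∈ bag k → v ∈ bag j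

/-- Treewidth: minimal width of a tree decomposition. -/
noncomputable def treewidth {V : Type} (G : SimpleGraph V) : ℕ :=
  sInf {k | ∃ td : TreeDecomp G, ∀ x, (td.bag x).ncard ≤ k + 1}

/-- Spaghetti treewidth: minimal width of a spaghetti tree decomposition. -/
noncomputable def sptw {V : Type} (G : SimpleGraph V) : ℕ :=
  sInf {k | ∃ td : SpaghettiTD G, ∀ x, (td.bag x).ncard ≤ k + 1}

/-- Directed spaghetti treewidth: minimal width of a directed spaghetti tree
decomposition. -/
noncomputable def dptw {V : Type} (G : SimpleGraph V) : ℕ :=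
  sInf {k | ∃ td : DirSpaghettiTD G, ∀ x, (td.bag x).ncard ≤ k + 1}

/-- Special treewidth: minimal width of a special tree decomposition. -/
noncomputable def spctw {V : Type} (G : SimpleGraph V) : ℕ :=
  sInf {k | ∃ td : SpecialTD G, ∀ x, (td.bag x).ncard ≤ k + 1}

/-- Pathwidth: minimal width of a path decomposition. -/
noncomputable def pw {V : Type} (G : SimpleGraph V) : ℕ :=
  sInf {k | ∃ pd : PathDecomp G, ∀ i, (pd.bag i).ncard ≤ k + 1}

/-- A graph is chordal iff it has no induced (i.e. chordless) cycle of length at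
least four. -/
def IsChordal {V : Type} (G : SimpleGraph V) : Prop :=
  ∀ (S : Set V) (n : ℕ), 4 ≤ n → ¬ Nonempty ((G.induce S) ≃g cycGraph n)

/-- A graph is strongly chordal if it is chordal and every even cycle of length at
least six has an odd chord: a chord splitting the cycle into two odd paths of
length at least three. -/
def IsStronglyChordal {V : Type} (G : SimpleGraph V) : Prop :=
  IsChordal G ∧ ∀ n : ℕ, 6 ≤ n → Even n → ∀ f : ZMod n → V,
    Function.Injective f → (∀ i : ZMod n, G.Adj (f i) (f (i + 1))) →
      ∃ (i : ZMod n) (d : ℕ), Odd d ∧ 3 ≤ d ∧ d + 3 ≤ n ∧ G.Adj (f i) (f (i + (d : ZMod n)))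

/-- Strongly chordal treewidth: the minimum of `ω(H) - 1` over all strongly chordal
supergraphs `H` of `G` (on the same vertex set; here `ω(H) ≤ k + 1` is expressed as
`H.CliqueFree (k + 2)`). -/
noncomputable def sctw {V : Type} (G : SimpleGraph V) : ℕ :=
  sInf {k | ∃ H : SimpleGraph V, G ≤ H ∧ IsStronglyChordal H ∧ H.CliqueFree (k + 2)}

/-- `H` is a minor of `G`: there is a family of nonempty, pairwise disjoint,
connected branch sets in `G`, one for each vertex of `H`, such that every edge of
`H` is realized by an edge of `G` between the corresponding branch sets. -/
def IsMinorOf {W V : Type} (H : SimpleGraph W) (G : SimpleGraph V) : Prop :=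
  ∃ f : W → Set V,
    (∀ w, (f w).Nonempty) ∧ (∀ w, (G.induce (f w)).Connected) ∧
    (Pairwise fun w w' => Disjoint (f w) (f w')) ∧
    ∀ ⦃w w'⦄, H.Adj w w' → ∃ u ∈ f w, ∃ v ∈ f w', G.Adj u v

/-- The complete graph on four vertices. -/
def K4 : SimpleGraph (Fin 4) := ⊤

/-- `D₃`: two vertices (`0` and `1`) joined by three internally vertex-disjoint
paths of length three. -/
def D3 : SimpleGraph (Fin 8) := SimpleGraph.fromRel (fun x y =>
  (x = 0 ∧ y = 2) ∨ (x = 2 ∧ y = 3) ∨ (x = 3 ∧ y = 1) ∨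
  (x = 0 ∧ y = 4) ∨ (x = 4 ∧ y = 5) ∨ (x = 5 ∧ y = 1) ∨
  (x = 0 ∧ y = 6) ∨ (x = 6 ∧ y = 7) ∨ (x = 7 ∧ y = 1))

/-- `S₃` (the 3-sun): a 6-cycle `0 1 2 3 4 5` together with the triangle `1 3 5`. -/
def S3 : SimpleGraph (Fin 6) := SimpleGraph.fromRel (fun x y =>
  (x = 0 ∧ y = 1) ∨ (x = 1 ∧ y = 2) ∨ (x = 2 ∧ y = 3) ∨ (x = 3 ∧ y = 4) ∨
  (x = 4 ∧ y = 5) ∨ (x = 5 ∧ y = 0) ∨ (x = 1 ∧ y = 3) ∨ (x = 3 ∧ y = 5) ∨ (x = 5 ∧ y = 1))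

/-- A graph is 2-connected if it has at least three vertices and deleting any one
vertex leaves it connected. -/
def TwoConnected {V : Type} (G : SimpleGraph V) : Prop :=
  3 ≤ Nat.card V ∧ ∀ v : V, (G.induce {x | x ≠ v}).Connected

/-- The cell completion of `G`: add an edge `vw` for every pair of (nonadjacent)
vertices `v, w` such that deleting `v` and `w` leaves at least three connected
components. -/
def cellCompletion {V : Type} (G : SimpleGraph V) : SimpleGraph V :=
  SimpleGraph.fromRel (fun v w => G.Adj v w ∨
    3 ≤ Nat.card ((G.induce {x | x ≠ v ∧ x ≠ w}).ConnectedComponent))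

/-- The induced subgraph of `G` on `S` has no cut vertex. -/
def NoCutVertex {V : Type} (G : SimpleGraph V) (S : Set V) : Prop :=
  ∀ v ∈ S, (S \ {v}).Nonempty → (G.induce (S \ {v})).Connected

/-- `S` carries a block of `G`: a maximal connected (induced) subgraph without a
cut vertex. -/
def IsBlock {V : Type} (G : SimpleGraph V) (S : Set V) : Prop :=
  S.Nonempty ∧ (G.induce S).Connected ∧ NoCutVertex G S ∧
    ∀ S' : Set V, S ⊆ S' → (G.induce S').Connected → NoCutVertex G S' → S' = S

/-- Glue a cycle of length `n` onto the graph `G` by identifying the cycle edge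
`{0, 1}` (with its end vertices) with the edge `{a, b}` of `G`. -/
def glueCycle {V : Type} (G : SimpleGraph V) (n : ℕ) (a b : V) :
    SimpleGraph (V ⊕ {x : ZMod n // x ≠ 0 ∧ x ≠ 1}) :=
  SimpleGraph.fromRel (fun p q =>
    match p, q with
    | Sum.inl u, Sum.inl v => G.Adj u v
    | Sum.inl u, Sum.inr x => (u = a ∧ (cycGraph n).Adj 0 x.1) ∨ (u = b ∧ (cycGraph n).Adj 1 x.1)
    | Sum.inr x, Sum.inr y => (cycGraph n).Adj x.1 y.1
    | Sum.inr _, Sum.inl _ => False)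

/-- The class of trees of cycles: every cycle is a tree of cycles, and gluing a
cycle onto a tree of cycles along an edge yields a tree of cycles (up to
isomorphism). -/
inductive IsTreeOfCycles : {V : Type} → SimpleGraph V → Prop
  | cycle {V : Type} (G : SimpleGraph V) (n : ℕ) (hn : 3 ≤ n)
      (e : Nonempty (G ≃g cycGraph n)) : IsTreeOfCycles G
  | glue {V W : Type} (G : SimpleGraph V) (hG : IsTreeOfCycles G)
      (n : ℕ) (hn : 3 ≤ n) (a b : V) (hab : G.Adj a b)
      (H : SimpleGraph W) (e : Nonempty (H ≃g glueCycle G n a b)) : IsTreeOfCycles H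

/-- `S` is the vertex set of a chordless cycle of `G`, i.e. it induces a cycle. -/
def IsChordlessCycle {V : Type} (G : SimpleGraph V) (S : Set V) : Prop :=
  ∃ n : ℕ, 3 ≤ n ∧ Nonempty ((G.induce S) ≃g cycGraph n)

/-- The edge `uv` is an edge separator: it lies in at least two distinct chordless
cycles of `G`. -/
def IsEdgeSeparator {V : Type} (G : SimpleGraph V) (u v : V) : Prop :=
  G.Adj u v ∧ ∃ S₁ S₂ : Set V, S₁ ≠ S₂ ∧ IsChordlessCycle G S₁ ∧ IsChordlessCycle G S₂ ∧
    u ∈ S₁ ∧ v ∈ S₁ ∧ u ∈ S₂ ∧ v ∈ S₂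

/-- `S` is a simplicial triangle of `G`: a chordless cycle on three vertices
containing a simplicial vertex of `G`. -/
def IsSimplicialTriangle {V : Type} (G : SimpleGraph V) (S : Set V) : Prop :=
  IsChordlessCycle G S ∧ S.ncard = 3 ∧ ∃ v ∈ S, G.IsClique (G.neighborSet v)

/-- A chain tree of cycles: a tree of cycles in which every edge lies in at most two
chordless cycles that are not simplicial triangles (equivalently, if an edge lies in
`m ≥ 3` chordless cycles then at least `m - 2` of them are simplicial triangles). -/
def IsChainTreeOfCycles {V : Type} (G : SimpleGraph V) : Prop :=
  IsTreeOfCycles G ∧ ∀ u v : V, G.Adj u v →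
    {S : Set V | IsChordlessCycle G S ∧ u ∈ S ∧ v ∈ S ∧ ¬ IsSimplicialTriangle G S}.ncard ≤ 2

/-- A tree of two-boundaried cycles: a tree of cycles in which every chordless
cycle contains at most two edge separators. -/
def IsTreeOfTwoBoundariedCycles {V : Type} (G : SimpleGraph V) : Prop :=
  IsTreeOfCycles G ∧ ∀ S : Set V, IsChordlessCycle G S →
    {e : Sym2 V | ∃ u v : V, e = s(u, v) ∧ u ∈ S ∧ v ∈ S ∧ IsEdgeSeparator G u v}.ncard ≤ 2

/-- A path of cycles: a tree of cycles in which every chordless cycle contains at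
most two edge separators and every edge lies in at most two chordless cycles that
are not simplicial triangles. -/
def IsPathOfCycles {V : Type} (G : SimpleGraph V) : Prop :=
  IsTreeOfCycles G ∧
    (∀ S : Set V, IsChordlessCycle G S →
      {e : Sym2 V | ∃ u v : V, e = s(u, v) ∧ u ∈ S ∧ v ∈ S ∧ IsEdgeSeparator G u v}.ncard ≤ 2) ∧
    ∀ u v : V, G.Adj u v →
      {S : Set V | IsChordlessCycle G S ∧ u ∈ S ∧ v ∈ S ∧ ¬ IsSimplicialTriangle G S}.ncard ≤ 2

/-- The graph is a single edge. -/
def IsSingleEdgeGraph {V : Type} (G : SimpleGraph V) : Prop :=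
  Nat.card V = 2 ∧ ∀ a b : V, a ≠ b → G.Adj a b

/-- A mamba: a 2-connected graph of pathwidth two, a single edge, or an isolated
vertex. -/
def IsMamba {V : Type} (G : SimpleGraph V) : Prop :=
  (TwoConnected G ∧ pw G = 2) ∨ IsSingleEdgeGraph G ∨ Nat.card V = 1

/-- `v` is a head vertex of the mamba `G`: some path decomposition of `G` of width
at most two has `v` in its first bag. -/
def IsHeadVertex {V : Type} (G : SimpleGraph V) (v : V) : Prop :=
  ∃ pd : PathDecomp G, (∀ i, (pd.bag i).ncard ≤ 3) ∧ v ∈ pd.bag ⟨0, pd.hm⟩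

/-- Glue the graph `M` onto the graph `G` by identifying the vertex `h` of `M` with
the vertex `x` of `G`. -/
def glueAtVertex {V W : Type} (G : SimpleGraph V) (x : V) (M : SimpleGraph W) (h : W) :
    SimpleGraph (V ⊕ {w : W // w ≠ h}) :=
  SimpleGraph.fromRel (fun p q =>
    match p, q with
    | Sum.inl u, Sum.inl u' => G.Adj u u'
    | Sum.inl u, Sum.inr w => u = x ∧ M.Adj h w.1
    | Sum.inr w, Sum.inr w' => M.Adj w.1 w'.1
    | Sum.inr _, Sum.inl _ => False)

/-- The class of mamba trees: every mamba is a mamba tree, and gluing a mamba onto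
a mamba tree by identifying a vertex of the mamba tree with a head vertex of the
mamba yields a mamba tree (up to isomorphism). -/
inductive IsMambaTree : {V : Type} → SimpleGraph V → Prop
  | mamba {V : Type} (G : SimpleGraph V) (hG : IsMamba G) : IsMambaTree G
  | glue {V W U : Type} (G : SimpleGraph V) (hG : IsMambaTree G)
      (M : SimpleGraph W) (hM : IsMamba M) (x : V) (h : W) (hh : IsHeadVertex M h)
      (K : SimpleGraph U) (e : Nonempty (K ≃g glueAtVertex G x M h)) : IsMambaTree K

/-- Subdivide the edge `{a, b}` of `G` by a new vertex. -/
def subdivideEdge {V : Type} (G : SimpleGraph V) (a b : V) : SimpleGraph (V ⊕ Unit) :=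
  SimpleGraph.fromRel (fun p q =>
    match p, q with
    | Sum.inl u, Sum.inl v => G.Adj u v ∧ ¬(u = a ∧ v = b) ∧ ¬(u = b ∧ v = a)
    | Sum.inl u, Sum.inr _ => u = a ∨ u = b
    | Sum.inr _, _ => False)

/-- `H` is a subdivision of `G`: `H` is obtained from (an isomorphic copy of) `G`
by repeatedly subdividing edges. -/
inductive IsSubdivisionOf : {W V : Type} → SimpleGraph W → SimpleGraph V → Prop
  | base {V W : Type} {G : SimpleGraph V} {H : SimpleGraph W}
      (e : Nonempty (H ≃g G)) : IsSubdivisionOf H G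
  | step {V W U : Type} {G : SimpleGraph V} {H : SimpleGraph W} (a b : W) (hab : H.Adj a b)
      (h : IsSubdivisionOf H G) {K : SimpleGraph U}
      (e : Nonempty (K ≃g subdivideEdge H a b)) : IsSubdivisionOf K G

/-- Contract the edge `{a, b}` of `G` (the contracted vertex is `a`, `b` is removed). -/
def contractEdge {V : Type} (G : SimpleGraph V) (a b : V) : SimpleGraph {x : V // x ≠ b} :=
  SimpleGraph.fromRel (fun x y =>
    G.Adj x.1 y.1 ∨ (x.1 = a ∧ G.Adj b y.1) ∨ (y.1 = a ∧ G.Adj b x.1))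

/-! ### Sets closed under adjacency away from a removed set -/

/-- `A` is a union of connected components of the subgraph of `H` induced by `S \ X`. -/
def ClosedIn {V : Type} (H : SimpleGraph V) (S X A : Set V) : Prop :=
  A ⊆ S ∧ (∀ x ∈ A, x ∉ X) ∧ ∀ x ∈ A, ∀ y ∈ S, H.Adj x y → y ∈ A ∨ y ∈ X

/-- The subgraph of `H` induced by `S` is connected and has no cut vertex. -/
def BiConn {V : Type} (H : SimpleGraph V) (S : Set V) : Prop :=
  (∀ A : Set V, A.Nonempty → ClosedIn H S ∅ A → A = S) ∧
    ∀ v ∈ S, ∀ A : Set V, A.Nonempty → ClosedIn H S {v} A → A = S \ {v}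

/-- Removing `X` from `S` leaves at least two components. -/
def TwoSep {V : Type} (H : SimpleGraph V) (S X : Set V) : Prop :=
  ∃ A B : Set V, A.Nonempty ∧ B.Nonempty ∧ Disjoint A B ∧ ClosedIn H S X A ∧ ClosedIn H S X B

/-- Removing `X` from `S` leaves at least three components. -/
def ThreeSep {V : Type} (H : SimpleGraph V) (S X : Set V) : Prop :=
  ∃ A : Fin 3 → Set V, (∀ i, (A i).Nonempty) ∧ (∀ i j, i ≠ j → Disjoint (A i) (A j)) ∧
    ∀ i, ClosedIn H S X (A i)

/-- `A` and the vertices of `S` outside of the set `S'` that are adjacent to a vertex of `A`. -/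
def extendBy {V : Type} (H : SimpleGraph V) (S S' A : Set V) : Set V :=
  A ∪ {x | x ∈ S \ S' ∧ ∃ y ∈ A, H.Adj x y}

section Closed

variable {V : Type} {H H' : SimpleGraph V} {S S' X A B : Set V}

/-- `(H', S')` arises from `(H, S)` by deleting independent vertices and turning their
neighbourhoods into cliques. -/
def Reduces (H : SimpleGraph V) (S : Set V) (H' : SimpleGraph V) (S' : Set V) : Prop :=
  S' ⊆ S ∧ H ≤ H' ∧ ∀ x ∈ S \ S', ∀ y ∈ S, H.Adj x y →
    y ∈ S' ∧ ∀ z ∈ S, H.Adj x z → y ≠ z → H'.Adj y z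

lemma ClosedIn.mono_graph (hH : H ≤ H') (hA : ClosedIn H' S X A) : ClosedIn H S X A :=
  ⟨hA.1, hA.2.1, fun x hx y hy h => hA.2.2 x hx y hy (hH h)⟩

lemma ClosedIn.congr_graph (hH : ∀ x ∈ S, ∀ y ∈ S, H.Adj x y ↔ H'.Adj x y)
    (hA : ClosedIn H' S X A) : ClosedIn H S X A :=
  ⟨hA.1, hA.2.1, fun x hx y hy h => hA.2.2 x hx y hy ((hH x (hA.1 hx) y hy).1 h)⟩

lemma ClosedIn.compl (hA : ClosedIn H S X A) : ClosedIn H S X ((S \ A) \ X) := by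
  refine ⟨fun x hx => hx.1.1, fun x hx => hx.2, fun x hx y hy h => ?_⟩
  by_contra hc
  simp only [Set.mem_sdiff, not_or, not_and, not_not] at hc
  have hyA : y ∈ A := by by_contra hn; exact hc.2 (hc.1 ⟨hy, hn⟩)
  rcases hA.2.2 y hyA x hx.1.1 h.symm with h1 | h1
  · exact hx.1.2 h1
  · exact hx.2 h1

lemma Reduces.closedIn_extendBy (hr : Reduces H S H' S') (hX : X ⊆ S')
    (hA : ClosedIn H' S' X A) : ClosedIn H S X (extendBy H S S' A) := by
  obtain ⟨hS, hH, hc⟩ := hr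
  obtain ⟨h1, h2, h3⟩ := hA
  refine ⟨?_, ?_, ?_⟩
  · rintro x (hx | hx)
    · exact hS (h1 hx)
    · exact hx.1.1
  · rintro x (hx | hx) hxX
    · exact h2 x hx hxX
    · exact hx.1.2 (hX hxX)
  · rintro x (hx | ⟨hx, w, hw, hxw⟩) y hy hxy
    · by_cases hyS : y ∈ S'
      · rcases h3 x hx y hyS (hH hxy) with h | h
        · exact Or.inl (Or.inl h)
        · exact Or.inr h
      · exact Or.inl (Or.inr ⟨⟨hy, hyS⟩, x, hx, hxy.symm⟩)
    · by_cases hyw : w = y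
      · subst hyw; exact Or.inl (Or.inl hw)
      · rcases h3 w hw y (hc x hx y hy hxy).1 ((hc x hx w (hS (h1 hw)) hxw).2 y hy hxy hyw) with h | h
        · exact Or.inl (Or.inl h)
        · exact Or.inr h

lemma extendBy_inter (hA : A ⊆ S') : extendBy H S S' A ∩ S' = A := by
  ext x
  simp only [extendBy, Set.mem_inter_iff, Set.mem_union, Set.mem_ofPred_eq, Set.mem_sdiff]
  constructor
  · rintro ⟨h | h, h'⟩
    · exact h
    · exact absurd h' h.1.2
  · exact fun h => ⟨Or.inl h, hA h⟩

lemma Reduces.disjoint_extendBy (hr : Reduces H S H' S') (hA : ClosedIn H' S' X A)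
    (hB : ClosedIn H' S' X B) (hAB : Disjoint A B) :
    Disjoint (extendBy H S S' A) (extendBy H S S' B) := by
  obtain ⟨hS, hH, hc⟩ := hr
  rw [Set.disjoint_left] at *
  rintro x (hx | ⟨hx, w, hw, hxw⟩) (hx' | ⟨hx', w', hw', hxw'⟩)
  · exact hAB hx hx'
  · exact hx'.2 (hA.1 hx)
  · exact hx.2 (hB.1 hx')
  · by_cases hww : w = w'
    · subst hww; exact hAB hw hw'
    · have hadj := (hc x hx w (hS (hA.1 hw)) hxw).2 w' (hS (hB.1 hw')) hxw' hww
      rcases hA.2.2 w hw w' (hB.1 hw') hadj with h | h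
      · exact hAB h hw'
      · exact hB.2.1 _ hw' h

lemma Reduces.biConn (hr : Reduces H S H' S') (hb : BiConn H S) : BiConn H' S' := by
  refine ⟨fun A hne hA => ?_, fun v hv A hne hA => ?_⟩
  · have := hb.1 (extendBy H S S' A) (hne.mono Set.subset_union_left) (hr.closedIn_extendBy (Set.empty_subset _) hA)
    rw [← extendBy_inter (H := H) (S := S) hA.1, this, Set.inter_eq_right.2 hr.1]
  · have := hb.2 v (hr.1 hv) (extendBy H S S' A) (hne.mono Set.subset_union_left)
      (hr.closedIn_extendBy (Set.singleton_subset_iff.2 hv) hA)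
    rw [← extendBy_inter (H := H) (S := S) hA.1, this]
    ext y
    have := @hr.1 y
    simp only [Set.mem_inter_iff, Set.mem_sdiff]
    tauto

lemma Reduces.threeSep (hr : Reduces H S H' S') (hX : X ⊆ S') (h : ThreeSep H' S' X) :
    ThreeSep H S X := by
  obtain ⟨A, hne, hd, hc⟩ := h
  exact ⟨fun i => extendBy H S S' (A i), fun i => (hne i).mono Set.subset_union_left,
    fun i j hij => hr.disjoint_extendBy (hc i) (hc j) (hd i j hij),
    fun i => hr.closedIn_extendBy hX (hc i)⟩

lemma Reduces.twoSep (hr : Reduces H S H' S') (hX : X ⊆ S') (h : TwoSep H' S' X) :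
    TwoSep H S X := by
  obtain ⟨A, B, hA, hB, hd, hcA, hcB⟩ := h
  exact ⟨_, _, hA.mono Set.subset_union_left, hB.mono Set.subset_union_left,
    hr.disjoint_extendBy hcA hcB hd, hr.closedIn_extendBy hX hcA, hr.closedIn_extendBy hX hcB⟩

lemma ThreeSep.mono_graph (hH : H ≤ H') (h : ThreeSep H' S X) : ThreeSep H S X := by
  obtain ⟨A, hne, hd, hc⟩ := h
  exact ⟨A, hne, hd, fun i => (hc i).mono_graph hH⟩

/-- In a 2-connected graph, every part of a two-vertex separation sees both vertices. -/
lemma BiConn.exists_adj (hb : BiConn H S) {u v : V} (hu : u ∈ S) (hv : v ∈ S) (huv : u ≠ v)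
    (hne : A.Nonempty) (hA : ClosedIn H S {u, v} A) : ∃ y ∈ A, H.Adj u y := by
  by_contra hc
  push Not at hc
  have h := hb.2 v hv A hne ⟨hA.1, fun x hx h => hA.2.1 x hx (by simp_all), fun x hx y hy h => by
    rcases hA.2.2 x hx y hy h with h' | rfl | h'
    · exact Or.inl h'
    · exact absurd h.symm (hc x hx)
    · exact Or.inr h'⟩
  have : u ∈ A := by rw [h]; exact ⟨hu, huv⟩
  exact hA.2.1 u this (by simp)

/-- In a 2-connected graph on at least three vertices there is no vertex of degree at most one. -/
lemma BiConn.not_nbr_subsingleton (hb : BiConn H S) (h3 : 3 ≤ S.ncard) {x c : V}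
    (hx : x ∈ S) (h : ∀ y ∈ S, H.Adj x y → y = c) : False := by
  by_cases hc : c ∈ S ∧ c ≠ x
  · have := hb.2 c hc.1 {x} (by simp) ⟨by simpa, by simpa using fun h => hc.2 h.symm, by
      rintro _ rfl y hy hxy; exact Or.inr (h y hy hxy)⟩
    have h2 : S ⊆ {x, c} := by
      intro y hy
      by_cases hyc : y = c
      · simp [hyc]
      · have : y ∈ ({x} : Set V) := by rw [this]; exact ⟨hy, hyc⟩
        exact Or.inl this
    have := Set.ncard_le_ncard h2
    have := Set.ncard_insert_le x {c}
    have := Set.ncard_singleton c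
    omega
  · have := hb.1 {x} (by simp) ⟨by simpa, by simp, by
      rintro _ rfl y hy hxy
      have := h y hy hxy
      subst this
      exact absurd ⟨hy, hxy.ne'⟩ hc⟩
    rw [← this] at h3
    simp at h3

end Closed

/-! ### Elimination orderings of width two -/

/-- The subgraph of `H` induced by `S` can be dismantled by eliminating vertices of degree
at most two. -/
inductive Elim2 {V : Type} : SimpleGraph V → Set V → Prop
  | small (H : SimpleGraph V) (S : Set V) (h : S.ncard ≤ 2) : Elim2 H S
  | step (H : SimpleGraph V) (S : Set V) (x a b : V) (hx : x ∈ S)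
      (hN : ∀ y ∈ S, H.Adj x y → y = a ∨ y = b)
      (h : Elim2 (H ⊔ edge a b) (S \ {x})) : Elim2 H S

section Elim

variable {V : Type} {H H' : SimpleGraph V} {S S' X A B : Set V}

lemma sup_edge_adj_iff {a b x y : V} : (H ⊔ edge a b).Adj x y ↔
    H.Adj x y ∨ ((x = a ∧ y = b ∨ x = b ∧ y = a) ∧ x ≠ y) := by
  simp [edge_adj]

lemma Elim2.mono [Finite V] (h : Elim2 H' S) (hS : S' ⊆ S)
    (hH : ∀ x ∈ S', ∀ y ∈ S', H.Adj x y → H'.Adj x y) : Elim2 H S' := by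
  induction h generalizing H S' with
  | small H' S h => exact .small _ _ ((Set.ncard_le_ncard hS S.toFinite).trans h)
  | step H' S x a b hx hN h ih =>
    by_cases hxS : x ∈ S'
    · refine .step _ _ x a b hxS (fun y hy hxy => hN y (hS hy) (hH x hxS y hy hxy)) ?_
      refine ih (Set.sdiff_subset_sdiff_left hS) fun y hy z hz hyz => ?_
      rw [sup_edge_adj_iff] at hyz ⊢
      exact hyz.imp_left (hH y hy.1 z hz.1)
    · refine ih (fun y hy => ⟨hS hy, fun h => hxS (h ▸ hy)⟩) fun y hy z hz hyz => ?_
      exact Or.inl (hH y hy z hz hyz)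

lemma Elim2.no_K4 [Finite V] (h : Elim2 H S) {p q r s : V} (hp : p ∈ S) (hq : q ∈ S) (hr : r ∈ S) (hs : s ∈ S)
    (hpq : H.Adj p q) (hpr : H.Adj p r) (hps : H.Adj p s) (hqr : H.Adj q r) (hqs : H.Adj q s)
    (hrs : H.Adj r s) : False := by
  have e1 := hpq.ne
  have e2 := hpr.ne
  have e3 := hps.ne
  have e4 := hqr.ne
  have e5 := hqs.ne
  have e6 := hrs.ne
  induction h with
  | small H S h =>
    have hf := S.toFinite
    have : ({p, q, r} : Set V).ncard = 3 := by
      rw [Set.ncard_eq_three]; exact ⟨p, q, r, e1, e2, e4, rfl⟩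
    have := Set.ncard_le_ncard (s := {p, q, r}) (t := S) (by
      intro x; simp only [Set.mem_insert_iff, Set.mem_singleton_iff]; grind) hf
    omega
  | step H S x a b hx hN h ih =>
    have hpx : p ≠ x := by
      rintro rfl
      have := hN q hq hpq; have := hN r hr hpr; have := hN s hs hps; grind
    have hqx : q ≠ x := by
      rintro rfl
      have := hN p hp hpq.symm; have := hN r hr hqr; have := hN s hs hqs; grind
    have hrx : r ≠ x := by
      rintro rfl
      have := hN p hp hpr.symm; have := hN q hq hqr.symm; have := hN s hs hrs; grind
    have hsx : s ≠ x := by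
      rintro rfl
      have := hN p hp hps.symm; have := hN q hq hqs.symm; have := hN r hr hrs.symm; grind
    exact ih ⟨hp, hpx⟩ ⟨hq, hqx⟩ ⟨hr, hrx⟩ ⟨hs, hsx⟩ (Or.inl hpq) (Or.inl hpr) (Or.inl hps)
      (Or.inl hqr) (Or.inl hqs) (Or.inl hrs)

lemma BiConn.exists_reduction [Finite V] (hb : BiConn H S) (h3 : 3 ≤ S.ncard) (he : Elim2 H S) :
    ∃ x ∈ S, ∃ a ∈ S, ∃ b ∈ S, a ≠ b ∧ a ≠ x ∧ b ≠ x ∧ (∀ y ∈ S, H.Adj x y ↔ y = a ∨ y = b) ∧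
      Elim2 (H ⊔ edge a b) (S \ {x}) ∧ Reduces H S (H ⊔ edge a b) (S \ {x}) := by
  cases he with
  | small _ _ h => omega
  | step _ _ x a b hx hN h =>
    have key : ∀ c d, (∀ y ∈ S, H.Adj x y → y = c ∨ y = d) → d ∈ S ∧ H.Adj x d := by
      intro c d hcd
      by_contra hc
      refine hb.not_nbr_subsingleton h3 (c := c) hx fun y hy hxy => (hcd y hy hxy).resolve_right ?_
      rintro rfl
      exact hc ⟨hy, hxy⟩
    obtain ⟨hbS, hxb⟩ := key a b hN
    obtain ⟨haS, hxa⟩ := key b a fun y hy h => (hN y hy h).symm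
    have hab : a ≠ b := by
      rintro rfl
      exact hb.not_nbr_subsingleton h3 (c := a) hx fun y hy h => by simpa using hN y hy h
    refine ⟨x, hx, a, haS, b, hbS, hab, hxa.ne', hxb.ne', fun y hy => ⟨hN y hy, ?_⟩, h,
      Set.sdiff_subset, le_sup_left, ?_⟩
    · rintro (rfl | rfl) <;> assumption
    · intro z hz y hy hzy
      have hzx : z = x := by
        by_contra hne
        exact hz.2 ⟨hz.1, hne⟩
      subst hzx
      refine ⟨⟨hy, hzy.ne'⟩, fun w hw hzw hyw => ?_⟩
      rw [sup_edge_adj_iff]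
      have := hN y hy hzy
      have := hN w hw hzw
      grind

lemma Reduces.threeSep_of_twoSep {x : V} (hr : Reduces H S H' (S \ {x})) (hX : X ⊆ S \ {x})
    (hx : x ∈ S) (hN : ∀ y ∈ S, H.Adj x y → y ∈ X) (h : TwoSep H' (S \ {x}) X) :
    ThreeSep H S X := by
  obtain ⟨A, B, hA, hB, hd, hcA, hcB⟩ := h
  have hxc : ClosedIn H S X {x} := by
    refine ⟨by simpa, ?_, ?_⟩
    · rintro _ rfl hx'
      exact (hX hx').2 rfl
    · rintro _ rfl y hy hxy
      exact Or.inr (hN y hy hxy)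
  have hxe : ∀ {A}, ClosedIn H' (S \ {x}) X A → x ∉ extendBy H S (S \ {x}) A := by
    rintro A hA (h | ⟨-, y, hy, hxy⟩)
    · exact (hA.1 h).2 rfl
    · exact hA.2.1 y hy (hN y (hA.1 hy).1 hxy)
  have hdd := hr.disjoint_extendBy hcA hcB hd
  refine ⟨![extendBy H S (S \ {x}) A, extendBy H S (S \ {x}) B, {x}], ?_, ?_, ?_⟩
  · intro i
    fin_cases i
    · exact hA.mono Set.subset_union_left
    · exact hB.mono Set.subset_union_left
    · exact Set.singleton_nonempty x
  · intro i j hij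
    fin_cases i <;> fin_cases j <;> first | exact absurd rfl hij | skip
    · exact hdd
    · exact Set.disjoint_singleton_right.2 (hxe hcA)
    · exact hdd.symm
    · exact Set.disjoint_singleton_right.2 (hxe hcB)
    · exact Set.disjoint_singleton_left.2 (hxe hcA)
    · exact Set.disjoint_singleton_left.2 (hxe hcB)
  · intro i
    fin_cases i
    · exact hr.closedIn_extendBy hX hcA
    · exact hr.closedIn_extendBy hX hcB
    · exact hxc

end Elim

/-! ### Induced cycles -/

/-- The subgraph of `H` induced by `C` is connected and 2-regular. -/
def IsCyc {V : Type} (H : SimpleGraph V) (C : Set V) : Prop :=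
  C.Nonempty ∧ (∀ A : Set V, A.Nonempty → ClosedIn H C ∅ A → A = C) ∧
    ∀ x ∈ C, ∃ a ∈ C, ∃ b ∈ C, a ≠ b ∧ ∀ y ∈ C, H.Adj x y ↔ y = a ∨ y = b

section Cyc

variable {V : Type} {H H' : SimpleGraph V} {S C C' A : Set V}

lemma IsCyc.congr (h : IsCyc H C) (hH : ∀ x ∈ C, ∀ y ∈ C, H.Adj x y ↔ H'.Adj x y) :
    IsCyc H' C := by
  refine ⟨h.1, fun A hne hA => h.2.1 A hne (hA.congr_graph hH), fun x hx => ?_⟩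
  obtain ⟨a, ha, b, hb, hab, hN⟩ := h.2.2 x hx
  exact ⟨a, ha, b, hb, hab, fun y hy => (hH x hx y hy).symm.trans (hN y hy)⟩

lemma IsCyc.eq_of_subset (h : IsCyc H C) (h' : IsCyc H C') (hs : C' ⊆ C) : C' = C := by
  refine h.2.1 C' h'.1 ⟨hs, by simp, fun x hx y hy hxy => Or.inl ?_⟩
  obtain ⟨a, ha, b, hb, hab, hN⟩ := h.2.2 x (hs hx)
  obtain ⟨c, hc, d, hd, hcd, hN'⟩ := h'.2.2 x hx
  have h1 := (hN c (hs hc)).1 ((hN' c hc).2 (Or.inl rfl))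
  have h2 := (hN d (hs hd)).1 ((hN' d hd).2 (Or.inr rfl))
  have h3 := (hN y hy).1 hxy
  grind

lemma IsCyc.eq_triangle (h : IsCyc H C) {x a b : V} (hx : x ∈ C) (ha : a ∈ C) (hb : b ∈ C)
    (hxa : H.Adj x a) (hxb : H.Adj x b) (hab : H.Adj a b) : C = {x, a, b} := by
  symm
  refine h.2.1 _ ⟨x, by simp⟩ ⟨?_, by simp, ?_⟩
  · rintro y (rfl | rfl | rfl) <;> assumption
  · rintro y hy z hz hyz
    left
    have hyC : y ∈ C := by rcases hy with rfl | rfl | rfl <;> assumption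
    obtain ⟨c, hc, d, hd, hcd, hN⟩ := h.2.2 y hyC
    have h1 := hN x hx
    have h2 := hN a ha
    have h3 := hN b hb
    have h4 := hN z hz
    have := hxa.ne
    have := hxb.ne
    have := hab.ne
    have := hxa.symm
    have := hxb.symm
    have := hab.symm
    simp only [Set.mem_insert_iff, Set.mem_singleton_iff] at hy ⊢
    grind

lemma isCyc_triangle {x a b : V} (hxa : H.Adj x a) (hxb : H.Adj x b) (hab : H.Adj a b) :
    IsCyc H {x, a, b} := by
  refine ⟨⟨x, by simp⟩, fun A hne hA => ?_, ?_⟩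
  · refine Set.Subset.antisymm hA.1 ?_
    have hc := hA.2.2
    simp only [Set.mem_empty_iff_false, or_false] at hc
    have hx : x ∈ A := by
      obtain ⟨y, hy⟩ := hne
      rcases hA.1 hy with rfl | rfl | rfl
      · exact hy
      · exact hc _ hy x (by simp) hxa.symm
      · exact hc _ hy x (by simp) hxb.symm
    rintro y (rfl | rfl | rfl)
    · exact hx
    · exact hc _ hx _ (by simp) hxa
    · exact hc _ hx _ (by simp) hxb
  · have := hxa.ne
    have := hxb.ne
    have := hab.ne
    rintro y (rfl | rfl | rfl)
    · refine ⟨a, by simp, b, by simp, hab.ne, ?_⟩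
      rintro z (rfl | rfl | rfl) <;> simp_all
    · refine ⟨x, by simp, b, by simp, hxb.ne, ?_⟩
      rintro z (rfl | rfl | rfl) <;> simp_all [H.adj_comm, eq_comm]
    · refine ⟨x, by simp, a, by simp, hxa.ne, ?_⟩
      rintro z (rfl | rfl | rfl) <;> simp_all [H.adj_comm, eq_comm]

lemma reduces_of_nbrs {x a b : V}
    (hN : ∀ y ∈ S, H.Adj x y → y = a ∨ y = b) : Reduces H S (H ⊔ edge a b) (S \ {x}) := by
  refine ⟨Set.sdiff_subset, le_sup_left, ?_⟩
  intro z hz y hy hzy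
  have hzx : z = x := by
    by_contra hne
    exact hz.2 ⟨hz.1, hne⟩
  subst hzx
  refine ⟨⟨hy, hzy.ne'⟩, fun w hw hzw hyw => ?_⟩
  rw [sup_edge_adj_iff]
  have := hN y hy hzy
  have := hN w hw hzw
  grind

/-- Smoothing a vertex of an induced cycle. -/
lemma IsCyc.smooth (h : IsCyc H C) {x a b : V} (hx : x ∈ C) (ha : a ∈ C) (hb : b ∈ C)
    (hab : a ≠ b) (hN : ∀ y ∈ C, H.Adj x y ↔ y = a ∨ y = b) (hnab : ¬ H.Adj a b) :
    IsCyc (H ⊔ edge a b) (C \ {x}) := by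
  have hxa : H.Adj x a := (hN a ha).2 (Or.inl rfl)
  have hxb : H.Adj x b := (hN b hb).2 (Or.inr rfl)
  have hr := reduces_of_nbrs fun y hy => (hN y hy).1
  refine ⟨⟨a, ha, hxa.ne'⟩, fun A hne hA => ?_, ?_⟩
  · have := h.2.1 (extendBy H C (C \ {x}) A) (hne.mono Set.subset_union_left)
      (hr.closedIn_extendBy (Set.empty_subset _) hA)
    rw [← extendBy_inter (H := H) (S := C) hA.1, this, Set.inter_eq_right.2 hr.1]
  · rintro y ⟨hy, hyx⟩
    obtain ⟨c, hc, d, hd, hcd, hN'⟩ := h.2.2 y hy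
    have hyx : y ≠ x := hyx
    have h1 := hN y hy
    have h2 := hN' x hx
    have h3 := hN' a ha
    have h4 := hN' b hb
    have h5 := hxa.symm
    have h6 := hxb.symm
    have h7 := hxa.ne
    have h8 := hxb.ne
    have h9 : ¬ H.Adj b a := fun h => hnab h.symm
    have hs := H.adj_comm x y
    have nc := hN' c hc
    have nd := hN' d hd
    have ac := H.ne_of_adj (nc.2 (Or.inl rfl))
    have ad := H.ne_of_adj (nd.2 (Or.inr rfl))
    have key : ∃ c' d', c' ∈ C ∧ d' ∈ C ∧ c' ≠ x ∧ d' ≠ x ∧ c' ≠ d' ∧ y ≠ c' ∧ y ≠ d' ∧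
        ((y = a ∧ H.Adj y c' ∧ d' = b ∧ ∀ z, (z = c ∨ z = d) ↔ (z = x ∨ z = c')) ∨
         (y = b ∧ H.Adj y c' ∧ d' = a ∧ ∀ z, (z = c ∨ z = d) ↔ (z = x ∨ z = c')) ∨
         (y ≠ a ∧ y ≠ b ∧ c' = c ∧ d' = d)) := by
      by_cases hya : y = a
      · by_cases hcx : c = x
        · exact ⟨d, b, by grind⟩
        · exact ⟨c, b, by grind⟩
      · by_cases hyb : y = b
        · by_cases hcx : c = x
          · exact ⟨d, a, by grind⟩
          · exact ⟨c, a, by grind⟩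
        · exact ⟨c, d, by grind⟩
    obtain ⟨c', d', hc', hd', hcx, hdx, hcd', hyc, hyd, hk⟩ := key
    refine ⟨c', ⟨hc', hcx⟩, d', ⟨hd', hdx⟩, hcd', fun z hz => ?_⟩
    have hzx : z ≠ x := hz.2
    have hz := hN' z hz.1
    rw [sup_edge_adj_iff]
    rcases hk with ⟨rfl, -, rfl, hk⟩ | ⟨rfl, -, rfl, hk⟩ | ⟨-, -, rfl, rfl⟩
    · have := hk z; grind
    · have := hk z; grind
    · grind

/-- Subdividing an edge of an induced cycle. -/
lemma IsCyc.subdivide {x a b : V} (h : IsCyc (H ⊔ edge a b) C) (hx : x ∉ C) (ha : a ∈ C)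
    (hb : b ∈ C) (hab : a ≠ b) (hN : ∀ y ∈ C, H.Adj x y ↔ y = a ∨ y = b)
    (hnab : ¬ H.Adj a b) : IsCyc H (insert x C) := by
  have hxa : H.Adj x a := (hN a ha).2 (Or.inl rfl)
  have hxb : H.Adj x b := (hN b hb).2 (Or.inr rfl)
  refine ⟨⟨x, by simp⟩, fun A hne hA => ?_, ?_⟩
  · have hc := hA.2.2
    simp only [Set.mem_empty_iff_false, or_false] at hc
    have hxC : (x ∈ A ∨ a ∈ A ∨ b ∈ A) → x ∈ A ∧ a ∈ A ∧ b ∈ A := by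
      have i1 : x ∈ A → a ∈ A := fun h => hc x h a (Or.inr ha) hxa
      have i2 : x ∈ A → b ∈ A := fun h => hc x h b (Or.inr hb) hxb
      have i3 : a ∈ A → x ∈ A := fun h => hc a h x (by simp) hxa.symm
      have i4 : b ∈ A → x ∈ A := fun h => hc b h x (by simp) hxb.symm
      tauto
    have hACne : (A ∩ C).Nonempty := by
      obtain ⟨y, hy⟩ := hne
      rcases hA.1 hy with rfl | h'
      · exact ⟨a, (hxC (Or.inl hy)).2.1, ha⟩
      · exact ⟨y, hy, h'⟩
    have hAC := h.2.1 (A ∩ C) hACne ⟨Set.inter_subset_right, by simp, fun y hy z hz hyz => Or.inl ⟨?_, hz⟩⟩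
    · have hCA : C ⊆ A := Set.inter_eq_right.1 hAC
      refine Set.Subset.antisymm hA.1 (Set.insert_subset (hxC (Or.inr (Or.inl (hCA ha)))).1 hCA)
    · rw [sup_edge_adj_iff] at hyz
      rcases hyz with hyz | ⟨⟨rfl, rfl⟩ | ⟨rfl, rfl⟩, -⟩
      · exact hc y hy.1 z (Or.inr hz) hyz
      · exact (hxC (Or.inr (Or.inl hy.1))).2.2
      · exact (hxC (Or.inr (Or.inr hy.1))).2.1
  · rintro y (rfl | hy)
    · refine ⟨a, Or.inr ha, b, Or.inr hb, hab, ?_⟩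
      rintro z (rfl | hz)
      · have := hxa.ne; have := hxb.ne; simp_all
      · exact hN z hz
    · obtain ⟨c, hc, d, hd, hcd, hN'⟩ := h.2.2 y hy
      have hs := H.adj_comm x y
      have h1 := hN y hy
      have h3 := hN' a ha
      have h4 := hN' b hb
      have nc := hN' c hc
      have nd := hN' d hd
      have hxc : x ≠ c := fun h => hx (h ▸ hc)
      have hxd : x ≠ d := fun h => hx (h ▸ hd)
      simp only [sup_edge_adj_iff] at hN' h3 h4 nc nd
      have h9 : ¬ H.Adj b a := fun h => hnab h.symm
      by_cases hya : y = a
      · by_cases hcb : c = b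
        · refine ⟨x, by simp, d, Or.inr hd, hxd, ?_⟩
          rintro z (rfl | hz)
          · grind
          · have := hN' z hz; have : x ≠ z := fun h => hx (h ▸ hz)
            grind
        · refine ⟨x, by simp, c, Or.inr hc, hxc, ?_⟩
          rintro z (rfl | hz)
          · grind
          · have := hN' z hz; have : x ≠ z := fun h => hx (h ▸ hz)
            grind
      · by_cases hyb : y = b
        · by_cases hcb : c = a
          · refine ⟨x, by simp, d, Or.inr hd, hxd, ?_⟩
            rintro z (rfl | hz)
            · grind
            · have := hN' z hz; have : x ≠ z := fun h => hx (h ▸ hz)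
              grind
          · refine ⟨x, by simp, c, Or.inr hc, hxc, ?_⟩
            rintro z (rfl | hz)
            · grind
            · have := hN' z hz; have : x ≠ z := fun h => hx (h ▸ hz)
              grind
        · refine ⟨c, Or.inr hc, d, Or.inr hd, hcd, ?_⟩
          rintro z (rfl | hz)
          · grind
          · have := hN' z hz; have : x ≠ z := fun h => hx (h ▸ hz)
            grind

/-- Deleting the ends of an edge of an induced cycle leaves a connected graph. -/
lemma IsCyc.eq_of_closedIn [Finite V] (h : IsCyc H C) {u v : V} (hu : u ∈ C) (hv : v ∈ C)
    (huv : H.Adj u v) (hne : A.Nonempty) (hA : ClosedIn H C {u, v} A) : A = C \ {u, v} := by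
  induction hn : C.ncard using Nat.strong_induction_on generalizing H C A with
  | _ n ih =>
    subst hn
    obtain ⟨x, hxA⟩ := hne
    have hx := hA.1 hxA
    obtain ⟨a, ha, b, hb, hab, hN⟩ := h.2.2 x hx
    have hxa : H.Adj x a := (hN a ha).2 (Or.inl rfl)
    have hxb : H.Adj x b := (hN b hb).2 (Or.inr rfl)
    have hxu : x ≠ u := by rintro rfl; exact hA.2.1 _ hxA (by simp)
    have hxv : x ≠ v := by rintro rfl; exact hA.2.1 _ hxA (by simp)
    by_cases hadj : H.Adj a b
    · have hC := h.eq_triangle hx ha hb hxa hxb hadj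
      have := huv.ne
      subst hC
      have h1 := hA.1
      have h2 := hA.2.1
      simp only [Set.mem_insert_iff, Set.mem_singleton_iff] at hu hv h2
      ext y
      have := h2 y
      have := @h1 y
      simp only [Set.mem_insert_iff, Set.mem_singleton_iff, Set.mem_sdiff] at this ⊢
      grind
    · have hc : ∀ y ∈ A \ {x}, ∀ z ∈ C \ {x}, (H ⊔ edge a b).Adj y z → z ∈ A \ {x} ∨ z ∈ ({u, v} : Set V) := by
        rintro y hy z hz hyz
        rw [sup_edge_adj_iff] at hyz
        rcases hyz with hyz | ⟨⟨rfl, rfl⟩ | ⟨rfl, rfl⟩, -⟩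
        · exact (hA.2.2 y hy.1 z hz.1 hyz).imp_left fun h => ⟨h, hz.2⟩
        · exact (hA.2.2 x hxA z hz.1 hxb).imp_left fun h => ⟨h, hz.2⟩
        · exact (hA.2.2 x hxA z hz.1 hxa).imp_left fun h => ⟨h, hz.2⟩
      have hne' : (A \ {x}).Nonempty := by
        rcases hA.2.2 x hxA a ha hxa with h1 | h1
        · exact ⟨a, h1, hxa.ne'⟩
        · rcases hA.2.2 x hxA b hb hxb with h2 | h2
          · exact ⟨b, h2, hxb.ne'⟩
          · exfalso
            simp only [Set.mem_insert_iff, Set.mem_singleton_iff] at h1 h2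
            have := huv.symm
            grind
      have := ih (C \ {x}).ncard (Set.ncard_sdiff_singleton_lt_of_mem hx C.toFinite)
        (h.smooth hx ha hb hab hN hadj) ⟨hu, hxu.symm⟩ ⟨hv, hxv.symm⟩ (Or.inl huv) hne'
        ⟨Set.sdiff_subset_sdiff_left hA.1, fun y hy => hA.2.1 y hy.1, hc⟩ rfl
      ext y
      by_cases hyx : y = x
      · subst hyx
        simp [hxA, hx, hxu, hxv]
      · have h1 : y ∈ A \ {x} ↔ y ∈ A := by simp [hyx]
        rw [← h1, this]
        simp [hyx]

lemma IsCyc.exists_enum [Finite V] (h : IsCyc H C) {a b : V} (ha : a ∈ C) (hb : b ∈ C)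
    (hab : H.Adj a b) : ∃ n : ℕ, 3 ≤ n ∧ ∃ f : ℕ → V, f 0 = a ∧ f 1 = b ∧
      (∀ y, y ∈ C ↔ ∃ i < n, f i = y) ∧ (∀ i < n, ∀ j < n, f i = f j → i = j) ∧
      ∀ i j, i < j → j < n → (H.Adj (f i) (f j) ↔ j = i + 1 ∨ (i = 0 ∧ j + 1 = n)) := by
  classical
  induction hn : C.ncard using Nat.strong_induction_on generalizing H C with
  | _ n ih =>
    subst hn
    obtain ⟨p, hp, q, hq, hpq, hNa⟩ := h.2.2 a ha
    obtain ⟨x, hx, hbx, hNa⟩ : ∃ x ∈ C, b ≠ x ∧ ∀ y ∈ C, H.Adj a y ↔ y = b ∨ y = x := by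
      rcases (hNa b hb).1 hab with rfl | rfl
      · exact ⟨q, hq, hpq, hNa⟩
      · exact ⟨p, hp, hpq.symm, fun y hy => (hNa y hy).trans or_comm⟩
    have hax : H.Adj a x := (hNa x hx).2 (Or.inr rfl)
    obtain ⟨p, hp, q, hq, hpq, hNx⟩ := h.2.2 x hx
    obtain ⟨d, hd, had, hNx⟩ : ∃ d ∈ C, a ≠ d ∧ ∀ y ∈ C, H.Adj x y ↔ y = a ∨ y = d := by
      rcases (hNx a ha).1 hax.symm with rfl | rfl
      · exact ⟨q, hq, hpq, hNx⟩
      · exact ⟨p, hp, hpq.symm, fun y hy => (hNx y hy).trans or_comm⟩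
    have hxd : H.Adj x d := (hNx d hd).2 (Or.inr rfl)
    by_cases hadj : H.Adj a d
    · have hdb : d = b := ((hNa d hd).1 hadj).resolve_right hxd.ne'
      subst hdb
      have hC := h.eq_triangle ha hx hd hax hab hxd
      refine ⟨3, le_rfl, fun i => if i = 0 then a else if i = 1 then d else x, by simp, by simp, ?_, ?_, ?_⟩
      · intro y
        rw [hC]
        constructor
        · rintro (rfl | rfl | rfl)
          · exact ⟨0, by simp⟩
          · exact ⟨2, by simp⟩
          · exact ⟨1, by simp⟩
        · rintro ⟨i, hi, rfl⟩
          interval_cases i <;> simp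
      · intro i hi j hj
        have := hax.ne
        interval_cases i <;> interval_cases j <;> simp <;> grind
      · intro i j hij hj
        have := hxd.symm
        interval_cases j <;> interval_cases i <;> simp_all
    · obtain ⟨n, hn, f, hf0, hf1, hfC, hinj, hfadj⟩ := ih (C \ {x}).ncard
        (Set.ncard_sdiff_singleton_lt_of_mem hx C.toFinite) (h.smooth hx ha hd had hNx hadj)
        ⟨ha, hax.ne⟩ ⟨hb, hbx⟩ (Or.inl hab) rfl
      have hdb : d ≠ b := by rintro rfl; exact hadj hab
      have hfd : f (n - 1) = d := by
        obtain ⟨i, hi, rfl⟩ := (hfC d).1 ⟨hd, hxd.ne'⟩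
        have hi0 : 0 < i := by
          rcases Nat.eq_zero_or_pos i with rfl | h
          · exact absurd hf0.symm had
          · exact h
        have := (hfadj 0 i hi0 hi).1 (by rw [hf0, sup_edge_adj_iff]; right; grind)
        have : i ≠ 1 := by rintro rfl; exact hdb hf1
        congr 1
        omega
      have hfx : ∀ i < n, f i ≠ x := fun i hi h => ((hfC (f i)).2 ⟨i, hi, rfl⟩).2 h
      have hfm : ∀ i < n, f i ∈ C := fun i hi => ((hfC (f i)).2 ⟨i, hi, rfl⟩).1
      refine ⟨n + 1, by omega, fun i => if i = n then x else f i, ?_, ?_, ?_, ?_, ?_⟩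
      · simp [hf0]; omega
      · simpa [show 1 ≠ n by omega]
      · intro y
        constructor
        · intro hy
          by_cases hyx : y = x
          · exact ⟨n, by omega, by simp [hyx]⟩
          · obtain ⟨i, hi, rfl⟩ := (hfC y).1 ⟨hy, hyx⟩
            exact ⟨i, by omega, if_neg (by omega)⟩
        · rintro ⟨i, hi, rfl⟩
          by_cases hin : i = n
          · simpa [hin]
          · simpa [hin] using hfm i (by omega)
      · intro i hi j hj hij
        have := hfx i
        have := hfx j
        have := hinj i
        by_cases hin : i = n <;> by_cases hjn : j = n <;> simp only [hin, hjn, if_true, if_false] at hij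
        · omega
        · exact absurd hij.symm (hfx j (by omega))
        · exact absurd hij (hfx i (by omega))
        · exact hinj i (by omega) j (by omega) hij
      · intro i j hij hj
        have hin : i ≠ n := by omega
        simp only [hin, if_false]
        by_cases hjn : j = n
        · simp only [hjn, if_true]
          rw [H.adj_comm, hNx _ (hfm i (by omega)), ← hf0, ← hfd]
          constructor
          · rintro (h | h)
            · have := hinj i (by omega) 0 (by omega) h; exact Or.inr ⟨this, by simp⟩
            · have := hinj i (by omega) (n - 1) (by omega) h; omega
          · rintro (h | h)
            · right; congr 1; omega
            · left; rw [h.1]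
        · simp only [hjn, if_false]
          have hjn' : j < n := by omega
          have h1 := hfadj i j hij hjn'
          rw [sup_edge_adj_iff] at h1
          have hnad : ∀ k < n, f k = a → k = 0 := fun k hk h => hinj k hk 0 (by omega) (h.trans hf0.symm)
          have hndd : ∀ k < n, f k = d → k = n - 1 := fun k hk h => hinj k hk (n - 1) (by omega) (h.trans hfd.symm)
          constructor
          · intro hadj'
            rcases h1.1 (Or.inl hadj') with h2 | ⟨rfl, h2⟩
            · exact Or.inl h2
            · exfalso
              apply hadj
              rw [← hf0, ← hfd]
              rwa [show n - 1 = j by omega]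
          · rintro (h2 | h2)
            · rcases h1.2 (Or.inl h2) with h3 | ⟨⟨h3, h4⟩ | ⟨h3, h4⟩, h5⟩
              · exact h3
              · have := hnad i (by omega) h3; have := hndd j hjn' h4; omega
              · have := hnad j hjn' h4; omega
            · omega

lemma cycGraph_adj_iff_val {n : ℕ} (hn : 3 ≤ n) (x y : ZMod n) :
    (cycGraph n).Adj x y ↔ (x.val = y.val + 1 ∨ y.val = x.val + 1 ∨ (x.val = 0 ∧ y.val + 1 = n) ∨
      (y.val = 0 ∧ x.val + 1 = n)) := by
  have : NeZero n := ⟨by omega⟩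
  have : Fact (1 < n) := ⟨by omega⟩
  have key : ∀ x y : ZMod n, x = y + 1 ↔ x.val = y.val + 1 ∨ (x.val = 0 ∧ y.val + 1 = n) := by
    intro x y
    rw [← (ZMod.val_injective n).eq_iff, ZMod.val_add, ZMod.val_one]
    have hx := x.val_lt
    have hy := y.val_lt
    by_cases h : y.val + 1 = n
    · rw [h, Nat.mod_self]; omega
    · rw [Nat.mod_eq_of_lt (by omega)]; omega
  simp only [cycGraph, fromRel_adj, key, ne_eq]
  rw [← (ZMod.val_injective n).eq_iff]
  omega

/-- An induced cycle is isomorphic to a standard cycle, with any prescribed edge going to the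
edge `{0, 1}`. -/
lemma IsCyc.exists_iso [Finite V] (h : IsCyc H C) {a b : V} (ha : a ∈ C) (hb : b ∈ C)
    (hab : H.Adj a b) : ∃ n : ℕ, 3 ≤ n ∧ ∃ e : cycGraph n ≃g H.induce C,
      (e 0 : V) = a ∧ (e 1 : V) = b := by
  obtain ⟨n, hn, f, hf0, hf1, hfC, hinj, hfadj⟩ := h.exists_enum ha hb hab
  have : NeZero n := ⟨by omega⟩
  have : Fact (1 < n) := ⟨by omega⟩
  let g : ZMod n → C := fun z => ⟨f z.val, (hfC _).2 ⟨z.val, z.val_lt, rfl⟩⟩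
  have hg : Function.Bijective g := by
    constructor
    · intro x y hxy
      exact ZMod.val_injective n (hinj _ x.val_lt _ y.val_lt (congrArg Subtype.val hxy))
    · rintro ⟨y, hy⟩
      obtain ⟨i, hi, rfl⟩ := (hfC y).1 hy
      exact ⟨(i : ZMod n), Subtype.ext (by simp [g, ZMod.val_natCast_of_lt hi])⟩
  refine ⟨n, hn, ⟨Equiv.ofBijective g hg, ?_⟩, ?_, ?_⟩
  · intro x y
    change H.Adj (f x.val) (f y.val) ↔ _
    rw [cycGraph_adj_iff_val hn]
    have hx := x.val_lt
    have hy := y.val_lt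
    rcases lt_trichotomy x.val y.val with h | h | h
    · rw [hfadj _ _ h hy]; omega
    · rw [h]; exact iff_of_false H.irrefl (by omega)
    · rw [H.adj_comm, hfadj _ _ h hx]; omega
  · simp [g, hf0]
  · simp [g, hf1, ZMod.val_one]

lemma isCyc_range {n : ℕ} (hn : 3 ≤ n) (e : cycGraph n ↪g H) : IsCyc H (Set.range e) := by
  have : NeZero n := ⟨by omega⟩
  have : Fact (1 < n) := ⟨by omega⟩
  have h10 : (1 : ZMod n) ≠ 0 := one_ne_zero
  have h20 : (1 : ZMod n) + 1 ≠ 0 := by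
    intro h
    have h2 : ((2 : ℕ) : ZMod n) = 0 := by push_cast; rw [← h]; norm_num
    rw [ZMod.natCast_eq_zero_iff] at h2
    have := Nat.le_of_dvd (by norm_num) h2
    omega
  have hadj : ∀ x y, H.Adj (e x) (e y) ↔ y = x + 1 ∨ y = x - 1 := by
    intro x y
    rw [e.map_adj_iff, cycGraph, fromRel_adj]
    constructor
    · rintro ⟨-, rfl | rfl⟩ <;> simp
    · rintro (rfl | rfl)
      · simp
      · simp [eq_comm (a := x)]
  refine ⟨⟨e 0, 0, rfl⟩, ?_, ?_⟩
  · rintro A ⟨x, hx⟩ hA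
    refine Set.Subset.antisymm hA.1 ?_
    obtain ⟨z, rfl⟩ := hA.1 hx
    have hk : ∀ k : ℕ, e (z + k) ∈ A := by
      intro k
      induction k with
      | zero => simpa
      | succ k ih =>
        have := hA.2.2 _ ih (e (z + (k + 1 : ℕ))) ⟨_, rfl⟩ ((hadj _ _).2 (Or.inl (by push_cast; ring)))
        simpa using this
    rintro _ ⟨w, rfl⟩
    have := hk (w - z).val
    rwa [ZMod.natCast_val, ZMod.cast_id, add_sub_cancel] at this
  · rintro _ ⟨x, rfl⟩
    refine ⟨e (x + 1), ⟨_, rfl⟩, e (x - 1), ⟨_, rfl⟩, ?_, ?_⟩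
    · intro h
      have := e.injective h
      apply h20
      linear_combination this
    · rintro _ ⟨y, rfl⟩
      rw [hadj, e.injective.eq_iff, e.injective.eq_iff]

lemma IsCyc.exists_edge (h : IsCyc H C) : ∃ a ∈ C, ∃ b ∈ C, H.Adj a b := by
  obtain ⟨x, hx⟩ := h.1
  obtain ⟨a, ha, b, hb, hab, hN⟩ := h.2.2 x hx
  exact ⟨x, hx, a, ha, (hN a ha).2 (Or.inl rfl)⟩

lemma isChordlessCycle_iff [Finite V] : IsChordlessCycle H C ↔ IsCyc H C := by
  constructor
  · rintro ⟨n, hn, ⟨e⟩⟩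
    have := isCyc_range hn ((Embedding.induce C).comp e.symm.toEmbedding)
    convert this
    ext y
    constructor
    · intro hy
      exact ⟨e ⟨y, hy⟩, by simp⟩
    · rintro ⟨z, rfl⟩
      simp
  · intro h
    obtain ⟨a, ha, b, hb, hab⟩ := h.exists_edge
    obtain ⟨n, hn, e, -⟩ := h.exists_iso ha hb hab
    exact ⟨n, hn, ⟨e.symm⟩⟩

end Cyc

/-! ### Trees of cycles inside a fixed vertex set -/

/-- The subgraph of `H` induced by the given set is a tree of cycles. -/
inductive ToC {V : Type} (H : SimpleGraph V) : Set V → Prop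
  | cyc (S : Set V) (h : IsCyc H S) : ToC H S
  | glue (S C : Set V) (a b : V) (hS : ToC H S) (hC : IsCyc H C) (hab : H.Adj a b)
      (hSC : S ∩ C = {a, b}) (hx : ∀ x ∈ S, ∀ y ∈ C, H.Adj x y → y ∈ S ∨ x ∈ C) : ToC H (S ∪ C)

section ToC

variable {V : Type} {H H' : SimpleGraph V} {S S' C C' A X : Set V} {a b u v x p q : V}

lemma IsCyc.exists_ne_ne (h : IsCyc H C) (u v : V) : ∃ y ∈ C, y ≠ u ∧ y ≠ v := by
  obtain ⟨x, hx⟩ := h.1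
  obtain ⟨a, ha, b, hb, hab, hN⟩ := h.2.2 x hx
  have h1 := ((hN a ha).2 (Or.inl rfl)).ne
  have h2 := ((hN b hb).2 (Or.inr rfl)).ne
  by_contra hc
  push Not at hc
  have h3 := hc x hx
  have h4 := hc a ha
  have h5 := hc b hb
  by_cases hxu : x = u
  · exact hab ((h4 (hxu ▸ h1.symm)).trans (h5 (hxu ▸ h2.symm)).symm)
  · by_cases hau : a = u
    · exact h2 ((h3 hxu).trans (h5 (hau ▸ hab.symm)).symm)
    · exact h1 ((h3 hxu).trans (h4 hau).symm)

lemma ToC.exists_ne_ne (h : ToC H S) (u v : V) : ∃ y ∈ S, y ≠ u ∧ y ≠ v := by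
  induction h with
  | cyc S h => exact h.exists_ne_ne u v
  | glue S C a b hS hC hab hSC hx ih =>
    obtain ⟨y, hy, h⟩ := ih
    exact ⟨y, Or.inl hy, h⟩

lemma ToC.congr (h : ToC H S) (hH : ∀ x ∈ S, ∀ y ∈ S, H.Adj x y ↔ H'.Adj x y) : ToC H' S := by
  induction h with
  | cyc S h => exact .cyc S (h.congr hH)
  | glue S C a b hS hC hab hSC hx ih =>
    have ha : a ∈ S ∩ C := hSC ▸ by simp
    have hb : b ∈ S ∩ C := hSC ▸ by simp
    exact .glue S C a b (ih fun x hx y hy => hH x (Or.inl hx) y (Or.inl hy))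
      (hC.congr fun x hx y hy => hH x (Or.inr hx) y (Or.inr hy))
      ((hH a (Or.inl ha.1) b (Or.inl hb.1)).1 hab) hSC
      fun x h1 y h2 h => hx x h1 y h2 ((hH x (Or.inl h1) y (Or.inr h2)).2 h)

lemma IsCyc.exists_adj_ne (h : IsCyc H C) (hu : u ∈ C) (v : V) : ∃ y ∈ C, H.Adj u y ∧ y ≠ v := by
  obtain ⟨a, ha, b, hb, hab, hN⟩ := h.2.2 u hu
  by_cases hav : a = v
  · exact ⟨b, hb, (hN b hb).2 (Or.inr rfl), fun h => hab (hav.trans h.symm)⟩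
  · exact ⟨a, ha, (hN a ha).2 (Or.inl rfl), hav⟩

lemma IsCyc.biConn [Finite V] (h : IsCyc H C) : BiConn H C := by
  refine ⟨h.2.1, fun p hp A hne hA => ?_⟩
  obtain ⟨c, hc, hpc, -⟩ := h.exists_adj_ne hp p
  obtain ⟨e, he, hce, hep⟩ := h.exists_adj_ne hc p
  have hpA : p ∉ A := fun h => hA.2.1 p h rfl
  have hne' : (A \ {c}).Nonempty := by
    obtain ⟨y, hy⟩ := hne
    by_cases hyc : y = c
    · subst hyc
      exact ⟨e, (hA.2.2 y hy e he hce).resolve_right hep, hce.ne'⟩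
    · exact ⟨y, hy, hyc⟩
  have h1 := h.eq_of_closedIn hp hc hpc hne' ⟨fun y hy => hA.1 hy.1, by
    rintro y hy (rfl | h')
    · exact hpA hy.1
    · exact hy.2 h', fun y hy z hz hyz => by
      by_cases hzc : z = c
      · simp [hzc]
      · exact (hA.2.2 y hy.1 z hz hyz).imp (fun h => ⟨h, hzc⟩) (fun h => Or.inl h)⟩
  have heA : e ∈ A := by
    have : e ∈ A \ {c} := by rw [h1]; simp [he, hep, hce.ne']
    exact this.1
  have hcA : c ∈ A := (hA.2.2 e heA c hc hce.symm).resolve_right hpc.ne'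
  ext y
  by_cases hyc : y = c
  · subst hyc
    simp [hcA, hc, hpc.ne']
  · have h2 : y ∈ A \ {c} ↔ y ∈ A := by simp [hyc]
    rw [← h2, h1]
    simp [hyc]

/-- A set closed away from `X` in `S` extends to `S ∪ C` when `C` is glued onto `S`. -/
lemma ClosedIn.glue (hA : ClosedIn H S X A) (hX : X ⊆ S) (hab : H.Adj a b) (hSC : S ∩ C = {a, b})
    (hx : ∀ x ∈ S, ∀ y ∈ C, H.Adj x y → y ∈ S ∨ x ∈ C) :
    ClosedIn H (S ∪ C) X (A ∪ {y | y ∈ C \ S ∧ (a ∈ A ∨ b ∈ A)}) := by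
  have ha : a ∈ S ∩ C := hSC ▸ by simp
  have hb : b ∈ S ∩ C := hSC ▸ by simp
  have hmem : ∀ y ∈ S, y ∈ C → y = a ∨ y = b := fun y h1 h2 => by
    have : y ∈ S ∩ C := ⟨h1, h2⟩
    rw [hSC] at this
    exact this
  refine ⟨?_, ?_, ?_⟩
  · rintro y (hy | hy)
    · exact Or.inl (hA.1 hy)
    · exact Or.inr hy.1.1
  · rintro y (hy | hy) h
    · exact hA.2.1 y hy h
    · exact hy.1.2 (hX h)
  · rintro y (hy | ⟨⟨hy, hyS⟩, hor⟩) z hz hyz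
    · by_cases hzS : z ∈ S
      · exact (hA.2.2 y hy z hzS hyz).imp_left Or.inl
      · have hzC := hz.resolve_left hzS
        have hyC := (hx y (hA.1 hy) z hzC hyz).resolve_left hzS
        refine Or.inl (Or.inr ⟨⟨hzC, hzS⟩, ?_⟩)
        rcases hmem y (hA.1 hy) hyC with rfl | rfl
        · exact Or.inl hy
        · exact Or.inr hy
    · by_cases hzS : z ∈ S
      · have hzC := (hx z hzS y hy hyz.symm).resolve_left hyS
        have h1 : a ∈ A → b ∈ A ∨ b ∈ X := fun h => hA.2.2 a h b hb.1 hab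
        have h2 : b ∈ A → a ∈ A ∨ a ∈ X := fun h => hA.2.2 b h a ha.1 hab.symm
        have : z ∈ A ∨ z ∈ X := by
          rcases hmem z hzS hzC with rfl | rfl <;> tauto
        exact this.imp_left Or.inl
      · exact Or.inl (Or.inr ⟨⟨hz.resolve_left hzS, hzS⟩, hor⟩)

lemma pair_eq_pair_of_mem (huv : u ≠ v) (hu : u ∈ ({p, q} : Set V)) (hv : v ∈ ({p, q} : Set V)) :
    ({p, q} : Set V) = {u, v} := by
  rcases hu with rfl | rfl <;> rcases hv with rfl | rfl
  · exact absurd rfl huv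
  · rfl
  · exact Set.pair_comm _ _
  · exact absurd rfl huv

/-- A separation of `S` lifts to `S ∪ C` when `C` is glued onto `S`. -/
lemma TwoSep.glue (h : TwoSep H S X) (hX : X ⊆ S) (hab : H.Adj a b) (hSC : S ∩ C = {a, b})
    (hx : ∀ x ∈ S, ∀ y ∈ C, H.Adj x y → y ∈ S ∨ x ∈ C) : TwoSep H (S ∪ C) X := by
  obtain ⟨A, B, hA, hB, hd, hcA, hcB⟩ := h
  have ha : a ∈ S ∩ C := hSC ▸ by simp
  have hb : b ∈ S ∩ C := hSC ▸ by simp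
  refine ⟨_, _, hA.mono Set.subset_union_left, hB.mono Set.subset_union_left, ?_,
    hcA.glue hX hab hSC hx, hcB.glue hX hab hSC hx⟩
  rw [Set.disjoint_left] at *
  rintro y (hy | ⟨hy, h1⟩) (hy' | ⟨hy', h2⟩)
  · exact hd hy hy'
  · exact hy'.2 (hcA.1 hy)
  · exact hy.2 (hcB.1 hy')
  · rcases h1 with h1 | h1 <;> rcases h2 with h2 | h2
    · exact hd h1 h2
    · rcases hcA.2.2 a h1 b hb.1 hab with h | h
      exacts [hd h h2, hcB.2.1 b h2 h]
    · rcases hcA.2.2 b h1 a ha.1 hab.symm with h | h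
      exacts [hd h h2, hcB.2.1 a h2 h]
    · exact hd h1 h2

/-- The edge along which a cycle is glued is a separator. -/
lemma twoSep_of_glue (hS : ∃ y ∈ S, y ≠ a ∧ y ≠ b) (hC : ∃ y ∈ C, y ≠ a ∧ y ≠ b)
    (hEq : S ∩ C = {a, b}) (hx : ∀ x ∈ S, ∀ y ∈ C, H.Adj x y → y ∈ S ∨ x ∈ C) :
    TwoSep H (S ∪ C) {a, b} := by
  have hmem : ∀ y ∈ S, y ∈ C → y ∈ ({a, b} : Set V) := fun y h1 h2 => hEq ▸ ⟨h1, h2⟩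
  obtain ⟨y, hy, hya, hyb⟩ := hS
  obtain ⟨z, hz, hza, hzb⟩ := hC
  refine ⟨S \ {a, b}, C \ {a, b}, ⟨y, hy, by simp [hya, hyb]⟩, ⟨z, hz, by simp [hza, hzb]⟩,
    ?_, ⟨fun y hy => Or.inl hy.1, fun y hy => hy.2, ?_⟩,
    ⟨fun y hy => Or.inr hy.1, fun y hy => hy.2, ?_⟩⟩
  · rw [Set.disjoint_left]
    exact fun y h1 h2 => h1.2 (hmem y h1.1 h2.1)
  · intro y hy z hz hyz
    by_cases hzX : z ∈ ({a, b} : Set V)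
    · exact Or.inr hzX
    · refine Or.inl ⟨hz.elim id fun hzC => ?_, hzX⟩
      exact (hx y hy.1 z hzC hyz).resolve_right fun h => hy.2 (hmem y hy.1 h)
  · intro y hy z hz hyz
    by_cases hzX : z ∈ ({a, b} : Set V)
    · exact Or.inr hzX
    · refine Or.inl ⟨hz.elim (fun hzS => ?_) id, hzX⟩
      exact (hx z hzS y hy.1 hyz.symm).resolve_left fun h => hy.2 (hmem y h hy.1)

lemma insert_inter_of_notMem {S C : Set V} (hx : x ∉ C) : insert x S ∩ C = S ∩ C := by
  ext y
  simp only [Set.mem_inter_iff, Set.mem_insert_iff]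
  constructor
  · rintro ⟨rfl | h, h'⟩
    · exact absurd h' hx
    · exact ⟨h, h'⟩
  · exact fun h => ⟨Or.inr h.1, h.2⟩

/-- Subdividing an edge which is not a separator preserves trees of cycles. -/
lemma ToC.subdivide (h : ToC (H ⊔ edge a b) S) (hab : a ≠ b) (hnab : ¬ H.Adj a b) (ha : a ∈ S)
    (hb : b ∈ S) (hx : x ∉ S) (hN : ∀ y ∈ S, H.Adj x y ↔ y = a ∨ y = b)
    (hts : ¬ TwoSep (H ⊔ edge a b) S {a, b}) : ToC H (insert x S) := by
  have hiff : ∀ y z, ¬ (y = a ∧ z = b) → ¬ (y = b ∧ z = a) →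
      ((H ⊔ edge a b).Adj y z ↔ H.Adj y z) := by
    intro y z h1 h2
    rw [sup_edge_adj_iff]
    tauto
  have hadj' : (H ⊔ edge a b).Adj a b := by rw [sup_edge_adj_iff]; tauto
  have hcongr : ∀ T : Set V, ¬ (a ∈ T ∧ b ∈ T) → ∀ y ∈ T, ∀ z ∈ T,
      ((H ⊔ edge a b).Adj y z ↔ H.Adj y z) := by
    intro T hT y hy z hz
    apply hiff
    · rintro ⟨rfl, rfl⟩; exact hT ⟨hy, hz⟩
    · rintro ⟨rfl, rfl⟩; exact hT ⟨hz, hy⟩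
  induction h with
  | cyc S h => exact .cyc _ (h.subdivide hx ha hb hab hN hnab)
  | glue S C p q hS hC hpq hSC hcross ih =>
    have hp : p ∈ S ∩ C := hSC ▸ by simp
    have hq : q ∈ S ∩ C := hSC ▸ by simp
    simp only [Set.mem_union, not_or] at hx
    by_cases hS' : a ∈ S ∧ b ∈ S
    · by_cases hC' : a ∈ C ∧ b ∈ C
      · exfalso
        apply hts
        have haSC : a ∈ S ∩ C := ⟨hS'.1, hC'.1⟩
        have hbSC : b ∈ S ∩ C := ⟨hS'.2, hC'.2⟩
        rw [hSC] at haSC hbSC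
        exact twoSep_of_glue (hS.exists_ne_ne a b) (hC.exists_ne_ne a b)
          (hSC.trans (pair_eq_pair_of_mem hab haSC hbSC)) hcross
      · have hS2 : ¬ TwoSep (H ⊔ edge a b) S {a, b} := by
          intro h
          refine hts (h.glue ?_ hpq hSC hcross)
          rintro y (rfl | rfl)
          exacts [hS'.1, hS'.2]
        have h1 := ih hS'.1 hS'.2 hx.1 (fun y hy => hN y (Or.inl hy)) hS2
        rw [← Set.insert_union]
        refine .glue _ C p q h1 (hC.congr (hcongr C hC'))
          ((hcongr C hC' p hp.2 q hq.2).1 hpq) ?_ ?_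
        · rw [insert_inter_of_notMem hx.2, hSC]
        · rintro y (rfl | hy) z hz hyz
          · rcases (hN z (Or.inr hz)).1 hyz with rfl | rfl
            · exact Or.inl (Or.inr hS'.1)
            · exact Or.inl (Or.inr hS'.2)
          · exact (hcross y hy z hz (Or.inl hyz)).imp_left Or.inr
    · have hC' : a ∈ C ∧ b ∈ C := by
        rcases ha with ha | ha <;> rcases hb with hb | hb
        · exact absurd ⟨ha, hb⟩ hS'
        · have := hcross a ha b hb hadj'; tauto
        · have := hcross b hb a ha hadj'.symm; tauto
        · exact ⟨ha, hb⟩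
      rw [← Set.union_insert]
      refine .glue S _ p q (hS.congr (hcongr S hS'))
        (hC.subdivide hx.2 hC'.1 hC'.2 hab (fun y hy => hN y (Or.inr hy)) hnab)
        ((hcongr S hS' p hp.1 q hq.1).1 hpq) ?_ ?_
      · rw [Set.inter_comm, insert_inter_of_notMem hx.1, Set.inter_comm, hSC]
      · rintro y hy z (rfl | hz) hyz
        · rcases (hN y (Or.inl hy)).1 hyz.symm with rfl | rfl
          · exact Or.inr (Or.inr hC'.1)
          · exact Or.inr (Or.inr hC'.2)
        · exact (hcross y hy z hz (Or.inl hyz)).imp_right Or.inr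

/-- A 2-connected graph of treewidth two in which every pair separating three components is
adjacent is a tree of cycles. -/
lemma BiConn.toC [Finite V] (hb : BiConn H S) (h3 : 3 ≤ S.ncard) (he : Elim2 H S)
    (hs : ∀ u ∈ S, ∀ v ∈ S, u ≠ v → ¬ H.Adj u v → ¬ ThreeSep H S {u, v}) : ToC H S := by
  induction hn : S.ncard using Nat.strong_induction_on generalizing H S with
  | _ n ih =>
    subst hn
    obtain ⟨x, hx, a, ha, b, hbS, hab, hax, hbx, hN, hel, hr⟩ := hb.exists_reduction h3 he
    have hxa : H.Adj x a := (hN a ha).2 (Or.inl rfl)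
    have hxb : H.Adj x b := (hN b hbS).2 (Or.inr rfl)
    have hcard := Set.ncard_sdiff_singleton_add_one hx S.toFinite
    by_cases hS3 : S.ncard = 3
    · have hS : S = {x, a, b} := by
        symm
        apply Set.eq_of_subset_of_ncard_le
        · rintro y (rfl | rfl | rfl) <;> assumption
        · rw [hS3, (Set.ncard_eq_three.2 ⟨x, a, b, hax.symm, hbx.symm, hab, rfl⟩)]
        · exact S.toFinite
      have hadj : H.Adj a b := by
        by_contra hc
        refine hb.not_nbr_subsingleton h3 (c := x) ha fun y hy hay => ?_
        rw [hS] at hy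
        rcases hy with rfl | rfl | rfl
        · rfl
        · exact absurd rfl hay.ne
        · exact absurd hay hc
      exact .cyc _ (hS ▸ isCyc_triangle hxa hxb hadj)
    · have hT : ToC (H ⊔ edge a b) (S \ {x}) := by
        refine ih (S \ {x}).ncard (by omega) (hr.biConn hb) (by omega) hel ?_ rfl
        intro u hu v hv huv hnadj ht
        refine hs u hu.1 v hv.1 huv (fun h => hnadj (Or.inl h)) (hr.threeSep ?_ ht)
        rintro y (rfl | rfl) <;> assumption
      by_cases hadj : H.Adj a b
      · have hT' : ToC H (S \ {x}) := hT.congr fun y _ z _ => by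
          rw [sup_edge_adj_iff]
          constructor
          · rintro (h | ⟨⟨rfl, rfl⟩ | ⟨rfl, rfl⟩, -⟩)
            exacts [h, hadj, hadj.symm]
          · exact Or.inl
        have hSU : S = S \ {x} ∪ {x, a, b} := by
          ext y
          simp only [Set.mem_union, Set.mem_sdiff, Set.mem_singleton_iff, Set.mem_insert_iff]
          by_cases hyx : y = x
          · simp [hyx, hx]
          · constructor
            · exact fun h => Or.inl ⟨h, hyx⟩
            · rintro (h | h | rfl | rfl)
              · exact h.1
              · exact absurd h hyx
              · exact ha
              · exact hbS
        rw [hSU]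
        refine .glue _ _ a b hT' (isCyc_triangle hxa hxb hadj) hadj ?_ ?_
        · ext y
          simp only [Set.mem_inter_iff, Set.mem_sdiff, Set.mem_singleton_iff, Set.mem_insert_iff]
          grind
        · rintro y hy z hz hyz
          rcases hz with rfl | rfl | rfl
          · right
            rcases (hN y hy.1).1 hyz.symm with rfl | rfl <;> simp
          · exact Or.inl ⟨ha, hax⟩
          · exact Or.inl ⟨hbS, hbx⟩
      · have hX : ({a, b} : Set V) ⊆ S \ {x} := by
          rintro y (rfl | rfl)
          exacts [⟨ha, hax⟩, ⟨hbS, hbx⟩]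
        have := hT.subdivide hab hadj ⟨ha, hax⟩ ⟨hbS, hbx⟩ (x := x) (by simp)
          (fun y hy => hN y hy.1) fun ht => hs a ha b hbS hab hadj
            (hr.threeSep_of_twoSep hX hx (fun y hy h => by simpa using (hN y hy).1 h) ht)
        rwa [Set.insert_sdiff_singleton, Set.insert_eq_of_mem hx] at this

lemma Elim2.glue [Finite V] (h : Elim2 H S) (hC : IsCyc H C) (hab : H.Adj a b)
    (hSC : S ∩ C = {a, b}) (hx : ∀ x ∈ S, ∀ y ∈ C, H.Adj x y → y ∈ S ∨ x ∈ C) :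
    Elim2 H (S ∪ C) := by
  induction hn : C.ncard using Nat.strong_induction_on generalizing H C with
  | _ n ih =>
    subst hn
    have ha : a ∈ S ∩ C := hSC ▸ by simp
    have hb : b ∈ S ∩ C := hSC ▸ by simp
    have hmem : ∀ y ∈ S, y ∈ C → y = a ∨ y = b := fun y h1 h2 => by
      have : y ∈ S ∩ C := ⟨h1, h2⟩
      rw [hSC] at this
      exact this
    obtain ⟨x, hxC, hxa, hxb⟩ := hC.exists_ne_ne a b
    have hxS : x ∉ S := fun h => by
      rcases hmem x h hxC with h | h
      exacts [hxa h, hxb h]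
    obtain ⟨c, hc, d, hd, hcd, hN⟩ := hC.2.2 x hxC
    have hxc : H.Adj x c := (hN c hc).2 (Or.inl rfl)
    have hxd : H.Adj x d := (hN d hd).2 (Or.inr rfl)
    have hN' : ∀ y ∈ S ∪ C, H.Adj x y → y = c ∨ y = d := by
      rintro y (hy | hy) hxy
      · exact (hN y ((hx y hy x hxC hxy.symm).resolve_left hxS)).1 hxy
      · exact (hN y hy).1 hxy
    have hdiff : (S ∪ C) \ {x} = S ∪ (C \ {x}) := by
      ext y
      simp only [Set.mem_union, Set.mem_sdiff, Set.mem_singleton_iff]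
      have : y = x → y ∉ S := by rintro rfl; exact hxS
      tauto
    refine .step _ _ x c d (Or.inr hxC) hN' ?_
    rw [hdiff]
    by_cases hadj : H.Adj c d
    · have hC3 := hC.eq_triangle hxC hc hd hxc hxd hadj
      have habcd : (a = c ∧ b = d) ∨ (a = d ∧ b = c) := by
        have h1 := ha.2
        have h2 := hb.2
        have := hab.ne
        rw [hC3] at h1 h2
        simp only [Set.mem_singleton_iff, Set.mem_insert_iff] at h1 h2
        grind
      refine h.mono ?_ fun y _ z _ hyz => ?_
      · rintro y (hy | ⟨hy, hyx⟩)
        · exact hy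
        · rw [hC3] at hy
          rcases hy with rfl | rfl | rfl
          · exact absurd rfl hyx
          · rcases habcd with ⟨rfl, rfl⟩ | ⟨rfl, rfl⟩
            exacts [ha.1, hb.1]
          · rcases habcd with ⟨rfl, rfl⟩ | ⟨rfl, rfl⟩
            exacts [hb.1, ha.1]
      · rw [sup_edge_adj_iff] at hyz
        rcases hyz with h | ⟨⟨rfl, rfl⟩ | ⟨rfl, rfl⟩, -⟩
        exacts [h, hadj, hadj.symm]
    · have hnS : ¬ (c ∈ S ∧ d ∈ S) := by
        rintro ⟨h1, h2⟩
        have h1 := hmem c h1 hc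
        have h2 := hmem d h2 hd
        have := hab.symm
        grind
      refine ih (C \ {x}).ncard (Set.ncard_sdiff_singleton_lt_of_mem hxC C.toFinite) ?_
        (hC.smooth hxC hc hd hcd hN hadj) (Or.inl hab) ?_ ?_ rfl
      · refine h.mono subset_rfl fun y hy z hz hyz => ?_
        rw [sup_edge_adj_iff] at hyz
        rcases hyz with h | ⟨⟨rfl, rfl⟩ | ⟨rfl, rfl⟩, -⟩
        exacts [h, absurd ⟨hy, hz⟩ hnS, absurd ⟨hz, hy⟩ hnS]
      · rw [← hSC]
        ext y
        simp only [Set.mem_inter_iff, Set.mem_sdiff, Set.mem_singleton_iff]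
        have : y = x → y ∉ S := by rintro rfl; exact hxS
        tauto
      · intro y hy z hz hyz
        rw [sup_edge_adj_iff] at hyz
        have hyx : y ∉ ({x} : Set V) := by rintro rfl; exact hxS hy
        rcases hyz with h | ⟨⟨rfl, rfl⟩ | ⟨rfl, rfl⟩, -⟩
        · exact (hx y hy z hz.1 h).imp_right fun h => ⟨h, hyx⟩
        · exact Or.inr ⟨hc, hyx⟩
        · exact Or.inr ⟨hd, hyx⟩

lemma ToC.elim2 [Finite V] (h : ToC H S) : Elim2 H S := by
  induction h with
  | cyc S h =>
    obtain ⟨a, ha, b, hb, hab⟩ := h.exists_edge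
    have hsub : ({a, b} : Set V) ⊆ S := by
      rintro y (rfl | rfl) <;> assumption
    have := (Elim2.small H {a, b} (Set.ncard_insert_le a {b} |>.trans (by simp))).glue h hab
      (Set.inter_eq_left.2 hsub) fun x hx y hy hxy => Or.inr (hsub hx)
    rwa [Set.union_eq_right.2 hsub] at this
  | glue S C a b hS hC hab hSC hx ih => exact ih.glue hC hab hSC hx

/-- Every part of the separation given by an edge contains a cycle through that edge. -/
lemma ToC.exists_cyc [Finite V] (h : ToC H S) (hu : u ∈ S) (hv : v ∈ S) (huv : H.Adj u v)
    (hne : A.Nonempty) (hA : ClosedIn H S {u, v} A) :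
    ∃ C ⊆ S, IsCyc H C ∧ u ∈ C ∧ v ∈ C ∧ C \ {u, v} ⊆ A := by
  induction h generalizing u v A with
  | cyc S h => exact ⟨S, subset_rfl, h, hu, hv, (h.eq_of_closedIn hu hv huv hne hA).ge⟩
  | glue S C p q hS hC hpq hSC hcross ih =>
    have hp : p ∈ S ∩ C := hSC ▸ by simp
    have hq : q ∈ S ∩ C := hSC ▸ by simp
    have hmem : ∀ y ∈ S, y ∈ C → y ∈ ({p, q} : Set V) := fun y h1 h2 => hSC ▸ ⟨h1, h2⟩
    have hres : ∀ T ⊆ S ∪ C, ClosedIn H T {u, v} (A ∩ T) := fun T hT =>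
      ⟨Set.inter_subset_right, fun y hy => hA.2.1 y hy.1, fun y hy z hz hyz =>
        (hA.2.2 y hy.1 z (hT hz) hyz).imp_left fun h => ⟨h, hz⟩⟩
    by_cases hS' : (u ∈ S ∧ v ∈ S) ∧ (A ∩ S).Nonempty
    · obtain ⟨D, hD, h1, h2, h3, h4⟩ := ih hS'.1.1 hS'.1.2 huv hS'.2 (hres S Set.subset_union_left)
      exact ⟨D, hD.trans Set.subset_union_left, h1, h2, h3, h4.trans Set.inter_subset_left⟩
    by_cases hC' : (u ∈ C ∧ v ∈ C) ∧ (A ∩ C).Nonempty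
    · have := hC.eq_of_closedIn hC'.1.1 hC'.1.2 huv hC'.2 (hres C Set.subset_union_right)
      exact ⟨C, Set.subset_union_right, hC, hC'.1.1, hC'.1.2, this.ge.trans Set.inter_subset_left⟩
    exfalso
    have key : ∀ y ∈ ({p, q} : Set V), ∀ z ∈ A, H.Adj z y → y ∉ A → y = u ∨ y = v := by
      intro y hy z hz hzy hyA
      have hySC : y ∈ S ∩ C := hSC ▸ hy
      exact (hA.2.2 z hz y (Or.inl hySC.1) hzy).resolve_left hyA
    by_cases huvS : u ∈ S ∧ v ∈ S
    · have hAS : ∀ y ∈ A, y ∉ S := fun y hy h => hS' ⟨huvS, y, hy, h⟩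
      have hAC : A ⊆ C := fun y hy => (hA.1 hy).resolve_left (hAS y hy)
      have hEq := hC.eq_of_closedIn hp.2 hq.2 hpq hne ⟨hAC, by
        rintro y hy (rfl | rfl)
        exacts [hAS _ hy hp.1, hAS _ hy hq.1], fun y hy z hz hyz =>
          (hA.2.2 y hy z (Or.inr hz) hyz).imp_right fun h => hmem z (by
            rcases h with rfl | rfl
            exacts [huvS.1, huvS.2]) hz⟩
      obtain ⟨y, hy, hpy, hyq⟩ := hC.exists_adj_ne hp.2 q
      obtain ⟨z, hz, hqz, hzp⟩ := hC.exists_adj_ne hq.2 p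
      have h1 := key p (by simp) y (by rw [hEq]; simp [hy, hpy.ne', hyq]) hpy.symm (hAS p · hp.1)
      have h2 := key q (by simp) z (by rw [hEq]; simp [hz, hqz.ne', hzp]) hqz.symm (hAS q · hq.1)
      have huC : u ∈ C := by have := hpq.ne; have := hp.2; have := hq.2; grind
      have hvC : v ∈ C := by have := hpq.ne; have := hp.2; have := hq.2; grind
      obtain ⟨w, hw⟩ := hne
      exact hC' ⟨⟨huC, hvC⟩, w, hw, hAC hw⟩
    · have huvC : u ∈ C ∧ v ∈ C := by
        rcases hu with hu | hu <;> rcases hv with hv | hv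
        · exact absurd ⟨hu, hv⟩ huvS
        · have := hcross u hu v hv huv; tauto
        · have := hcross v hv u hu huv.symm; tauto
        · exact ⟨hu, hv⟩
      have hAC : ∀ y ∈ A, y ∉ C := fun y hy h => hC' ⟨huvC, y, hy, h⟩
      have hAS : A ⊆ S := fun y hy => (hA.1 hy).resolve_right (hAC y hy)
      obtain ⟨D, hDS, hD, hpD, hqD, hDA⟩ := ih hp.1 hq.1 hpq hne ⟨hAS, by
        rintro y hy (rfl | rfl)
        exacts [hAC _ hy hp.2, hAC _ hy hq.2], fun y hy z hz hyz =>
          (hA.2.2 y hy z (Or.inl hz) hyz).imp_right fun h => hmem z hz (by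
            rcases h with rfl | rfl
            exacts [huvC.1, huvC.2])⟩
      obtain ⟨y, hy, hpy, hyq⟩ := hD.exists_adj_ne hpD q
      obtain ⟨z, hz, hqz, hzp⟩ := hD.exists_adj_ne hqD p
      have h1 := key p (by simp) y (hDA (by simp [hy, hpy.ne', hyq])) hpy.symm (hAC p · hp.2)
      have h2 := key q (by simp) z (hDA (by simp [hz, hqz.ne', hzp])) hqz.symm (hAC q · hq.2)
      apply huvS
      have := hpq.ne; have := hp.1; have := hq.1; grind

lemma IsCyc.eq_of_not_subset [Finite V] (hD : IsCyc H C') (hC : IsCyc H C) (hpq : H.Adj p q)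
    (hSC : S ∩ C = {p, q}) (hx : ∀ x ∈ S, ∀ y ∈ C, H.Adj x y → y ∈ S ∨ x ∈ C)
    (hsub : C' ⊆ S ∪ C) (hn : ¬ C' ⊆ S) : C' = C := by
  have hmem : ∀ y ∈ S, y ∈ C → y ∈ ({p, q} : Set V) := fun y h1 h2 => hSC ▸ ⟨h1, h2⟩
  have hp : p ∈ S ∩ C := hSC ▸ by simp
  have hq : q ∈ S ∩ C := hSC ▸ by simp
  refine hC.eq_of_subset hD fun y hy => ?_
  by_contra hyC
  have hyS := (hsub hy).resolve_right hyC
  have hne : (C' \ S).Nonempty := by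
    rw [Set.not_subset] at hn
    obtain ⟨w, h1, h2⟩ := hn
    exact ⟨w, h1, h2⟩
  have hcl : ∀ X : Set V, X ⊆ S → (∀ z ∈ C', z ∈ ({p, q} : Set V) → z ∈ X) →
      ClosedIn H C' X (C' \ S) := by
    refine fun X hXS hX => ⟨Set.sdiff_subset, fun w hw h => hw.2 (hXS h), fun w hw z hz hwz => ?_⟩
    by_cases hzS : z ∈ S
    · exact Or.inr (hX z hz (hmem z hzS
        ((hx z hzS w ((hsub hw.1).resolve_left hw.2) hwz.symm).resolve_left hw.2)))
    · exact Or.inl ⟨hz, hzS⟩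
  have hout : ∀ X ⊆ C, C' \ S ≠ C' \ X := by
    intro X hX h
    have : y ∈ C' \ X := ⟨hy, fun h => hyC (hX h)⟩
    rw [← h] at this
    exact this.2 hyS
  by_cases hpC : p ∈ C' <;> by_cases hqC : q ∈ C'
  · refine hout {p, q} ?_ (hD.eq_of_closedIn hpC hqC hpq hne (hcl _ ?_ fun z _ h => h))
    · rintro z (rfl | rfl); exacts [hp.2, hq.2]
    · rintro z (rfl | rfl); exacts [hp.1, hq.1]
  · refine hout {p} (by simpa using hp.2) (hD.biConn.2 p hpC _ hne (hcl _ (by simpa using hp.1) ?_))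
    rintro z hz (rfl | rfl)
    exacts [rfl, absurd hz hqC]
  · refine hout {q} (by simpa using hq.2) (hD.biConn.2 q hqC _ hne (hcl _ (by simpa using hq.1) ?_))
    rintro z hz (rfl | rfl)
    exacts [absurd hz hpC, rfl]
  · refine hout ∅ (by simp) ((hD.2.1 _ hne (hcl _ (by simp) ?_)).trans (by simp))
    rintro z hz (rfl | rfl)
    exacts [absurd hz hpC, absurd hz hqC]

/-- Two distinct cycles through an edge are separated by this edge. -/
lemma ToC.exists_separation [Finite V] {C₁ C₂ : Set V} (h : ToC H S) (huv : H.Adj u v)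
    (h₁ : IsCyc H C₁) (h₂ : IsCyc H C₂) (hne : C₁ ≠ C₂) (hs₁ : C₁ ⊆ S) (hs₂ : C₂ ⊆ S)
    (hu₁ : u ∈ C₁) (hv₁ : v ∈ C₁) (hu₂ : u ∈ C₂) (hv₂ : v ∈ C₂) :
    ∃ A, ClosedIn H S {u, v} A ∧ C₁ \ {u, v} ⊆ A ∧ Disjoint C₂ A := by
  induction h with
  | cyc S h => exact absurd ((h.eq_of_subset h₁ hs₁).trans (h.eq_of_subset h₂ hs₂).symm) hne
  | glue S C p q hS hC hpq hSC hcross ih =>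
    have hmem : ∀ y ∈ S, y ∈ C → y ∈ ({p, q} : Set V) := fun y h1 h2 => hSC ▸ ⟨h1, h2⟩
    have hEq : u ∈ S ∩ C → v ∈ S ∩ C → S ∩ C = {u, v} := by
      intro h1 h2
      rw [hSC] at h1 h2 ⊢
      exact pair_eq_pair_of_mem huv.ne h1 h2
    by_cases h1S : C₁ ⊆ S <;> by_cases h2S : C₂ ⊆ S
    · obtain ⟨A, hA, h1A, h2A⟩ := ih h1S h2S
      refine ⟨_, hA.glue ?_ hpq hSC hcross, h1A.trans Set.subset_union_left, ?_⟩
      · rintro y (rfl | rfl); exacts [h1S hu₁, h1S hv₁]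
      · rw [Set.disjoint_left] at *
        rintro y hy (h | h)
        · exact h2A hy h
        · exact h.1.2 (h2S hy)
    · have := h₂.eq_of_not_subset hC hpq hSC hcross hs₂ h2S
      subst this
      have hE := hEq ⟨h1S hu₁, hu₂⟩ ⟨h1S hv₁, hv₂⟩
      have hm : ∀ y ∈ S, y ∈ C₂ → y ∈ ({u, v} : Set V) := fun y h1 h2 => hE ▸ ⟨h1, h2⟩
      refine ⟨S \ {u, v}, ⟨fun y hy => Or.inl hy.1, fun y hy => hy.2, ?_⟩,
        Set.sdiff_subset_sdiff_left h1S, ?_⟩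
      · intro y hy z hz hyz
        by_cases hzX : z ∈ ({u, v} : Set V)
        · exact Or.inr hzX
        · refine Or.inl ⟨hz.elim id fun hzC => ?_, hzX⟩
          exact (hcross y hy.1 z hzC hyz).resolve_right fun h => hy.2 (hm y hy.1 h)
      · rw [Set.disjoint_left]
        exact fun y h1 h2 => h2.2 (hm y h2.1 h1)
    · have := h₁.eq_of_not_subset hC hpq hSC hcross hs₁ h1S
      subst this
      have hE := hEq ⟨h2S hu₂, hu₁⟩ ⟨h2S hv₂, hv₁⟩
      have hm : ∀ y ∈ S, y ∈ C₁ → y ∈ ({u, v} : Set V) := fun y h1 h2 => hE ▸ ⟨h1, h2⟩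
      refine ⟨C₁ \ {u, v}, ⟨fun y hy => Or.inr hy.1, fun y hy => hy.2, ?_⟩, subset_rfl, ?_⟩
      · intro y hy z hz hyz
        by_cases hzX : z ∈ ({u, v} : Set V)
        · exact Or.inr hzX
        · refine Or.inl ⟨hz.elim (fun hzS => ?_) id, hzX⟩
          exact (hcross z hzS y hy.1 hyz.symm).resolve_left fun h => hy.2 (hm y h hy.1)
      · rw [Set.disjoint_left]
        exact fun y h1 h2 => h2.2 (hm y (h2S h1) h2.1)
    · exact absurd ((h₁.eq_of_not_subset hC hpq hSC hcross hs₁ h1S).trans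
        (h₂.eq_of_not_subset hC hpq hSC hcross hs₂ h2S).symm) hne

end ToC

section Translate

variable {V W : Type} {G : SimpleGraph V} {H : SimpleGraph W}

lemma glueCycle_adj_inl_inl {n : ℕ} {a b u v : V} :
    (glueCycle G n a b).Adj (Sum.inl u) (Sum.inl v) ↔ G.Adj u v := by
  simp only [glueCycle, fromRel_adj, ne_eq, Sum.inl.injEq, G.adj_comm v u, or_self]
  exact ⟨fun h => h.2, fun h => ⟨h.ne, h⟩⟩

lemma glueCycle_adj_inl_inr {n : ℕ} {a b u : V} {x : {x : ZMod n // x ≠ 0 ∧ x ≠ 1}} :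
    (glueCycle G n a b).Adj (Sum.inl u) (Sum.inr x) ↔
      (u = a ∧ (cycGraph n).Adj 0 x.1) ∨ (u = b ∧ (cycGraph n).Adj 1 x.1) := by
  simp [glueCycle, fromRel_adj]

lemma glueCycle_adj_inr_inr {n : ℕ} {a b : V} {x y : {x : ZMod n // x ≠ 0 ∧ x ≠ 1}} :
    (glueCycle G n a b).Adj (Sum.inr x) (Sum.inr y) ↔ (cycGraph n).Adj x.1 y.1 := by
  simp only [glueCycle, fromRel_adj, ne_eq, Sum.inr.injEq, (cycGraph n).adj_comm y.1 x.1, or_self]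
  exact ⟨fun h => h.2, fun h => ⟨fun e => h.ne (congrArg _ e), h⟩⟩

/-- The vertices of a glued cycle. -/
noncomputable def glueCycleMap (V : Type) {n : ℕ} (a b : V) (z : ZMod n) :
    V ⊕ {x : ZMod n // x ≠ 0 ∧ x ≠ 1} :=
  open Classical in
  if h0 : z = 0 then Sum.inl a else if h1 : z = 1 then Sum.inl b else Sum.inr ⟨z, h0, h1⟩

lemma glueCycleMap_cases {n : ℕ} (hn : 3 ≤ n) (a b : V) (z : ZMod n) :
    (z = 0 ∧ glueCycleMap V a b z = Sum.inl a) ∨ (z = 1 ∧ glueCycleMap V a b z = Sum.inl b) ∨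
      ∃ h : z ≠ 0 ∧ z ≠ 1, glueCycleMap V a b z = Sum.inr ⟨z, h⟩ := by
  have : Fact (1 < n) := ⟨by omega⟩
  unfold glueCycleMap
  by_cases h0 : z = 0
  · simp [h0]
  · by_cases h1 : z = 1
    · simp [h1]
    · exact Or.inr (Or.inr ⟨⟨h0, h1⟩, by simp [h0, h1]⟩)

lemma cycGraph_adj_zero_one {n : ℕ} (hn : 3 ≤ n) : (cycGraph n).Adj 0 1 := by
  have : Fact (1 < n) := ⟨by omega⟩
  simp [cycGraph]

/-- The glued cycle is an induced subgraph. -/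
noncomputable def glueCycleEmbedding {n : ℕ} (hn : 3 ≤ n) {a b : V} (hab : G.Adj a b) :
    cycGraph n ↪g glueCycle G n a b where
  toFun := glueCycleMap V a b
  inj' := by
    intro x y hxy
    have := hab.ne
    rcases glueCycleMap_cases hn a b x with ⟨rfl, h⟩ | ⟨rfl, h⟩ | ⟨hx, h⟩ <;>
    rcases glueCycleMap_cases hn a b y with ⟨rfl, h'⟩ | ⟨rfl, h'⟩ | ⟨hy, h'⟩ <;>
    simp only [h, h', Sum.inl.injEq, Sum.inr.injEq, Subtype.mk.injEq, reduceCtorEq] at hxy <;>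
    simp_all
  map_rel_iff' := by
    intro x y
    change (glueCycle G n a b).Adj (glueCycleMap V a b x) (glueCycleMap V a b y) ↔ _
    have h01 := cycGraph_adj_zero_one hn
    have := hab.ne
    rcases glueCycleMap_cases hn a b x with ⟨rfl, h⟩ | ⟨rfl, h⟩ | ⟨hx, h⟩ <;>
    rcases glueCycleMap_cases hn a b y with ⟨rfl, h'⟩ | ⟨rfl, h'⟩ | ⟨hy, h'⟩ <;>
    simp only [h, h']
    · simp
    · rw [glueCycle_adj_inl_inl]; exact iff_of_true hab h01
    · rw [glueCycle_adj_inl_inr]; simp [this]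
    · rw [glueCycle_adj_inl_inl]; exact iff_of_true hab.symm h01.symm
    · simp
    · rw [glueCycle_adj_inl_inr]; simp [this.symm]
    · rw [adj_comm, glueCycle_adj_inl_inr, (cycGraph n).adj_comm x]; simp [this]
    · rw [adj_comm, glueCycle_adj_inl_inr, (cycGraph n).adj_comm x]; simp [this.symm]
    · rw [glueCycle_adj_inr_inr]

lemma glueCycleMap_range {n : ℕ} (hn : 3 ≤ n) (a b : V) :
    Set.range (glueCycleMap V (n := n) a b) = {Sum.inl a, Sum.inl b} ∪ Set.range Sum.inr := by
  have : Fact (1 < n) := ⟨by omega⟩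
  ext p
  constructor
  · rintro ⟨z, rfl⟩
    rcases glueCycleMap_cases hn a b z with ⟨rfl, h⟩ | ⟨rfl, h⟩ | ⟨hx, h⟩ <;> rw [h] <;> simp
  · rintro ((rfl | rfl) | ⟨⟨z, h0, h1⟩, rfl⟩)
    · exact ⟨0, by simp [glueCycleMap]⟩
    · exact ⟨1, by simp [glueCycleMap]⟩
    · exact ⟨z, by simp [glueCycleMap, h0, h1]⟩

lemma IsTreeOfCycles.toC_range (h : IsTreeOfCycles G) (φ : G ↪g H) : ToC H (Set.range φ) := by
  induction h generalizing W with
  | cycle G n hn e =>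
    obtain ⟨e⟩ := e
    have := isCyc_range hn (φ.comp e.symm.toEmbedding)
    refine .cyc _ ?_
    convert this using 1
    ext y
    constructor
    · rintro ⟨x, rfl⟩
      exact ⟨e x, by simp⟩
    · rintro ⟨x, rfl⟩
      exact ⟨e.symm x, rfl⟩
  | @glue V₁ V₂ G hG n hn a b hab G' e ih =>
    obtain ⟨e⟩ := e
    let ψ : glueCycle G n a b ↪g H := φ.comp e.symm.toEmbedding
    have hψ : Set.range φ = Set.range ψ := by
      ext y
      constructor
      · rintro ⟨x, rfl⟩
        exact ⟨e x, by simp [ψ]⟩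
      · rintro ⟨x, rfl⟩
        exact ⟨e.symm x, rfl⟩
    let ι : G ↪g glueCycle G n a b := ⟨⟨Sum.inl, Sum.inl_injective⟩, glueCycle_adj_inl_inl⟩
    let c := glueCycleEmbedding hn hab
    have h1 := ih (ψ.comp ι)
    have h2 := isCyc_range hn (ψ.comp c)
    have hr1 : Set.range (ψ.comp ι) = ψ '' Set.range Sum.inl := by
      rw [← Set.range_comp]; rfl
    have hr2 : Set.range (ψ.comp c) = ψ '' ({Sum.inl a, Sum.inl b} ∪ Set.range Sum.inr) := by
      rw [← glueCycleMap_range hn, ← Set.range_comp]; rfl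
    rw [hr1] at h1
    rw [hr2] at h2
    have hU : Set.range φ =
        ψ '' Set.range Sum.inl ∪ ψ '' ({Sum.inl a, Sum.inl b} ∪ Set.range Sum.inr) := by
      rw [hψ, ← Set.image_union, ← Set.image_univ]
      congr 1
      ext p
      cases p <;> simp
    rw [hU]
    refine .glue _ _ (ψ (Sum.inl a)) (ψ (Sum.inl b)) h1 h2
      (ψ.map_adj_iff.2 (glueCycle_adj_inl_inl.2 hab)) ?_ ?_
    · rw [← Set.image_inter ψ.injective,
        show ({ψ (Sum.inl a), ψ (Sum.inl b)} : Set W) = ψ '' {Sum.inl a, Sum.inl b} from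
          (Set.image_pair _ _ _).symm]
      congr 1
      ext p
      cases p <;> simp
    · rintro _ ⟨_, ⟨u, rfl⟩, rfl⟩ _ ⟨p, hp, rfl⟩ hadj
      rw [ψ.map_adj_iff] at hadj
      rcases hp with hp | ⟨x, rfl⟩
      · left
        rcases hp with rfl | rfl
        · exact ⟨_, ⟨a, rfl⟩, rfl⟩
        · exact ⟨_, ⟨b, rfl⟩, rfl⟩
      · right
        rw [glueCycle_adj_inl_inr] at hadj
        refine ⟨_, Or.inl ?_, rfl⟩
        rcases hadj with ⟨rfl, -⟩ | ⟨rfl, -⟩ <;> simp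

lemma IsTreeOfCycles.of_iso (h : IsTreeOfCycles G) (e : H ≃g G) : IsTreeOfCycles H := by
  cases h with
  | cycle _ n hn e' => exact .cycle H n hn ⟨e.trans e'.some⟩
  | glue G₀ hG n hn a b hab _ e' => exact .glue G₀ hG n hn a b hab H ⟨e.trans e'.some⟩

lemma ToC.isTreeOfCycles_induce [Finite V] {S : Set V} (h : ToC G S) :
    IsTreeOfCycles (G.induce S) := by
  induction h with
  | cyc S h =>
    obtain ⟨a, ha, b, hb, hab⟩ := h.exists_edge
    obtain ⟨n, hn, e, -⟩ := h.exists_iso ha hb hab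
    exact .cycle _ n hn ⟨e.symm⟩
  | glue S C a b hS hC hab hSC hx ih =>
    have ha : a ∈ S ∩ C := hSC ▸ by simp
    have hb : b ∈ S ∩ C := hSC ▸ by simp
    have hmem : ∀ y ∈ S, y ∈ C → y = a ∨ y = b := fun y h1 h2 => by
      have : y ∈ S ∩ C := ⟨h1, h2⟩
      rw [hSC] at this
      exact this
    obtain ⟨n, hn, e, he0, he1⟩ := hC.exists_iso ha.2 hb.2 hab
    have hen : ∀ z : ZMod n, z ≠ 0 ∧ z ≠ 1 → (e z : V) ∉ S := by
      intro z hz hzS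
      rcases hmem _ hzS (e z).2 with h | h
      · exact hz.1 (e.injective (Subtype.ext (h.trans he0.symm)))
      · exact hz.2 (e.injective (Subtype.ext (h.trans he1.symm)))
    have hadj : ∀ x y : ZMod n, G.Adj (e x) (e y) ↔ (cycGraph n).Adj x y := fun x y => e.map_adj_iff
    let f : S ⊕ {x : ZMod n // x ≠ 0 ∧ x ≠ 1} → (S ∪ C : Set V) :=
      Sum.elim (fun s => ⟨s.1, Or.inl s.2⟩) (fun z => ⟨(e z.1).1, Or.inr (e z.1).2⟩)
    have hf : Function.Bijective f := by
      constructor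
      · rintro (s | z) (s' | z') h <;> have h' := congrArg Subtype.val h
        · exact congrArg Sum.inl (Subtype.ext h')
        · exact absurd (show (e z'.1 : V) ∈ S from h' ▸ s.2) (hen _ z'.2)
        · exact absurd (show (e z.1 : V) ∈ S from h' ▸ s'.2) (hen _ z.2)
        · exact congrArg Sum.inr (Subtype.ext (e.injective (Subtype.ext h')))
      · rintro ⟨y, hy⟩
        by_cases hyS : y ∈ S
        · exact ⟨Sum.inl ⟨y, hyS⟩, rfl⟩
        · have hyC := hy.resolve_left hyS
          obtain ⟨z, hz⟩ := e.surjective ⟨y, hyC⟩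
          have hz' : (e z : V) = y := congrArg Subtype.val hz
          refine ⟨Sum.inr ⟨z, ?_, ?_⟩, Subtype.ext hz'⟩
          · rintro rfl; exact hyS (hz' ▸ he0 ▸ ha.1)
          · rintro rfl; exact hyS (hz' ▸ he1 ▸ hb.1)
    have hlr : ∀ (s : S) (z : {x : ZMod n // x ≠ 0 ∧ x ≠ 1}), G.Adj s.1 (e z.1) ↔
        (glueCycle (G.induce S) n ⟨a, ha.1⟩ ⟨b, hb.1⟩).Adj (Sum.inl s) (Sum.inr z) := by
      intro s z
      rw [glueCycle_adj_inl_inr, ← hadj, ← hadj, he0, he1, Subtype.ext_iff, Subtype.ext_iff]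
      constructor
      · intro h
        rcases hmem s.1 s.2 ((hx _ s.2 _ (e z.1).2 h).resolve_left (hen _ z.2)) with h' | h'
        · exact Or.inl ⟨h', h' ▸ h⟩
        · exact Or.inr ⟨h', h' ▸ h⟩
      · rintro (⟨h, h'⟩ | ⟨h, h'⟩) <;> rw [h] <;> exact h'
    refine .glue _ ih n hn ⟨a, ha.1⟩ ⟨b, hb.1⟩ hab _ ⟨Iso.symm ⟨Equiv.ofBijective f hf, ?_⟩⟩
    rintro (s | z) (s' | z')
    · rw [glueCycle_adj_inl_inl]; rfl
    · exact hlr s z'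
    · rw [adj_comm, (glueCycle _ n _ _).adj_comm]; exact hlr s' z
    · rw [glueCycle_adj_inr_inr]; exact hadj _ _

lemma isTreeOfCycles_iff [Finite V] : IsTreeOfCycles G ↔ ToC G Set.univ := by
  constructor
  · intro h
    have := h.toC_range (Embedding.refl (G := G))
    rwa [show Set.range (Embedding.refl (G := G)) = Set.univ from Set.range_id] at this
  · intro h
    exact h.isTreeOfCycles_induce.of_iso (induceUnivIso G).symm

end Translate

/-! ### The cell completion -/

section CellCompletion

variable {V : Type} {G H : SimpleGraph V} {S A : Set V} {u v : V}

lemma induce_connected_iff : (H.induce S).Connected ↔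
    S.Nonempty ∧ ∀ A : Set V, A.Nonempty → ClosedIn H S ∅ A → A = S := by
  constructor
  · intro h
    refine ⟨?_, fun A hne hA => hA.1.antisymm fun y hy => ?_⟩
    · obtain ⟨x⟩ := h.nonempty
      exact ⟨x, x.2⟩
    · obtain ⟨a, ha⟩ := hne
      obtain ⟨w⟩ := h.preconnected ⟨a, hA.1 ha⟩ ⟨y, hy⟩
      by_contra hyA
      obtain ⟨d, -, h1, h2⟩ := w.exists_boundary_dart {x | x.1 ∈ A} ha hyA
      rcases hA.2.2 _ h1 _ d.snd.2 d.adj with h | h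
      · exact h2 h
      · exact h
  · rintro ⟨⟨a, ha⟩, h⟩
    rw [connected_iff_exists_forall_reachable]
    refine ⟨⟨a, ha⟩, ?_⟩
    have := h {x | ∃ hx : x ∈ S, (H.induce S).Reachable ⟨a, ha⟩ ⟨x, hx⟩} ⟨a, ha, .rfl⟩
      ⟨fun x hx => hx.1, fun x _ => by simp, ?_⟩
    · rintro ⟨x, hx⟩
      have hx' := hx
      rw [← this] at hx'
      exact hx'.2
    · rintro x ⟨hx, hr⟩ y hy hxy
      exact Or.inl ⟨hy, hr.trans (Adj.reachable (by simpa using hxy))⟩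

lemma TwoConnected.biConn [Finite V] (hG : TwoConnected G) : BiConn G Set.univ := by
  have key : ∀ v ∈ Set.univ, ∀ A : Set V, A.Nonempty → ClosedIn G Set.univ {v} A →
      A = Set.univ \ {v} := by
    intro v _ A hne hA
    have := (induce_connected_iff.1 (hG.2 v)).2 A hne ⟨fun x hx => hA.2.1 x hx, by simp, ?_⟩
    · rw [this]; ext; simp
    · intro x hx y hy hxy
      rcases hA.2.2 x hx y trivial hxy with h | h
      · exact Or.inl h
      · exact absurd h hy
  refine ⟨fun A ⟨a, ha⟩ hA => ?_, key⟩
  by_contra hne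
  obtain ⟨y, hy⟩ : ∃ y, y ∉ A := by
    by_contra hc
    push Not at hc
    exact hne (Set.eq_univ_of_forall hc)
  obtain ⟨v, hva, hvy⟩ : ∃ v, v ≠ a ∧ v ≠ y := by
    by_contra hc
    push Not at hc
    have : (Set.univ : Set V) ⊆ {a, y} := fun v _ => by
      by_cases h : v = a
      · exact Or.inl h
      · exact Or.inr (hc v h)
    have h1 := Set.ncard_le_ncard this
    have h2 := Set.ncard_insert_le a {y}
    rw [Set.ncard_univ] at h1
    rw [Set.ncard_singleton] at h2
    have := hG.1
    omega
  have := key v trivial (A \ {v}) ⟨a, ha, fun h => hva h.symm⟩ ⟨Set.subset_univ _, fun x hx => hx.2, ?_⟩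
  · have hy' : y ∈ Set.univ \ {v} := ⟨trivial, fun h => hvy h.symm⟩
    rw [← this] at hy'
    exact hy hy'.1
  · intro x hx y hy hxy
    rcases hA.2.2 x hx.1 y hy hxy with h | h
    · by_cases hyv : y = v
      · exact Or.inr hyv
      · exact Or.inl ⟨h, hyv⟩
    · exact absurd h (by simp)

lemma BiConn.mono_graph (hb : BiConn G S) (hGH : G ≤ H) : BiConn H S :=
  ⟨fun A hne hA => hb.1 A hne (hA.mono_graph hGH),
    fun v hv A hne hA => hb.2 v hv A hne (hA.mono_graph hGH)⟩

lemma threeSep_iff_card [Finite V] : ThreeSep G Set.univ {u, v} ↔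
    3 ≤ Nat.card (G.induce {x | x ≠ u ∧ x ≠ v}).ConnectedComponent := by
  have hX : ∀ x, x ∉ ({u, v} : Set V) ↔ x ≠ u ∧ x ≠ v := by simp
  constructor
  · rintro ⟨A, hne, hd, hc⟩
    choose a ha using hne
    have hS : ∀ i, a i ≠ u ∧ a i ≠ v := fun i => (hX _).1 ((hc i).2.1 _ (ha i))
    let f : Fin 3 → (G.induce {x | x ≠ u ∧ x ≠ v}).ConnectedComponent :=
      fun i => (G.induce _).connectedComponentMk ⟨a i, hS i⟩
    have hf : Function.Injective f := by
      intro i j hij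
      by_contra hne
      obtain ⟨w⟩ := ConnectedComponent.eq.1 hij
      obtain ⟨d, -, h1, h2⟩ := w.exists_boundary_dart {x | x.1 ∈ A i} (ha i)
        (fun h => Set.disjoint_left.1 (hd i j hne) h (ha j))
      rcases (hc i).2.2 _ h1 _ trivial d.adj with h | h
      · exact h2 h
      · exact (hX _).2 d.snd.2 h
    simpa using Nat.card_le_card_of_injective f hf
  · intro h
    have := Fintype.ofFinite (G.induce {x | x ≠ u ∧ x ≠ v}).ConnectedComponent
    rw [Nat.card_eq_fintype_card] at h
    obtain ⟨f⟩ := Function.Embedding.nonempty_of_card_le (α := Fin 3)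
      (β := (G.induce {x | x ≠ u ∧ x ≠ v}).ConnectedComponent) (by simpa using h)
    refine ⟨fun i => {x | ∃ hx : x ≠ u ∧ x ≠ v, (G.induce _).connectedComponentMk ⟨x, hx⟩ = f i},
      fun i => ?_, fun i j hij => ?_, fun i => ⟨Set.subset_univ _, fun x hx => (hX x).2 hx.1, ?_⟩⟩
    · obtain ⟨x, hx⟩ := (f i).exists_rep
      exact ⟨x.1, x.2, hx⟩
    · rw [Set.disjoint_left]
      rintro x ⟨hx, h1⟩ ⟨_, h2⟩
      exact hij (f.injective (h1.symm.trans h2))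
    · rintro x ⟨hx, h1⟩ y - hxy
      by_cases hy : y ≠ u ∧ y ≠ v
      · refine Or.inl ⟨hy, ?_⟩
        rw [← h1]
        exact ConnectedComponent.eq.2 (Adj.reachable (by simpa using hxy.symm))
      · exact Or.inr (not_not.1 ((hX y).not.2 hy))

lemma cellCompletion_adj [Finite V] : (cellCompletion G).Adj u v ↔
    u ≠ v ∧ (G.Adj u v ∨ ThreeSep G Set.univ {u, v}) := by
  have h : ThreeSep G Set.univ {u, v} ↔ ThreeSep G Set.univ {v, u} := by rw [Set.pair_comm]
  rw [cellCompletion, fromRel_adj, ← threeSep_iff_card, ← threeSep_iff_card, G.adj_comm v u, ← h]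
  tauto

lemma le_cellCompletion [Finite V] : G ≤ cellCompletion G :=
  fun _ _ h => cellCompletion_adj.2 ⟨h.ne, Or.inl h⟩

lemma cellCompletion_adj_of_threeSep [Finite V] (huv : u ≠ v)
    (h : ThreeSep (cellCompletion G) Set.univ {u, v}) : (cellCompletion G).Adj u v :=
  cellCompletion_adj.2 ⟨huv, Or.inr (h.mono_graph le_cellCompletion)⟩

end CellCompletion

/-! ### Chain trees of cycles and fat separations -/

/-- Removing `u` and `v` from `H` leaves three parts without isolated vertices. -/
def FatSep {V : Type} (H : SimpleGraph V) (u v : V) : Prop :=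
  ∃ A : Fin 3 → Set V, (∀ i, (A i).Nonempty) ∧ (∀ i j, i ≠ j → Disjoint (A i) (A j)) ∧
    (∀ i, ClosedIn H Set.univ {u, v} (A i)) ∧ ∀ i, ∀ p ∈ A i, ∃ q ∈ A i, H.Adj p q

section Fat

variable {V : Type} {H : SimpleGraph V} {S A B C X : Set V} {u v : V}

lemma FatSep.threeSep (h : FatSep H u v) : ThreeSep H Set.univ {u, v} :=
  h.imp fun _ hA => ⟨hA.1, hA.2.1, hA.2.2.1⟩

/-- The smallest union of components of `H - X` containing `B`. -/
def hull (H : SimpleGraph V) (X B : Set V) : Set V :=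
  {x | ∀ A, ClosedIn H Set.univ X A → B ⊆ A → x ∈ A}

lemma closedIn_hull (hB : ∀ x ∈ B, x ∉ X) : ClosedIn H Set.univ X (hull H X B) := by
  have h0 : ClosedIn H Set.univ X Xᶜ :=
    ⟨Set.subset_univ _, fun x hx => hx, fun x _ y _ _ => (em (y ∈ X)).symm⟩
  refine ⟨Set.subset_univ _, fun x hx => hx _ h0 hB, fun x hx y hy hxy => ?_⟩
  by_cases hyX : y ∈ X
  · exact Or.inr hyX
  · exact Or.inl fun A hA hBA => (hA.2.2 x (hx A hA hBA) y hy hxy).resolve_right hyX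

lemma subset_hull : B ⊆ hull H X B := fun _ hx _ _ h => h hx

lemma ClosedIn.fat (hA : ClosedIn H S X A) : ClosedIn H S X {p ∈ A | ∃ q ∈ A, H.Adj p q} := by
  refine ⟨fun x hx => hA.1 hx.1, fun x hx => hA.2.1 x hx.1, fun x hx y hy hxy => ?_⟩
  exact (hA.2.2 x hx.1 y hy hxy).imp_left fun h => ⟨h, x, hx.1, hxy.symm⟩

/-- A cycle through `uv` which is not a simplicial triangle gives an edge avoiding `u, v`. -/
lemma IsCyc.exists_edge_avoiding [Finite V] (hC : IsCyc H C) (hu : u ∈ C) (hv : v ∈ C)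
    (huv : H.Adj u v) (hs : ¬ IsSimplicialTriangle H C) (hA : ClosedIn H Set.univ {u, v} A)
    (hCA : C \ {u, v} ⊆ A) : ∃ p ∈ A, ∃ q ∈ A, H.Adj p q := by
  obtain ⟨w, hw, hwu, hwv⟩ := hC.exists_ne_ne u v
  have hwA : w ∈ A := hCA ⟨hw, by simp [hwu, hwv]⟩
  by_contra hc
  push Not at hc
  have hN : ∀ y, H.Adj w y → y = u ∨ y = v := fun y hy => by
    rcases hA.2.2 w hwA y trivial hy with h | h
    · exact absurd hy (hc w hwA y h)
    · exact h
  obtain ⟨a, ha, b, hb, hab, hw2⟩ := hC.2.2 w hw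
  have hwa : H.Adj w a := (hw2 a ha).2 (Or.inl rfl)
  have hwb : H.Adj w b := (hw2 b hb).2 (Or.inr rfl)
  have hwu' : H.Adj w u ∧ H.Adj w v := by
    rcases hN a hwa with rfl | rfl <;> rcases hN b hwb with rfl | rfl
    · exact absurd rfl hab
    · exact ⟨hwa, hwb⟩
    · exact ⟨hwb, hwa⟩
    · exact absurd rfl hab
  have hCeq := hC.eq_triangle hw hu hv hwu'.1 hwu'.2 huv
  refine hs ⟨isChordlessCycle_iff.2 hC, ?_, w, hw, ?_⟩
  · rw [hCeq, Set.ncard_eq_three]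
    exact ⟨w, u, v, hwu, hwv, huv.ne, rfl⟩
  · intro y hy z hz hyz
    rcases hN y hy with rfl | rfl <;> rcases hN z hz with rfl | rfl
    · exact absurd rfl hyz
    · exact huv
    · exact huv.symm
    · exact absurd rfl hyz

/-- A cycle whose inner vertices lie in a fat part is not a simplicial triangle. -/
lemma IsCyc.not_isSimplicialTriangle [Finite V] (hb : BiConn H Set.univ) (he : Elim2 H Set.univ)
    (hC : IsCyc H C) (hu : u ∈ C) (hv : v ∈ C) (huv : H.Adj u v)
    (hA : ClosedIn H Set.univ {u, v} A) (hCA : C \ {u, v} ⊆ A)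
    (hfat : ∀ p ∈ A, ∃ q ∈ A, H.Adj p q) (hB : ClosedIn H Set.univ {u, v} B)
    (hAB : Disjoint A B) (hBne : B.Nonempty) : ¬ IsSimplicialTriangle H C := by
  rintro ⟨-, h3, s, hs, hcl⟩
  obtain ⟨w, hw, hwu, hwv⟩ := hC.exists_ne_ne u v
  have hwA : w ∈ A := hCA ⟨hw, by simp [hwu, hwv]⟩
  have h3' : ({w, u, v} : Set V).ncard = 3 :=
    Set.ncard_eq_three.2 ⟨w, u, v, hwu, hwv, huv.ne, rfl⟩
  have hCeq : ({w, u, v} : Set V) = C := Set.eq_of_subset_of_ncard_le (by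
    rintro y (rfl | rfl | rfl) <;> assumption) (by omega) C.toFinite
  have key : ∀ p q : V, p ≠ q → ({p, q} : Set V) = {u, v} → ¬ H.IsClique (H.neighborSet p) := by
    intro p q hpq heq hcl
    rw [← heq] at hA hB
    obtain ⟨y, hy, hpy⟩ := hb.exists_adj trivial trivial hpq ⟨w, hwA⟩ hA
    obtain ⟨z, hz, hpz⟩ := hb.exists_adj trivial trivial hpq hBne hB
    have hyz : y ≠ z := fun h => Set.disjoint_left.1 hAB hy (h ▸ hz)
    rcases hA.2.2 y hy z trivial (hcl hpy hpz hyz) with h | h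
    · exact Set.disjoint_left.1 hAB h hz
    · exact hB.2.1 z hz h
  rw [← hCeq] at hs
  rcases hs with rfl | rfl | rfl
  · obtain ⟨y, hyA, hwy⟩ := hfat _ hwA
    obtain ⟨a, ha, b, hb', hab, hw2⟩ := hC.2.2 s hw
    have hwa : H.Adj s a := (hw2 a ha).2 (Or.inl rfl)
    have hwb : H.Adj s b := (hw2 b hb').2 (Or.inr rfl)
    have hyX := hA.2.1 y hyA
    simp only [Set.mem_insert_iff, Set.mem_singleton_iff, not_or] at hyX
    rw [← hCeq] at ha hb'
    have hsuv : H.Adj s u ∧ H.Adj s v := by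
      rcases ha with rfl | rfl | rfl <;> rcases hb' with rfl | rfl | rfl <;>
        first
        | exact absurd rfl hab
        | exact ⟨hwa, hwb⟩
        | exact ⟨hwb, hwa⟩
        | exact absurd rfl hwa.ne
        | exact absurd rfl hwb.ne
    exact he.no_K4 (p := s) (q := y) (r := u) (s := v) trivial trivial trivial trivial hwy hsuv.1
      hsuv.2 (hcl hwy hsuv.1 hyX.1) (hcl hwy hsuv.2 hyX.2) huv
  · exact key s v huv.ne rfl hcl
  · exact key s u huv.ne' (Set.pair_comm _ _) hcl

lemma ToC.not_fatSep_iff [Finite V] (h : ToC H Set.univ) (hb : BiConn H Set.univ)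
    (hcell : ∀ u v, u ≠ v → ThreeSep H Set.univ {u, v} → H.Adj u v) :
    (∀ u v, u ≠ v → ¬ FatSep H u v) ↔ ∀ u v, H.Adj u v →
      {S : Set V | IsChordlessCycle H S ∧ u ∈ S ∧ v ∈ S ∧
        ¬ IsSimplicialTriangle H S}.ncard ≤ 2 := by
  constructor
  · intro hQ u v huv
    by_contra hc
    rw [not_le, Set.two_lt_ncard_iff] at hc
    obtain ⟨C₀, C₁, C₂, h0, h1, h2, h01, h02, h12⟩ := hc
    let C : Fin 3 → Set V := ![C₀, C₁, C₂]
    have hC : ∀ i, IsCyc H (C i) ∧ u ∈ C i ∧ v ∈ C i ∧ ¬ IsSimplicialTriangle H (C i) := by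
      intro i
      rw [← isChordlessCycle_iff]
      fin_cases i
      exacts [h0, h1, h2]
    have hne : ∀ i j, i ≠ j → C i ≠ C j := by
      intro i j hij
      fin_cases i <;> fin_cases j <;> simp_all [C, ne_comm]
    have hcl : ∀ i, ClosedIn H Set.univ {u, v} (hull H {u, v} (C i \ {u, v})) :=
      fun i => closedIn_hull fun x hx => hx.2
    refine hQ u v huv.ne ⟨fun i => {p ∈ hull H {u, v} (C i \ {u, v}) |
      ∃ q ∈ hull H {u, v} (C i \ {u, v}), H.Adj p q}, fun i => ?_, fun i j hij => ?_,
      fun i => (hcl i).fat, fun i p hp => ?_⟩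
    · obtain ⟨p, hp, q, hq, hpq⟩ := (hC i).1.exists_edge_avoiding (hC i).2.1 (hC i).2.2.1 huv
        (hC i).2.2.2 (hcl i) subset_hull
      exact ⟨p, hp, q, hq, hpq⟩
    · obtain ⟨A, hA, hiA, hjA⟩ := h.exists_separation huv (hC i).1 (hC j).1 (hne i j hij)
        (Set.subset_univ _) (Set.subset_univ _) (hC i).2.1 (hC i).2.2.1 (hC j).2.1 (hC j).2.2.1
      rw [Set.disjoint_left]
      intro x hx hx'
      refine (hx'.1 _ hA.compl fun y hy => ⟨⟨trivial, ?_⟩, hy.2⟩).1.2 (hx.1 _ hA hiA)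
      exact Set.disjoint_left.1 hjA hy.1
    · obtain ⟨hp, q, hq, hpq⟩ := hp
      exact ⟨q, ⟨hq, p, hp, hpq.symm⟩, hpq⟩
  · rintro hQ u v hne hF
    have huv := hcell u v hne hF.threeSep
    obtain ⟨A, hA, hd, hcl, hfat⟩ := hF
    choose C hCs hC hu hv hCA using fun i => h.exists_cyc trivial trivial huv (hA i) (hcl i)
    have hinj : ∀ i j, i ≠ j → C i ≠ C j := by
      intro i j hij heq
      obtain ⟨w, hw, hwu, hwv⟩ := (hC i).exists_ne_ne u v
      have hw' : w ∉ ({u, v} : Set V) := by simp [hwu, hwv]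
      exact Set.disjoint_left.1 (hd i j hij) (hCA i ⟨hw, hw'⟩) (hCA j ⟨heq ▸ hw, hw'⟩)
    have hmem : ∀ i, C i ∈ {S : Set V | IsChordlessCycle H S ∧ u ∈ S ∧ v ∈ S ∧
        ¬ IsSimplicialTriangle H S} := by
      intro i
      obtain ⟨j, hj⟩ := exists_ne i
      exact ⟨isChordlessCycle_iff.2 (hC i), hu i, hv i,
        (hC i).not_isSimplicialTriangle hb h.elim2 (hu i) (hv i) huv (hcl i) (hCA i) (hfat i)
          (hcl j) (hd i j hj.symm) (hA j)⟩
    have := (Set.two_lt_ncard_iff (Set.toFinite _)).2 ⟨C 0, C 1, C 2, hmem 0, hmem 1, hmem 2,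
      hinj 0 1 (by decide), hinj 0 2 (by decide), hinj 1 2 (by decide)⟩
    have := hQ u v huv
    omega

end Fat

/-! ### Separations of trees along edges -/

/-- `kp` is the only edge between `K` and its complement, and its endpoint in `K` is `k`. -/
def IsSide {ι : Type} (T : SimpleGraph ι) (p k : ι) (K : Set ι) : Prop :=
  k ∈ K ∧ p ∉ K ∧ ∀ n ∈ K, ∀ m, m ∉ K → T.Adj n m → n = k ∧ m = p

section Side

variable {ι : Type} {T : SimpleGraph ι} {p k : ι} {K X Y P : Set ι}

lemma IsSide.compl (h : IsSide T p k K) : IsSide T k p Kᶜ :=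
  ⟨h.2.1, fun h' => h' h.1, fun n hn m hm hnm =>
    (h.2.2 m (not_not.1 hm) n hn hnm.symm).symm⟩

lemma IsSide.mem_of_cross (h : IsSide T p k K) (hX : (T.induce X).Connected) {a b : ι}
    (ha : a ∈ X) (haK : a ∈ K) (hb : b ∈ X) (hbK : b ∉ K) : k ∈ X ∧ p ∈ X := by
  by_contra hc
  have := (induce_connected_iff.1 hX).2 (X ∩ K) ⟨a, ha, haK⟩ ⟨Set.inter_subset_left, by simp, ?_⟩
  · rw [← this] at hb
    exact hbK hb.2
  · intro n hn m hm hnm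
    by_cases hmK : m ∈ K
    · exact Or.inl ⟨hm, hmK⟩
    · obtain ⟨rfl, rfl⟩ := h.2.2 n hn.2 m hmK hnm
      exact absurd ⟨hn.1, hm⟩ hc

lemma IsSide.dist_lt (h : IsSide T p k K) (hT : T.Connected) {a b : ι} (ha : a ∈ K) (hb : b ∉ K) :
    T.dist p b < T.dist a b := by
  obtain ⟨w, hw⟩ := hT.exists_walk_length_eq_dist a b
  rw [← hw]
  clear hw
  induction w with
  | nil => exact absurd ha hb
  | @cons a c b hac w ih =>
    rw [Walk.length_cons]
    by_cases hc : c ∈ K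
    · have := ih hc hb
      omega
    · obtain ⟨rfl, rfl⟩ := h.2.2 a ha c hc hac
      have := dist_le w
      omega

lemma SimpleGraph.IsAcyclic.exists_isSide (hT : T.IsAcyclic) (hpk : T.Adj p k) :
    ∃ K, IsSide T p k K := by
  have hb := isBridge_iff.1 (isAcyclic_iff_forall_adj_isBridge.1 hT hpk)
  refine ⟨{n | (T.deleteEdges {s(p, k)}).Reachable p n}ᶜ, hb, fun h => h .rfl, ?_⟩
  intro n hn m hm hnm
  rw [Set.mem_compl_iff, not_not] at hm
  by_contra hc
  refine hn (Reachable.trans hm (Adj.reachable (deleteEdges_adj.2 ⟨hnm.symm, ?_⟩)))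
  simp only [Set.mem_singleton_iff, Sym2.eq_iff]
  rintro (⟨rfl, rfl⟩ | ⟨rfl, rfl⟩)
  · exact hc ⟨rfl, rfl⟩
  · exact hb hm

lemma SimpleGraph.IsAcyclic.exists_exit (hT : T.IsAcyclic) (hX : (T.induce X).Connected) {n q : ι}
    (hn : n ∈ X) (hnP : n ∉ P) (hq : q ∈ X) (hqP : q ∈ P) :
    ∃ p ∈ X ∩ P, ∃ k ∈ X \ P, ∃ K, IsSide T p k K ∧ T.Adj p k ∧ n ∈ K := by
  let D : Set ι := {m | ∃ h : m ∈ X \ P, (T.induce (X \ P)).Reachable ⟨n, hn, hnP⟩ ⟨m, h⟩}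
  have hD : ¬ ClosedIn T X ∅ D := fun h => by
    have := (induce_connected_iff.1 hX).2 D ⟨n, ⟨hn, hnP⟩, .rfl⟩ h
    rw [← this] at hq
    exact hq.1.2 hqP
  obtain ⟨k, ⟨hk, hnk⟩, p, hp, hkp, hpD⟩ : ∃ k ∈ D, ∃ p ∈ X, T.Adj k p ∧ p ∉ D := by
    by_contra hc
    push Not at hc
    exact hD ⟨fun m hm => hm.1.1, by simp, fun x hx y hy h => Or.inl (hc x hx y hy h)⟩
  have hpP : p ∈ P := by
    by_contra hpP
    exact hpD ⟨⟨hp, hpP⟩, hnk.trans (Adj.reachable (by simpa using hkp))⟩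
  obtain ⟨K, hK⟩ := hT.exists_isSide hkp.symm
  refine ⟨p, ⟨hp, hpP⟩, k, hk, K, hK, hkp.symm, ?_⟩
  by_contra hnK
  obtain ⟨w⟩ := hnk.symm
  obtain ⟨d, -, h1, h2⟩ := w.exists_boundary_dart {m | m.1 ∈ K} hK.1 hnK
  have := (hK.2.2 _ h1 _ h2 d.adj).2
  exact d.snd.2.2 (this ▸ hpP)

/-- Connected sets of nodes of a tree that meet have a connected intersection. -/
lemma SimpleGraph.IsAcyclic.induce_inter_connected (hT : T.IsAcyclic) (hX : (T.induce X).Connected)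
    (hY : (T.induce Y).Connected) (hne : (X ∩ Y).Nonempty) : (T.induce (X ∩ Y)).Connected := by
  refine induce_connected_iff.2 ⟨hne, fun A ⟨a, ha⟩ hA => hA.1.antisymm fun b hb => ?_⟩
  by_contra hbA
  obtain ⟨p, ⟨hpX, hpA⟩, k, hk, K, hK, hpk, hbK⟩ :=
    hT.exists_exit hX hb.1 hbA (hA.1 ha).1 ha
  have hkY := (hK.mem_of_cross hY hb.2 hbK (hA.1 hpA).2 hK.2.1).1
  rcases hA.2.2 p hpA k ⟨hk.1, hkY⟩ hpk with h | h
  · exact hk.2 h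
  · exact h

/-- A tree with maximum degree two has at most two leaves. -/
lemma SimpleGraph.IsTree.not_three_leaves [Finite ι] (hT : T.IsTree)
    (hdeg : ∀ x, {y | T.Adj x y}.ncard ≤ 2) (f : Fin 3 → ι) (hf : Function.Injective f)
    (hleaf : ∀ i, {y | T.Adj (f i) y}.ncard ≤ 1) : False := by
  classical
  have := Fintype.ofFinite ι
  have h1 := hT.card_edgeFinset
  have h2 := sum_degrees_eq_twice_card_edges T
  have hd : ∀ x, T.degree x = {y | T.Adj x y}.ncard := fun x => by
    rw [← card_neighborFinset_eq_degree, ← Set.ncard_coe_finset, coe_neighborFinset]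
    rfl
  have hF : (Finset.univ.image f).card = 3 := by
    rw [Finset.card_image_of_injective _ hf, Finset.card_univ, Fintype.card_fin]
  have h3 : ∑ x, T.degree x + ∑ x, (if x ∈ Finset.univ.image f then 1 else 0) ≤ ∑ x : ι, 2 := by
    rw [← Finset.sum_add_distrib]
    refine Finset.sum_le_sum fun x _ => ?_
    split_ifs with h
    · obtain ⟨i, -, rfl⟩ := Finset.mem_image.1 h
      have := hleaf i
      rw [hd]
      omega
    · rw [hd]
      exact hdeg x
  rw [Finset.sum_ite_mem, Finset.univ_inter, Finset.sum_const, hF, Finset.sum_const,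
    Finset.card_univ] at h3
  simp only [smul_eq_mul] at h3
  omega

end Side

/-! ### Tree decompositions of width two -/

section Decomp

variable {V : Type} {G H : SimpleGraph V} {S A B C X : Set V} {u v : V}

/-- A tree decomposition remains one when edges inside bags are added. -/
def TreeDecomp.ofAdj (td : TreeDecomp G) (h : ∀ ⦃u v⦄, H.Adj u v → ∃ x, u ∈ td.bag x ∧ v ∈ td.bag x) :
    TreeDecomp H where
  ι := td.ι
  finι := td.finι
  tree := td.tree
  isTree := td.isTree
  bag := td.bag
  bag_cover := td.bag_cover
  bag_edge := h
  bag_conn := td.bag_conn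

lemma TreeDecomp.induce_univ_connected (td : TreeDecomp G) :
    (td.tree.induce Set.univ).Connected :=
  (induceUnivIso td.tree).connected_iff.2 td.isTree.1

lemma TreeDecomp.subset_of_mem (td : TreeDecomp G) {p k : td.ι} {K : Set td.ι}
    (hK : IsSide td.tree p k K) {y : V} (hy : ¬ (y ∈ td.bag p ∧ y ∈ td.bag k)) {n : td.ι}
    (hn : n ∈ K) (hyn : y ∈ td.bag n) : {x | y ∈ td.bag x} ⊆ K := by
  intro m hm
  by_contra hmK
  exact hy (hK.mem_of_cross (td.bag_conn y) hyn hn hm hmK).symm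

/-- The vertices living on one side of a tree edge are separated by the adhesion set. -/
lemma TreeDecomp.closedIn_side (td : TreeDecomp G) {p k : td.ι} {K : Set td.ι}
    (hK : IsSide td.tree p k K) :
    ClosedIn G Set.univ (td.bag p ∩ td.bag k) {y | {x | y ∈ td.bag x} ⊆ K} := by
  refine ⟨Set.subset_univ _, fun y hy h => hK.2.1 (hy h.1), fun y hy z _ hyz => ?_⟩
  by_cases hz : z ∈ td.bag p ∩ td.bag k
  · exact Or.inr hz
  · obtain ⟨n, hyn, hzn⟩ := td.bag_edge hyz
    exact Or.inl (td.subset_of_mem hK hz (hy hyn) hzn)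

lemma ClosedIn.inter_of_subset (hA : ClosedIn G S X A) (hB : ClosedIn G S C B)
    (hC : ∀ y ∈ C, y ∈ A → y ∈ B) : ClosedIn G S X (A ∩ B) := by
  refine ⟨fun x hx => hA.1 hx.1, fun x hx => hA.2.1 x hx.1, fun x hx y hy hxy => ?_⟩
  rcases hA.2.2 x hx.1 y hy hxy with h | h
  · rcases hB.2.2 x hx.2 y hy hxy with h' | h'
    · exact Or.inl ⟨h, h'⟩
    · exact Or.inl ⟨h, hC y h' h⟩
  · exact Or.inr h

/-- In a 2-connected graph no part of a two-vertex separation misses one of the two vertices. -/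
lemma BiConn.not_closedIn_singleton (hb : BiConn G Set.univ) (huv : u ≠ v) (hne : A.Nonempty)
    (hA : ClosedIn G Set.univ {u, v} A) (hu : ∀ y ∈ A, ¬ G.Adj u y) : False := by
  obtain ⟨y, hy, huy⟩ := hb.exists_adj trivial trivial huv hne hA
  exact hu y hy huy

lemma exists_disjoint_part [Finite V] {Y : Set V} (hY : Y.ncard ≤ 3) (hu : u ∈ Y) {A : Fin 3 → Set V}
    (hd : ∀ i j, i ≠ j → Disjoint (A i) (A j)) (huA : ∀ i, u ∉ A i) :
    ∃ i, Disjoint (A i) Y := by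
  by_contra hc
  push Not at hc
  simp only [Set.not_disjoint_iff] at hc
  choose y hyA hyY using hc
  have hinj : Function.Injective y := by
    intro i j hij
    by_contra hne
    exact Set.disjoint_left.1 (hd i j hne) (hyA i) (hij ▸ hyA j)
  have h1 : (Set.range y).ncard = 3 := by
    rw [← Set.image_univ, Set.ncard_image_of_injective _ hinj, Set.ncard_univ]
    simp
  have h2 : Set.range y ⊆ Y \ {u} := by
    rintro _ ⟨i, rfl⟩
    exact ⟨hyY i, fun h => huA i (by rw [Set.mem_singleton_iff] at h; exact h ▸ hyA i)⟩
  have h3 := Set.ncard_le_ncard h2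
  have h4 := Set.ncard_sdiff_singleton_add_one hu
  omega

lemma TreeDecomp.exists_common_bag [Finite V] (td : TreeDecomp G) (hw : ∀ x, (td.bag x).ncard ≤ 3)
    (hb : BiConn G Set.univ) (huv : u ≠ v) (h : ThreeSep G Set.univ {u, v}) :
    ∃ x, u ∈ td.bag x ∧ v ∈ td.bag x := by
  by_contra hc
  push Not at hc
  obtain ⟨A, hne, hd, hcl⟩ := h
  obtain ⟨q, hq⟩ := td.bag_cover u
  obtain ⟨n, hn⟩ := td.bag_cover v
  obtain ⟨p, ⟨-, hp⟩, k, ⟨-, hk⟩, K, hK, -, hnK⟩ := td.isTree.isAcyclic.exists_exit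
    (P := {x | u ∈ td.bag x}) td.induce_univ_connected (n := n) (q := q) trivial
    (fun h => hc n h hn) trivial hq
  have hvK := td.subset_of_mem hK (fun h => hc p hp h.1) hnK hn
  have huK : {x | u ∈ td.bag x} ⊆ Kᶜ :=
    td.subset_of_mem hK.compl (fun h => hk h.1) hK.2.1 hp
  obtain ⟨i, hi⟩ := exists_disjoint_part (hw p) hp hd fun i h => (hcl i).2.1 u h (by simp)
  have hside : ∀ B : Set V, ClosedIn G Set.univ (td.bag p ∩ td.bag k) B →
      ClosedIn G Set.univ {u, v} (A i ∩ B) := fun B hB =>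
    (hcl i).inter_of_subset hB fun y hy hyA => absurd hy.1 (Set.disjoint_left.1 hi hyA)
  have h1 : ∀ y ∈ A i, ¬ {x | y ∈ td.bag x} ⊆ K := by
    intro y hy hyK
    refine hb.not_closedIn_singleton (A := A i ∩ {y | {x | y ∈ td.bag x} ⊆ K}) huv ⟨y, hy, hyK⟩
      (hside _ (td.closedIn_side hK)) ?_
    intro z hz huz
    obtain ⟨m, h1, h2⟩ := td.bag_edge huz
    exact huK h1 (hz.2 h2)
  refine hb.not_closedIn_singleton huv.symm (hne i) (Set.pair_comm u v ▸ hcl i) ?_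
  intro z hz hvz
  obtain ⟨m, h2, h3⟩ := td.bag_edge hvz
  exact h1 z hz (td.subset_of_mem hK (fun h => Set.disjoint_left.1 hi hz h.1) (hvK h2) h3)

lemma TreeDecomp.exists_nbrs_subset_bag [Finite V] (td : TreeDecomp G) (hS : S.Nonempty) :
    ∃ x ∈ S, ∃ t, x ∈ td.bag t ∧ ∀ y ∈ S, G.Adj x y → y ∈ td.bag t := by
  have := td.finι
  have r := td.isTree.1.nonempty.some
  choose t ht hmin using fun y => Set.exists_min_image {x | y ∈ td.bag x}
    (fun x => td.tree.dist x r) (Set.toFinite _) (td.bag_cover y)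
  obtain ⟨x, hx, hmax⟩ := Set.exists_max_image S (fun y => td.tree.dist (t y) r) (Set.toFinite _) hS
  refine ⟨x, hx, t x, ht x, fun z hz hxz => ?_⟩
  by_contra hzt
  obtain ⟨n, hxn, hzn⟩ := td.bag_edge hxz
  obtain ⟨p, ⟨-, hp⟩, k, ⟨hxk, -⟩, K, hK, -, hnK⟩ := td.isTree.isAcyclic.exists_exit
    (P := {t x}) (td.bag_conn x) (n := n) (q := t x) hxn (fun h => hzt (h ▸ hzn)) (ht x) rfl
  rw [Set.mem_singleton_iff] at hp
  subst hp
  have hzK := td.subset_of_mem hK (fun h => hzt h.1) hnK hzn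
  by_cases hr : r ∈ K
  · have := hK.compl.dist_lt td.isTree.1 hK.2.1 (fun h => h hr)
    have := hmin x k hxk
    omega
  · have := hK.dist_lt td.isTree.1 (hzK (ht z)) hr
    have := hmax z hz
    omega

lemma exists_pair_of_ncard_le [Finite V] {Y : Set V} {x : V} (hY : Y.ncard ≤ 3) (hx : x ∈ Y) :
    ∃ a ∈ Y, ∃ b ∈ Y, ∀ y ∈ Y, y ≠ x → y = a ∨ y = b := by
  have h1 := Set.ncard_sdiff_singleton_add_one hx
  by_cases h : ∃ a ∈ Y, a ≠ x
  · obtain ⟨a, ha, hax⟩ := h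
    have h2 := Set.ncard_sdiff_singleton_add_one (s := Y \ {x}) (a := a) ⟨ha, hax⟩
    by_cases h' : ∃ b ∈ Y, b ≠ x ∧ b ≠ a
    · obtain ⟨b, hb, hbx, hba⟩ := h'
      have h3 : ((Y \ {x}) \ {a}).ncard ≤ 1 := by omega
      rw [Set.ncard_le_one] at h3
      refine ⟨a, ha, b, hb, fun y hy hyx => ?_⟩
      by_cases hya : y = a
      · exact Or.inl hya
      · exact Or.inr (h3 y ⟨⟨hy, hyx⟩, hya⟩ b ⟨⟨hb, hbx⟩, hba⟩)
    · push Not at h'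
      exact ⟨a, ha, a, ha, fun y hy hyx => Or.inl (h' y hy hyx)⟩
  · push Not at h
    exact ⟨x, hx, x, hx, fun y hy hyx => absurd (h y hy) hyx⟩

lemma TreeDecomp.elim2 [Finite V] (td : TreeDecomp G) (hw : ∀ x, (td.bag x).ncard ≤ 3) :
    Elim2 G S := by
  induction hn : S.ncard generalizing G S with
  | zero => exact .small _ _ (by omega)
  | succ n ih =>
    obtain ⟨x, hx, t, hxt, hN⟩ := td.exists_nbrs_subset_bag (S := S) (by
      rw [← Set.ncard_pos]; omega)
    obtain ⟨a, ha, b, hb, hab⟩ := exists_pair_of_ncard_le (hw t) hxt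
    refine .step _ _ x a b hx (fun y hy hxy => hab y (hN y hy hxy) hxy.ne') ?_
    have h1 := Set.ncard_sdiff_singleton_add_one hx
    refine ih (td.ofAdj (H := G ⊔ edge a b) fun u v huv => ?_) hw (by omega)
    rcases sup_edge_adj_iff.1 huv with h | ⟨⟨rfl, rfl⟩ | ⟨rfl, rfl⟩, -⟩
    · exact td.bag_edge h
    · exact ⟨t, ha, hb⟩
    · exact ⟨t, hb, ha⟩

lemma TreeDecomp.not_ncard_le_two [Finite V] (td : TreeDecomp G) (hb : BiConn G Set.univ)
    (h3 : 3 ≤ Nat.card V) (hw : ∀ x, (td.bag x).ncard ≤ 2) : False := by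
  have : Nonempty V := (Nat.card_pos_iff.1 (by omega)).1
  obtain ⟨x, -, t, hxt, hN⟩ := td.exists_nbrs_subset_bag (S := Set.univ) Set.univ_nonempty
  have h1 := Set.ncard_sdiff_singleton_add_one hxt
  have h2 : (td.bag t \ {x}).ncard ≤ 1 := by have := hw t; omega
  rw [Set.ncard_le_one] at h2
  rw [← Set.ncard_univ] at h3
  by_cases h : (td.bag t \ {x}).Nonempty
  · obtain ⟨c, hc⟩ := h
    exact hb.not_nbr_subsingleton h3 (x := x) (c := c) trivial fun y hy hxy =>
      h2 y ⟨hN y hy hxy, hxy.ne'⟩ c hc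
  · exact hb.not_nbr_subsingleton h3 (x := x) (c := x) trivial fun y hy hxy =>
      absurd ⟨y, hN y hy hxy, hxy.ne'⟩ h

end Decomp

section Spaghetti

variable {V : Type} {G H : SimpleGraph V} {S A B C X : Set V} {u v : V}

lemma eq_triple_of_ncard_le [Finite V] {Y : Set V} {z : V} (hY : Y.ncard ≤ 3) (hu : u ∈ Y) (hv : v ∈ Y)
    (hz : z ∈ Y) (huv : u ≠ v) (hzu : z ≠ u) (hzv : z ≠ v) : Y = {u, v, z} := by
  symm
  refine Set.eq_of_subset_of_ncard_le ?_ ?_ Y.toFinite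
  · rintro y (rfl | rfl | rfl) <;> assumption
  · rwa [Set.ncard_eq_three.2 ⟨u, v, z, huv, hzu.symm, hzv.symm, rfl⟩]

/-- Some vertex of every part of `H - {u, v}` shares a bag with both `u` and `v`. -/
lemma TreeDecomp.exists_mem_common_bag (td : TreeDecomp H)
    (hb : BiConn H Set.univ) (huv : u ≠ v) {q : td.ι} (hq : u ∈ td.bag q ∧ v ∈ td.bag q)
    (hA : ClosedIn H Set.univ {u, v} A) (hne : A.Nonempty) :
    ∃ z ∈ A, ∃ p, z ∈ td.bag p ∧ u ∈ td.bag p ∧ v ∈ td.bag p := by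
  by_contra hc
  push Not at hc
  obtain ⟨y, hy⟩ := hne
  obtain ⟨n, hyn⟩ := td.bag_cover y
  obtain ⟨p, ⟨-, hup, hvp⟩, k, ⟨-, hk⟩, K, hK, -, hnK⟩ := td.isTree.isAcyclic.exists_exit
    (P := {x | u ∈ td.bag x ∧ v ∈ td.bag x}) td.induce_univ_connected (n := n) (q := q) trivial
    (fun h => hc y hy n hyn h.1 h.2) trivial hq
  have hyK : {x | y ∈ td.bag x} ⊆ K :=
    td.subset_of_mem hK (fun h => hc y hy p h.1 hup hvp) hnK hyn
  have hcl : ClosedIn H Set.univ {u, v} (A ∩ {y | {x | y ∈ td.bag x} ⊆ K}) :=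
    hA.inter_of_subset (td.closedIn_side hK) fun z hz hzA => absurd hvp (hc z hzA p hz.1 hup)
  have hWne : (A ∩ {y | {x | y ∈ td.bag x} ⊆ K}).Nonempty := ⟨y, hy, hyK⟩
  have key : ∀ w, w ∈ td.bag p → w ∉ td.bag k →
      ∀ z ∈ A ∩ {y | {x | y ∈ td.bag x} ⊆ K}, ¬ H.Adj w z := by
    intro w hwp hwk z hz hwz
    obtain ⟨m, h1, h2⟩ := td.bag_edge hwz
    exact td.subset_of_mem hK.compl (fun h => hwk h.1) hK.2.1 hwp h1 (hz.2 h2)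
  by_cases huk : u ∈ td.bag k
  · exact hb.not_closedIn_singleton huv.symm hWne (Set.pair_comm u v ▸ hcl)
      (key v hvp fun h => hk ⟨huk, h⟩)
  · exact hb.not_closedIn_singleton huv hWne hcl (key u hup huk)

lemma SpaghettiTD.exists_leaf [Finite V] (td : SpaghettiTD H) (hw : ∀ x, (td.bag x).ncard ≤ 3)
    (hb : BiConn H Set.univ) (huv : u ≠ v) {q : td.ι} (hq : u ∈ td.bag q ∧ v ∈ td.bag q)
    (hA : ClosedIn H Set.univ {u, v} A) (hne : A.Nonempty) (hfat : ∀ p ∈ A, ∃ q ∈ A, H.Adj p q) :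
    ∃ z ∈ A, ∃ p, td.bag p = {u, v, z} ∧
      {y | (u ∈ td.bag y ∧ v ∈ td.bag y) ∧ td.tree.Adj p y}.ncard ≤ 1 := by
  have := td.finι
  obtain ⟨z, hzA, q, hzq, hqu, hqv⟩ := td.exists_mem_common_bag hb huv hq hA hne
  have hAX : ∀ y ∈ A, y ≠ u ∧ y ≠ v := fun y hy => by simpa using hA.2.1 y hy
  have htriple : ∀ p, u ∈ td.bag p → v ∈ td.bag p → z ∈ td.bag p → td.bag p = {u, v, z} :=
    fun p h1 h2 h3 => eq_triple_of_ncard_le (hw p) h1 h2 h3 huv (hAX z hzA).1 (hAX z hzA).2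
  obtain ⟨z', hzA', hzz⟩ := hfat z hzA
  have hnot : ∀ p, u ∈ td.bag p → v ∈ td.bag p → z ∈ td.bag p → z' ∉ td.bag p := by
    intro p h1 h2 h3 h4
    rw [htriple p h1 h2 h3] at h4
    rcases h4 with h | h | h
    exacts [(hAX z' hzA').1 h, (hAX z' hzA').2 h, hzz.ne' h]
  obtain ⟨n, hzn, hzn'⟩ := td.bag_edge hzz
  obtain ⟨p, ⟨hzp, hup, hvp⟩, k, ⟨hzk, hk⟩, K, hK, hpk, hnK⟩ := td.isTree.isAcyclic.exists_exit
    (P := {x | u ∈ td.bag x ∧ v ∈ td.bag x}) (td.bag_conn z) (n := n) (q := q) hzn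
    (fun h => hnot n h.1 h.2 hzn hzn') hzq ⟨hqu, hqv⟩
  refine ⟨z, hzA, p, htriple p hup hvp hzp, ?_⟩
  have hleaf : ∀ w, w ∈ td.bag p → w ∈ td.bag k →
      (∀ y, u ∈ td.bag y ∧ v ∈ td.bag y → w ∈ td.bag y) →
      {y | (u ∈ td.bag y ∧ v ∈ td.bag y) ∧ td.tree.Adj p y}.ncard ≤ 1 := by
    intro w hwp hwk hsub
    have h2 := (td.bag_path w).2 p hwp
    have h3 := Set.ncard_sdiff_singleton_add_one
      (s := {y | w ∈ td.bag y ∧ td.tree.Adj p y}) (a := k) ⟨hwk, hpk⟩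
    have h4 : {y | (u ∈ td.bag y ∧ v ∈ td.bag y) ∧ td.tree.Adj p y} ⊆
        {y | w ∈ td.bag y ∧ td.tree.Adj p y} \ {k} := fun y hy =>
      ⟨⟨hsub y hy.1, hy.2⟩, fun h => hk (h ▸ hy.1)⟩
    have h5 := Set.ncard_le_ncard h4
    simp only [Set.mem_ofPred_eq] at h2
    omega
  by_cases huk : u ∈ td.bag k
  · exact hleaf u hup huk fun y h => h.1
  by_cases hvk : v ∈ td.bag k
  · exact hleaf v hvp hvk fun y h => h.2
  exfalso
  have hcl := td.closedIn_side hK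
  have hz : td.bag p ∩ td.bag k = {z} := by
    rw [htriple p hup hvp hzp]
    ext y
    simp only [Set.mem_inter_iff, Set.mem_insert_iff, Set.mem_singleton_iff]
    constructor
    · rintro ⟨rfl | rfl | rfl, h⟩
      exacts [absurd h huk, absurd h hvk, rfl]
    · rintro rfl
      exact ⟨Or.inr (Or.inr rfl), hzk⟩
  rw [hz] at hcl
  have := hb.2 z trivial _ ⟨z', td.subset_of_mem hK (fun h => hnot p hup hvp hzp h.1) hnK hzn'⟩ hcl
  have hu : u ∈ Set.univ \ {z} := ⟨trivial, (hAX z hzA).1.symm⟩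
  rw [← this] at hu
  exact hK.2.1 (hu hup)

lemma SpaghettiTD.not_fatSep [Finite V] (td : SpaghettiTD H) (hw : ∀ x, (td.bag x).ncard ≤ 3)
    (hb : BiConn H Set.univ) (huv : H.Adj u v) : ¬ FatSep H u v := by
  rintro ⟨A, hne, hd, hcl, hfat⟩
  have := td.finι
  obtain ⟨q, hq⟩ := td.bag_edge huv
  choose z hzA p hp hleaf using fun i =>
    td.exists_leaf hw hb huv.ne hq (hcl i) (hne i) (hfat i)
  let P := {x | u ∈ td.bag x} ∩ {x | v ∈ td.bag x}
  have hpP : ∀ i, p i ∈ P := fun i => by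
    constructor <;> rw [Set.mem_ofPred_eq, hp] <;> simp
  have hinj : ∀ i j, p i = p j → i = j := by
    intro i j hij
    by_contra hne
    have h1 : z i ∈ td.bag (p j) := by rw [← hij, hp]; simp
    have h2 := (hcl i).2.1 _ (hzA i)
    rw [hp] at h1
    simp only [Set.mem_insert_iff, Set.mem_singleton_iff, not_or] at h1 h2
    rcases h1 with h | h | h
    · exact h2.1 h
    · exact h2.2 h
    · exact Set.disjoint_left.1 (hd i j hne) (hzA i) (h ▸ hzA j)
  have hT : (td.tree.induce P).IsTree :=
    ⟨td.isTree.isAcyclic.induce_inter_connected (td.bag_conn u) (td.bag_conn v) ⟨q, hq⟩,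
      td.isTree.isAcyclic.induce P⟩
  have hcard : ∀ x : P, {y | (td.tree.induce P).Adj x y}.ncard =
      {y | y ∈ P ∧ td.tree.Adj x y}.ncard := by
    intro x
    rw [← Set.ncard_image_of_injective _ Subtype.val_injective]
    congr 1
    ext y
    simp [and_comm]
  refine hT.not_three_leaves (fun x => ?_) (fun i => ⟨p i, hpP i⟩)
    (fun i j h => hinj i j (Subtype.ext_iff.1 h)) fun i => ?_
  · rw [hcard]
    refine le_trans (Set.ncard_le_ncard ?_) ((td.bag_path u).2 x x.2.1)
    exact fun y hy => ⟨hy.1.1, hy.2⟩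
  · rw [hcard]
    exact hleaf i

end Spaghetti

/-! ### Attaching leaves to trees -/

section Leaf

variable {ι : Type} {T : SimpleGraph ι} {t : ι}

lemma isAcyclic_of_isSide (h : ∀ p k, T.Adj p k → ∃ K, IsSide T p k K) : T.IsAcyclic := by
  rw [isAcyclic_iff_forall_adj_isBridge]
  intro p k hpk
  obtain ⟨K, hK⟩ := h p k hpk
  rw [isBridge_iff]
  rintro ⟨w⟩
  obtain ⟨d, -, h1, h2⟩ := w.exists_boundary_dart Kᶜ hK.2.1 (fun h => h hK.1)
  have hd := deleteEdges_adj.1 d.adj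
  obtain ⟨h3, h4⟩ := hK.2.2 _ (not_not.1 h2) _ h1 hd.1.symm
  exact hd.2 (by rw [h3, h4]; rfl)

/-- The graph obtained from `T` by attaching a new leaf to `t`. -/
def attachLeaf (T : SimpleGraph ι) (t : ι) : SimpleGraph (Option ι) where
  Adj x y := match x, y with
    | some x, some y => T.Adj x y
    | some x, none => x = t
    | none, some y => y = t
    | none, none => False
  symm := ⟨by
    rintro (_ | x) (_ | y) h
    exacts [h, h, h, h.symm]⟩
  loopless := ⟨by
    rintro (_ | x) h
    exacts [h, T.irrefl h]⟩

lemma SimpleGraph.IsTree.attachLeaf (hT : T.IsTree) : (attachLeaf T t).IsTree := by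
  refine ⟨?_, isAcyclic_of_isSide ?_⟩
  · rw [connected_iff_exists_forall_reachable]
    refine ⟨some t, ?_⟩
    rintro (_ | x)
    · exact Adj.reachable (by exact rfl)
    · let φ : T →g _root_.attachLeaf T t := ⟨some, fun h => h⟩
      exact (hT.1.preconnected t x).map φ
  · rintro (_ | p) (_ | k) h
    · exact h.elim
    · refine ⟨Set.range some, ⟨k, rfl⟩, by simp, ?_⟩
      rintro _ ⟨n, rfl⟩ (_ | m) hm hnm
      · obtain rfl : n = t := hnm
        obtain rfl : k = n := h
        exact ⟨rfl, rfl⟩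
      · exact absurd ⟨m, rfl⟩ hm
    · refine ⟨{none}, rfl, by simp, ?_⟩
      rintro _ rfl (_ | m) hm hnm
      · exact absurd rfl hm
      · obtain rfl : p = t := h
        obtain rfl : m = p := hnm
        exact ⟨rfl, rfl⟩
    · obtain ⟨K, hK⟩ := hT.isAcyclic.exists_isSide h
      refine ⟨{x | x.getD t ∈ K}, hK.1, hK.2.1, ?_⟩
      rintro (_ | n) hn (_ | m) hm hnm
      · exact hnm.elim
      · obtain rfl : m = t := hnm
        exact absurd hn hm
      · obtain rfl : n = t := hnm
        exact absurd hn hm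
      · obtain ⟨rfl, rfl⟩ := hK.2.2 n hn m hm hnm
        exact ⟨rfl, rfl⟩

lemma IsPathSet.attachLeaf [Finite ι] {X : Set ι} {Y : Set (Option ι)}
    (hX : X.Nonempty → IsPathSet T X)
    (ht : none ∈ Y → X.Nonempty → t ∈ X ∧ {y | y ∈ X ∧ T.Adj t y}.ncard ≤ 1)
    (hY : ∀ x, some x ∈ Y ↔ x ∈ X) (hne : Y.Nonempty) : IsPathSet (_root_.attachLeaf T t) Y := by
  refine ⟨induce_connected_iff.2 ⟨hne, fun A hA hcl => hcl.1.antisymm ?_⟩, ?_⟩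
  · by_cases h0 : ∃ a, some a ∈ A
    · obtain ⟨a, ha⟩ := h0
      have haX := (hY a).1 (hcl.1 ha)
      have := (induce_connected_iff.1 (hX ⟨a, haX⟩).1).2 {a | some a ∈ A} ⟨a, ha⟩
        ⟨fun b hb => (hY b).1 (hcl.1 hb), by simp, fun b hb c hc hbc =>
          Or.inl ((hcl.2.2 _ hb (some c) ((hY c).2 hc) hbc).resolve_right (by simp))⟩
      rintro (_ | y) hy
      · have htX := (ht hy ⟨a, haX⟩).1
        rw [← this] at htX
        exact (hcl.2.2 _ htX none hy rfl).resolve_right (by simp)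
      · have hyX := (hY y).1 hy
        rwa [← this] at hyX
    · push Not at h0
      have hnA : none ∈ A := by
        obtain ⟨a | a, ha⟩ := hA
        · exact ha
        · exact absurd ha (h0 _)
      rintro (_ | y) hy
      · exact hnA
      · have htX := (ht (hcl.1 hnA) ⟨y, (hY y).1 hy⟩).1
        have := (hcl.2.2 _ hnA (some t) ((hY t).2 htX) rfl).resolve_right (by simp)
        exact absurd this (h0 _)
  · rintro (_ | x) hx
    · refine (Set.ncard_le_ncard (t := {some t}) ?_).trans (by simp)
      rintro (_ | y) ⟨-, h⟩
      · exact h.elim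
      · obtain rfl : y = t := h
        rfl
    · have hxX := (hY x).1 hx
      have himg : ∀ Z : Set ι, (some '' Z).ncard = Z.ncard := fun Z =>
        Set.ncard_image_of_injective _ (Option.some_injective ι)
      by_cases h : none ∈ Y ∧ x = t
      · obtain ⟨hn, rfl⟩ := h
        have h1 := (ht hn ⟨x, hxX⟩).2
        refine (Set.ncard_le_ncard
          (t := insert none (some '' {y | y ∈ X ∧ T.Adj x y})) ?_).trans ?_
        · rintro (_ | y) ⟨h, h'⟩
          · exact Or.inl rfl
          · exact Or.inr ⟨y, ⟨(hY y).1 h, h'⟩, rfl⟩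
        · refine (Set.ncard_insert_le _ _).trans ?_
          rw [himg]
          omega
      · refine (Set.ncard_le_ncard (t := some '' {y | y ∈ X ∧ T.Adj x y}) ?_).trans ?_
        · rintro (_ | y) ⟨h1, h2⟩
          · exact absurd ⟨h1, h2⟩ h
          · exact ⟨y, ⟨(hY y).1 h1, h2⟩, rfl⟩
        · rw [himg]
          exact (hX ⟨x, hxX⟩).2 x hxX

end Leaf

/-- A tree with bags of size at most three such that the nodes containing a vertex form
a path. -/
structure SpagTree (V : Type) where
  ι : Type
  finι : Finite ι
  tree : SimpleGraph ι
  isTree : tree.IsTree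
  bag : ι → Set V
  ncard_bag : ∀ x, (bag x).ncard ≤ 3
  path : ∀ v, {x | v ∈ bag x}.Nonempty → IsPathSet tree {x | v ∈ bag x}

namespace SpagTree

variable {V : Type} {D D' : SpagTree V} {B C : Set V}

/-- The nodes of degree at most one with bag `B`. -/
def leaves (D : SpagTree V) (B : Set V) : Set D.ι :=
  {t | D.bag t = B ∧ {y | D.tree.Adj t y}.ncard ≤ 1}

/-- `D'` arises from `D` by attaching a new leaf `n` with bag `B` to the node `t`. -/
structure IsAttach (D : SpagTree V) (t : D.ι) (B : Set V) (D' : SpagTree V) (e : D.ι → D'.ι)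
    (n : D'.ι) : Prop where
  inj : Function.Injective e
  bag : ∀ x, D'.bag (e x) = D.bag x
  bag_new : D'.bag n = B
  cases : ∀ y, (∃ x, y = e x) ∨ y = n
  ne : ∀ x, e x ≠ n
  adj : ∀ x y, D'.tree.Adj (e x) (e y) ↔ D.tree.Adj x y
  adj_new : ∀ x, D'.tree.Adj (e x) n ↔ x = t

lemma exists_isAttach (D : SpagTree V) (t : D.ι) (B : Set V) (hB : B.ncard ≤ 3)
    (h : ∀ v ∈ B, {x | v ∈ D.bag x}.Nonempty →
      v ∈ D.bag t ∧ {y | v ∈ D.bag y ∧ D.tree.Adj t y}.ncard ≤ 1) :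
    ∃ D' e n, IsAttach D t B D' e n := by
  have := D.finι
  refine ⟨⟨Option D.ι, inferInstance, attachLeaf D.tree t, D.isTree.attachLeaf,
    fun x => x.elim B D.bag, ?_, fun v hv => ?_⟩, some, none, ?_⟩
  · rintro (_ | x)
    exacts [hB, D.ncard_bag x]
  · exact IsPathSet.attachLeaf (D.path v) (h v) (fun x => Iff.rfl) hv
  · refine ⟨Option.some_injective _, fun x => rfl, rfl, ?_, by simp, fun x y => Iff.rfl, fun x => Iff.rfl⟩
    rintro (_ | x)
    exacts [Or.inr rfl, Or.inl ⟨x, rfl⟩]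

namespace IsAttach

variable {t : D.ι} {e : D.ι → D'.ι} {n : D'.ι}

lemma setOf_adj_of_ne (h : IsAttach D t B D' e n) {x : D.ι} (hx : x ≠ t) :
    {y | D'.tree.Adj (e x) y} = e '' {y | D.tree.Adj x y} := by
  ext y
  constructor
  · intro hy
    obtain ⟨z, rfl⟩ | rfl := h.cases y
    · exact ⟨z, (h.adj x z).1 hy, rfl⟩
    · exact absurd ((h.adj_new x).1 hy) hx
  · rintro ⟨z, hz, rfl⟩
    exact (h.adj x z).2 hz

lemma setOf_adj_new (h : IsAttach D t B D' e n) : {y | D'.tree.Adj n y} = {e t} := by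
  ext y
  simp only [Set.mem_ofPred_eq, Set.mem_singleton_iff]
  constructor
  · intro hy
    obtain ⟨z, rfl⟩ | rfl := h.cases y
    · rw [(h.adj_new z).1 hy.symm]
    · exact absurd hy (D'.tree.irrefl)
  · rintro rfl
    exact ((h.adj_new t).2 rfl).symm

lemma new_mem_leaves (h : IsAttach D t B D' e n) : n ∈ D'.leaves B :=
  ⟨h.bag_new, by rw [h.setOf_adj_new, Set.ncard_singleton]⟩

lemma mem_leaves (h : IsAttach D t B D' e n) {x : D.ι} (hx : x ≠ t) (hl : x ∈ D.leaves C) :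
    e x ∈ D'.leaves C := by
  refine ⟨(h.bag x).trans hl.1, ?_⟩
  rw [h.setOf_adj_of_ne hx, Set.ncard_image_of_injective _ h.inj]
  exact hl.2

lemma ncard_le (h : IsAttach D t B D' e n) :
    {x | D.bag x = C}.ncard ≤ {x | D'.bag x = C}.ncard := by
  have := D'.finι
  refine Set.ncard_le_ncard_of_injOn e (fun x hx => (h.bag x).trans hx) h.inj.injOn

lemma ncard_lt (h : IsAttach D t B D' e n) :
    {x | D.bag x = B}.ncard < {x | D'.bag x = B}.ncard := by
  have := D'.finι
  have := D.finι
  rw [← Set.ncard_image_of_injective _ h.inj, Nat.lt_iff_add_one_le,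
    ← Set.ncard_insert_of_notMem (a := n)]
  · refine Set.ncard_le_ncard ?_
    rintro _ (rfl | ⟨x, hx, rfl⟩)
    exacts [h.bag_new, (h.bag x).trans hx]
  · rintro ⟨x, -, hx⟩
    exact h.ne x hx

lemma bag_subset (h : IsAttach D t B D' e n) {S : Set V} (hD : ∀ x, D.bag x ⊆ S) (hB : B ⊆ S)
    (y : D'.ι) : D'.bag y ⊆ S := by
  obtain ⟨x, rfl⟩ | rfl := h.cases y
  · rw [h.bag]; exact hD x
  · rwa [h.bag_new]

end IsAttach

/-- Repeatedly attaching copies of a leaf keeps the number of leaves. -/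
lemma exists_chain (D : SpagTree V) (hl : (D.leaves B).Nonempty) (N : ℕ) :
    ∃ D' : SpagTree V, (∀ S, (∀ x, D.bag x ⊆ S) → ∀ x, D'.bag x ⊆ S) ∧
      (∀ C, {x | D.bag x = C}.ncard ≤ {x | D'.bag x = C}.ncard) ∧
      N ≤ {x | D'.bag x = B}.ncard ∧ ∀ C, (D.leaves C).ncard ≤ (D'.leaves C).ncard := by
  induction N with
  | zero => exact ⟨D, fun S h => h, fun C => le_rfl, Nat.zero_le _, fun C => le_rfl⟩
  | succ N ih =>
    obtain ⟨D₁, h1, h2, h3, h4⟩ := ih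
    have := D₁.finι
    have := D.finι
    obtain ⟨t, ht⟩ : (D₁.leaves B).Nonempty := by
      rw [← Set.ncard_pos] at hl ⊢
      exact hl.trans_le (h4 B)
    obtain ⟨D₂, e, n, h⟩ := D₁.exists_isAttach t B (ht.1 ▸ D₁.ncard_bag t) (fun v hv _ =>
      ⟨ht.1.symm ▸ hv, (Set.ncard_le_ncard fun y hy => hy.2).trans ht.2⟩)
    have := D₂.finι
    refine ⟨D₂, fun S hS x => h.bag_subset (h1 S hS) (ht.1 ▸ h1 S hS t) x,
      fun C => (h2 C).trans h.ncard_le, h3.trans_lt h.ncard_lt, fun C => (h4 C).trans ?_⟩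
    classical
    refine Set.ncard_le_ncard_of_injOn (fun x => if x = t then n else e x) (fun x hx => ?_)
      (fun x _ y _ hxy => ?_)
    · by_cases hxt : x = t
      · subst hxt
        simp only [if_true]
        rw [← hx.1, ht.1]
        exact h.new_mem_leaves
      · simp only [if_neg hxt]
        exact h.mem_leaves hxt hx
    · by_cases hx : x = t <;> by_cases hy : y = t <;> simp only [hx, hy, if_true, if_false] at hxy ⊢
      · exact absurd hxy.symm (h.ne y)
      · exact absurd hxy (h.ne x)
      · exact h.inj hxy

end SpagTree

section Construction

variable {V : Type} {H : SimpleGraph V} {S : Set V} {a b x : V}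

lemma ncard_triple_le (a b x : V) : ({a, b, x} : Set V).ncard ≤ 3 := by
  have h1 := Set.ncard_insert_le a {b, x}
  have h2 := Set.ncard_insert_le b {x}
  rw [Set.ncard_singleton] at h2
  omega

lemma SpagTree.exists_edge [Finite V] (a b : V) (N : ℕ) :
    ∃ D : SpagTree V, (∀ x, D.bag x ⊆ {a, b}) ∧ N ≤ {x | D.bag x = {a, b}}.ncard ∧
      1 < (D.leaves {a, b}).ncard := by
  have h2 : ({a, b} : Set V).ncard ≤ 3 := by
    have := ncard_triple_le a b b
    simpa using this
  let D₀ : SpagTree V := ⟨Unit, inferInstance, ⊥, IsTree.of_subsingleton, fun _ => {a, b},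
    fun _ => h2, fun v hv => ⟨?_, fun x _ => by simp⟩⟩
  · obtain ⟨D₁, e, n, h⟩ := D₀.exists_isAttach () {a, b} h2 fun v hv _ => ⟨hv, by
      simp [D₀]⟩
    have := D₁.finι
    have hl : e () ∈ D₁.leaves {a, b} := by
      refine ⟨h.bag (), ?_⟩
      refine (Set.ncard_le_ncard (t := {n}) ?_).trans (by simp)
      intro y hy
      obtain ⟨z, rfl⟩ | rfl := h.cases y
      · exact absurd ((h.adj () z).1 hy) (by simp [D₀])
      · rfl
    obtain ⟨D₂, h1, -, h3, h4⟩ := D₁.exists_chain ⟨_, hl⟩ N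
    refine ⟨D₂, h1 _ (h.bag_subset (fun _ => subset_rfl) subset_rfl), h3, ?_⟩
    refine lt_of_lt_of_le ?_ (h4 _)
    exact (Set.one_lt_ncard (Set.toFinite _)).2 ⟨_, hl, n, h.new_mem_leaves, h.ne ()⟩
  · obtain ⟨y, hy⟩ := hv
    have : Nonempty {x : Unit | v ∈ ({a, b} : Set V)} := ⟨⟨y, hy⟩⟩
    exact Connected.of_subsingleton

lemma SpagTree.exists_triangle [Finite V] (D : SpagTree V) (hab : a ≠ b) (hax : a ≠ x)
    (hbx : b ≠ x) {t : D.ι} (ht : t ∈ D.leaves {a, b}) (hx : ∀ y, x ∉ D.bag y) (N : ℕ) :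
    ∃ D' : SpagTree V, (∀ S, x ∈ S → (∀ x, D.bag x ⊆ S) → ∀ x, D'.bag x ⊆ S) ∧
      (∀ C, {x | D.bag x = C}.ncard ≤ {x | D'.bag x = C}.ncard) ∧
      (∀ c, c = a ∨ c = b → N ≤ {y | D'.bag y = {c, x}}.ncard ∧ (D'.leaves {c, x}).Nonempty) ∧
      ∀ C, (∃ t' ∈ D.leaves C, t' ≠ t) → (D'.leaves C).Nonempty := by
  have := D.finι
  have hat : a ∈ D.bag t := by rw [ht.1]; simp
  have hbt : b ∈ D.bag t := by rw [ht.1]; simp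
  obtain ⟨D₁, e₁, n₁, h₁⟩ := D.exists_isAttach t {a, b, x} (ncard_triple_le _ _ _) (by
    have hle : ∀ v, {y | v ∈ D.bag y ∧ D.tree.Adj t y}.ncard ≤ 1 := fun v =>
      (Set.ncard_le_ncard fun y hy => hy.2).trans ht.2
    rintro v (rfl | rfl | rfl) ⟨y, hy⟩
    exacts [⟨hat, hle _⟩, ⟨hbt, hle _⟩, absurd hy (hx y)])
  have := D₁.finι
  obtain ⟨D₂, e₂, n₂, h₂⟩ := D₁.exists_isAttach n₁ {a, x}
    (by have := ncard_triple_le a x x; simpa using this) (by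
      have hle : ∀ v, {y | v ∈ D₁.bag y ∧ D₁.tree.Adj n₁ y}.ncard ≤ 1 := fun v =>
        (Set.ncard_le_ncard fun y hy => hy.2).trans h₁.new_mem_leaves.2
      rintro v (rfl | rfl) -
      · exact ⟨by rw [h₁.bag_new]; simp, hle _⟩
      · exact ⟨by rw [h₁.bag_new]; simp, hle _⟩)
  have := D₂.finι
  have hadj : ∀ y, D₂.tree.Adj (e₂ n₁) y → y = e₂ (e₁ t) ∨ y = n₂ := by
    intro y hy
    obtain ⟨z, rfl⟩ | rfl := h₂.cases y
    · have hz : z ∈ {z | D₁.tree.Adj n₁ z} := (h₂.adj _ _).1 hy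
      rw [h₁.setOf_adj_new] at hz
      exact Or.inl (congrArg e₂ hz)
    · exact Or.inr rfl
  obtain ⟨D₃, e₃, n₃, h₃⟩ := D₂.exists_isAttach (e₂ n₁) {b, x}
    (by have := ncard_triple_le b x x; simpa using this) (by
      rintro v hv -
      refine ⟨?_, ?_⟩
      · rw [h₂.bag, h₁.bag_new]
        exact Or.inr hv
      rcases hv with rfl | rfl
      · refine (Set.ncard_le_ncard (t := {e₂ (e₁ t)}) ?_).trans (by simp)
        rintro y ⟨hvy, hy⟩
        rcases hadj y hy with rfl | rfl
        · rfl
        · rw [h₂.bag_new] at hvy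
          rcases hvy with h | h
          exacts [absurd h hab.symm, absurd h hbx]
      · refine (Set.ncard_le_ncard (t := {n₂}) ?_).trans (by simp)
        rintro y ⟨hvy, hy⟩
        rcases hadj y hy with rfl | rfl
        · rw [h₂.bag, h₁.bag] at hvy
          exact absurd hvy (hx t)
        · rfl)
  obtain ⟨D₄, s4, m4, c4, l4⟩ := D₃.exists_chain ⟨_, h₃.new_mem_leaves⟩ N
  have hla : (D₃.leaves {a, x}).Nonempty :=
    ⟨_, h₃.mem_leaves (h₂.ne _).symm h₂.new_mem_leaves⟩
  have := D₃.finι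
  have := D₄.finι
  have hmono : ∀ C, (D₃.leaves C).Nonempty → (D₄.leaves C).Nonempty := fun C h => by
    rw [← Set.ncard_pos] at h ⊢
    exact h.trans_le (l4 C)
  obtain ⟨D₅, s5, m5, c5, l5⟩ := D₄.exists_chain (hmono _ hla) N
  have := D₅.finι
  have hmono' : ∀ C, (D₄.leaves C).Nonempty → (D₅.leaves C).Nonempty := fun C h => by
    rw [← Set.ncard_pos] at h ⊢
    exact h.trans_le (l5 C)
  refine ⟨D₅, fun S hxS hS => ?_, fun C => ?_, ?_, fun C ⟨t', ht', hne⟩ => ?_⟩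
  · have hs : ({a, b, x} : Set V) ⊆ S := by
      rintro y (rfl | rfl | rfl)
      exacts [hS t hat, hS t hbt, hxS]
    refine s5 S (s4 S (h₃.bag_subset (h₂.bag_subset (h₁.bag_subset hS hs) ?_) ?_))
    · exact fun y hy => hs (by rcases hy with rfl | rfl <;> simp)
    · exact fun y hy => hs (Or.inr hy)
  · exact h₁.ncard_le.trans (h₂.ncard_le.trans (h₃.ncard_le.trans ((m4 C).trans (m5 C))))
  · rintro c (rfl | rfl)
    · exact ⟨c5, hmono' _ (hmono _ hla)⟩
    · exact ⟨c4.trans (m5 _), hmono' _ (hmono _ ⟨_, h₃.new_mem_leaves⟩)⟩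
  · exact hmono' _ (hmono _ ⟨_, h₃.mem_leaves (fun h => h₁.ne t' (h₂.inj h))
      (h₂.mem_leaves (h₁.ne t') (h₁.mem_leaves hne ht'))⟩)

lemma eq_pair_of_ncard_eq_two [Finite V] (h : S.ncard = 2) (ha : a ∈ S) (hb : b ∈ S)
    (hab : a ≠ b) : S = {a, b} := by
  symm
  refine Set.eq_of_subset_of_ncard_le ?_ (by rw [h, Set.ncard_pair hab]) S.toFinite
  rintro y (rfl | rfl) <;> assumption

lemma BiConn.exists_spagTree [Finite V] (N : ℕ) (hb : BiConn H S) (he : Elim2 H S)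
    (h2 : 2 ≤ S.ncard) (hs : ∀ u ∈ S, ∀ v ∈ S, u ≠ v → ¬ ThreeSep H S {u, v}) :
    ∃ D : SpagTree V, (∀ x, D.bag x ⊆ S) ∧
      (∀ c ∈ S, ∀ d ∈ S, H.Adj c d → N ≤ {x | D.bag x = {c, d}}.ncard) ∧
      (∀ c ∈ S, ∀ d ∈ S, H.Adj c d → ¬ TwoSep H S {c, d} → (D.leaves {c, d}).Nonempty) ∧
      (S.ncard = 2 → 1 < (D.leaves S).ncard) := by
  induction hn : S.ncard generalizing H S with
  | zero => omega
  | succ n ih =>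
    by_cases h3 : S.ncard = 2
    · obtain ⟨a, b, hab, rfl⟩ := Set.ncard_eq_two.1 h3
      obtain ⟨D, h4, h5, h6⟩ := SpagTree.exists_edge a b N
      have hcd : ∀ c ∈ ({a, b} : Set V), ∀ d ∈ ({a, b} : Set V), H.Adj c d →
          ({a, b} : Set V) = {c, d} := fun c hc d hd hcd =>
        eq_pair_of_ncard_eq_two h3 hc hd hcd.ne
      have := D.finι
      refine ⟨D, h4, fun c hc d hd h => hcd c hc d hd h ▸ h5, fun c hc d hd h _ => ?_,
        fun _ => h6⟩
      rw [← hcd c hc d hd h, ← Set.ncard_pos]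
      omega
    · obtain ⟨x, hx, a, ha, b, hb', hab, hax, hbx, hN, he', hr⟩ :=
        hb.exists_reduction (by omega) he
      have hcard := Set.ncard_sdiff_singleton_add_one hx
      have ha' : a ∈ S \ {x} := ⟨ha, hax⟩
      have hb'' : b ∈ S \ {x} := ⟨hb', hbx⟩
      have hpair : ∀ u ∈ S \ {x}, ∀ v ∈ S \ {x}, ({u, v} : Set V) ⊆ S \ {x} := by
        rintro u hu v hv y (rfl | rfl) <;> assumption
      obtain ⟨D, h4, h5, h6, h7⟩ := ih (hr.biConn hb) he' (by omega)
        (fun u hu v hv huv h => hs u hu.1 v hv.1 huv (hr.threeSep (hpair u hu v hv) h)) (by omega)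
      have := D.finι
      have hle : H ≤ H ⊔ edge a b := le_sup_left
      have hadj : (H ⊔ edge a b).Adj a b := sup_edge_adj_iff.2 (Or.inr ⟨Or.inl ⟨rfl, rfl⟩, hab⟩)
      obtain ⟨t, ht⟩ := h6 a ha' b hb'' hadj fun h => hs a ha b hb' hab
        (hr.threeSep_of_twoSep (hpair a ha' b hb'') hx (fun y hy hxy => (hN y hy).1 hxy) h)
      obtain ⟨D', s, m, l, o⟩ := D.exists_triangle hab hax hbx ht (fun y hy => (h4 y hy).2 rfl) N
      have hxe : ∀ c ∈ S, H.Adj x c → N ≤ {y | D'.bag y = {c, x}}.ncard ∧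
          (D'.leaves {c, x}).Nonempty := fun c hc h => l c ((hN c hc).1 h)
      refine ⟨D', s S hx fun y z hz => (h4 y hz).1, fun c hc d hd hcd => ?_,
        fun c hc d hd hcd hsep => ?_, fun h => absurd (hn.trans h) h3⟩
      · by_cases hcx : c = x
        · subst hcx
          rw [Set.pair_comm]
          exact (hxe d hd hcd).1
        by_cases hdx : d = x
        · subst hdx
          exact (hxe c hc hcd.symm).1
        · exact (h5 c ⟨hc, hcx⟩ d ⟨hd, hdx⟩ (hle hcd)).trans (m _)
      · by_cases hcx : c = x
        · subst hcx
          rw [Set.pair_comm]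
          exact (hxe d hd hcd).2
        by_cases hdx : d = x
        · subst hdx
          exact (hxe c hc hcd.symm).2
        have hc' : c ∈ S \ {x} := ⟨hc, hcx⟩
        have hd' : d ∈ S \ {x} := ⟨hd, hdx⟩
        obtain ⟨t', ht'⟩ := h6 c hc' d hd' (hle hcd) fun h =>
          hsep (hr.twoSep (hpair c hc' d hd') h)
        apply o
        by_cases heq : ({c, d} : Set V) = {a, b}
        · rw [heq] at hsep ⊢
          by_cases h8 : (S \ {x}).ncard = 2
          · rw [eq_pair_of_ncard_eq_two h8 ha' hb'' hab] at h7
            obtain ⟨p, hp, q, hq, hpq⟩ := (Set.one_lt_ncard (Set.toFinite _)).1 (h7 (by omega))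
            by_cases hpt : p = t
            · exact ⟨q, hq, fun h => hpq (hpt.trans h.symm)⟩
            · exact ⟨p, hp, hpt⟩
          · have hcl : ClosedIn H S {a, b} {x} := by
              refine ⟨by simpa, ?_, ?_⟩
              · rintro _ rfl (h | h)
                exacts [hax h.symm, hbx h.symm]
              · rintro _ rfl y hy hxy
                exact Or.inr ((hN y hy).1 hxy)
            refine absurd ⟨{x}, _, by simp, ?_, ?_, hcl, hcl.compl⟩ hsep
            · by_contra hne
              rw [Set.not_nonempty_iff_eq_empty, Set.sdiff_eq_empty] at hne
              have h9 := Set.ncard_le_ncard hne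
              rw [Set.ncard_pair hab] at h9
              omega
            · rw [Set.disjoint_left]
              exact fun y hy h => h.1.2 hy
        · refine ⟨t', ht', ?_⟩
          rintro rfl
          exact heq (ht'.1.symm.trans ht.1)

end Construction

/-! ### From chain trees of cycles to spaghetti tree decompositions -/

section Satellites

variable {V : Type} {G H : SimpleGraph V} {S : Set V} {u v a b : V}

/-- The vertices of degree two whose two neighbours separate the graph into at least three
parts. -/
def satellites (H : SimpleGraph V) : Set V :=
  {x | ∃ a b, a ≠ b ∧ (∀ y, H.Adj x y ↔ y = a ∨ y = b) ∧ ThreeSep H Set.univ {a, b}}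

lemma BiConn.notMem_satellites (hb : BiConn H Set.univ) (hab : a ≠ b)
    (h : ThreeSep H Set.univ {a, b}) : a ∉ satellites H := by
  rintro ⟨c, d, -, hN, -⟩
  obtain ⟨A, hne, hd, hcl⟩ := h
  choose y hy hay using fun i =>
    hb.exists_adj (Set.mem_univ a) (Set.mem_univ b) hab (hne i) (hcl i)
  have hinj : ∀ i j, i ≠ j → y i ≠ y j := fun i j hij h =>
    Set.disjoint_left.1 (hd i j hij) (hy i) (h ▸ hy j)
  have h01 := hinj 0 1 (by decide)
  have h02 := hinj 0 2 (by decide)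
  have h12 := hinj 1 2 (by decide)
  have h0 := (hN _).1 (hay 0)
  have h1 := (hN _).1 (hay 1)
  have h2 := (hN _).1 (hay 2)
  grind

lemma BiConn.reduces_satellites (hb : BiConn H Set.univ)
    (hcell : ∀ u v, u ≠ v → ThreeSep H Set.univ {u, v} → H.Adj u v) :
    Reduces H Set.univ H (satellites H)ᶜ := by
  refine ⟨Set.subset_univ _, le_rfl, ?_⟩
  rintro x ⟨-, hx⟩ y - hxy
  obtain ⟨a, b, hab, hN, h⟩ := not_not.1 hx
  have ha := hb.notMem_satellites hab h
  have hb' := hb.notMem_satellites hab.symm (Set.pair_comm a b ▸ h)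
  have hadj := hcell a b hab h
  refine ⟨?_, fun z _ hxz hyz => ?_⟩
  · rcases (hN y).1 hxy with rfl | rfl <;> assumption
  · rcases (hN y).1 hxy with rfl | rfl <;> rcases (hN z).1 hxz with rfl | rfl
    exacts [absurd rfl hyz, hadj, hadj.symm, absurd rfl hyz]

lemma BiConn.two_le_ncard_compl_satellites [Finite V] (hb : BiConn H Set.univ)
    (h3 : 3 ≤ Nat.card V) : 2 ≤ (satellites H)ᶜ.ncard := by
  rcases (satellites H).eq_empty_or_nonempty with h | ⟨x, a, b, hab, -, h⟩
  · rw [h, Set.compl_empty, Set.ncard_univ]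
    omega
  · rw [← Set.ncard_pair hab]
    refine Set.ncard_le_ncard ?_
    rintro y (rfl | rfl)
    · exact hb.notMem_satellites hab h
    · exact hb.notMem_satellites hab.symm (Set.pair_comm a y ▸ h)

lemma BiConn.not_threeSep_compl_satellites (hb : BiConn H Set.univ)
    (hcell : ∀ u v, u ≠ v → ThreeSep H Set.univ {u, v} → H.Adj u v)
    (hQ : ∀ u v, u ≠ v → ¬ FatSep H u v) (hu : u ∉ satellites H) (hv : v ∉ satellites H)
    (huv : u ≠ v) : ¬ ThreeSep H (satellites H)ᶜ {u, v} := by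
  intro h
  have hr := hb.reduces_satellites hcell
  have hX : ({u, v} : Set V) ⊆ (satellites H)ᶜ := by
    rintro y (rfl | rfl) <;> assumption
  have h3 := hr.threeSep hX h
  obtain ⟨A, hne, hd, hcl⟩ := h
  have hcl' := fun i => hr.closedIn_extendBy hX (hcl i)
  refine hQ u v huv ⟨_, fun i => (hne i).mono Set.subset_union_left,
    fun i j hij => hr.disjoint_extendBy (hcl i) (hcl j) (hd i j hij), hcl', fun i p hp => ?_⟩
  rcases hp with hp | ⟨-, q, hq, hpq⟩
  · by_contra hc
    push Not at hc
    have hpc : ClosedIn H Set.univ {u, v} {p} := by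
      refine ⟨Set.subset_univ _, ?_, ?_⟩
      · rintro _ rfl
        exact (hcl i).2.1 _ hp
      · rintro _ rfl y hy hpy
        exact Or.inr (((hcl' i).2.2 _ (Or.inl hp) y hy hpy).resolve_left fun h => hc y h hpy)
    obtain ⟨y, hy, hup⟩ := hb.exists_adj (Set.mem_univ u) (Set.mem_univ v) huv
      (Set.singleton_nonempty p) hpc
    obtain ⟨z, hz, hvp⟩ := hb.exists_adj (Set.mem_univ v) (Set.mem_univ u) huv.symm
      (Set.singleton_nonempty p) (Set.pair_comm u v ▸ hpc)
    rw [Set.mem_singleton_iff] at hy hz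
    subst hy hz
    refine (hcl i).1 hp ⟨u, v, huv, fun y => ⟨fun h => ?_, ?_⟩, h3⟩
    · exact (hpc.2.2 _ rfl y (Set.mem_univ y) h).resolve_left h.ne'
    · rintro (rfl | rfl)
      exacts [hup.symm, hvp.symm]
  · exact ⟨q, Or.inl hq, hpq⟩

lemma BiConn.exists_mem_adj (hb : BiConn H S) (h2 : 2 ≤ S.ncard) (hv : v ∈ S) :
    ∃ c ∈ S, H.Adj v c := by
  by_contra hc
  push Not at hc
  have h := hb.1 {v} (Set.singleton_nonempty v) ⟨by simpa, by simp, by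
    rintro _ rfl y hy h
    exact absurd h (hc y hy)⟩
  rw [← h, Set.ncard_singleton] at h2
  omega

lemma isPathSet_singleton {ι : Type} (T : SimpleGraph ι) (t : ι) : IsPathSet T {t} := by
  refine ⟨?_, fun x _ => ?_⟩
  · have : Nonempty ({t} : Set ι) := ⟨⟨t, rfl⟩⟩
    exact Connected.of_subsingleton
  · refine (Set.ncard_le_ncard (t := {t}) (fun y hy => hy.1)).trans ?_
    simp

lemma BiConn.exists_spaghettiTD [Finite V] (hb : BiConn H Set.univ) (h3 : 3 ≤ Nat.card V)
    (he : Elim2 H Set.univ)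
    (hcell : ∀ u v, u ≠ v → ThreeSep H Set.univ {u, v} → H.Adj u v)
    (hQ : ∀ u v, u ≠ v → ¬ FatSep H u v) :
    ∃ td : SpaghettiTD H, ∀ x, (td.bag x).ncard ≤ 3 := by
  have hr := hb.reduces_satellites hcell
  have hbS := hr.biConn hb
  have h2 := hb.two_le_ncard_compl_satellites h3
  obtain ⟨D, h4, h5, -, -⟩ := hbS.exists_spagTree (Nat.card V)
    (he.mono (Set.subset_univ _) fun x _ y _ h => h) h2
    fun u hu v hv huv => hb.not_threeSep_compl_satellites hcell hQ hu hv huv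
  have := D.finι
  have := D.isTree.1.nonempty
  have hf : ∀ B : Set V, ∃ f : V → D.ι,
      (∃ c ∉ satellites H, ∃ d ∉ satellites H, H.Adj c d ∧ B = {c, d}) →
        Function.Injective f ∧ ∀ y, D.bag (f y) = B := by
    intro B
    by_cases hB : ∃ c ∉ satellites H, ∃ d ∉ satellites H, H.Adj c d ∧ B = {c, d}
    · obtain ⟨c, hc, d, hd, hcd, rfl⟩ := hB
      have h := h5 c hc d hd hcd
      have := Fintype.ofFinite V
      have := Fintype.ofFinite {x | D.bag x = {c, d}}
      rw [← Nat.card_coe_set_eq, Nat.card_eq_fintype_card, Nat.card_eq_fintype_card] at h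
      obtain ⟨e⟩ := Function.Embedding.nonempty_of_card_le h
      exact ⟨fun y => e y, fun _ => ⟨Subtype.val_injective.comp e.injective, fun y => (e y).2⟩⟩
    · exact ⟨fun _ => Classical.arbitrary _, fun h => absurd h hB⟩
  choose f hf using hf
  have hN : ∀ x ∈ satellites H, (H.neighborSet x).ncard = 2 ∧
      ∃ c ∉ satellites H, ∃ d ∉ satellites H, H.Adj c d ∧ H.neighborSet x = {c, d} := by
    rintro x ⟨a, b, hab, hN, h⟩
    have h6 : H.neighborSet x = {a, b} := Set.ext hN
    exact ⟨by rw [h6, Set.ncard_pair hab], a, hb.notMem_satellites hab h, b,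
      hb.notMem_satellites hab.symm (Set.pair_comm a b ▸ h), hcell a b hab h, h6⟩
  let g : V → D.ι := fun x => f (H.neighborSet x) x
  have hg : ∀ x ∈ satellites H, D.bag (g x) = H.neighborSet x := fun x hx =>
    (hf _ (hN x hx).2).2 x
  have hinj : ∀ x ∈ satellites H, ∀ y ∈ satellites H, g x = g y → x = y := by
    intro x hx y hy h
    have h6 : H.neighborSet x = H.neighborSet y := by rw [← hg x hx, ← hg y hy, h]
    refine (hf _ (hN x hx).2).1 (h.trans ?_)
    rw [h6]
  let bag : D.ι → Set V := fun t => D.bag t ∪ {x | x ∈ satellites H ∧ g x = t}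
  have hpath : ∀ v, IsPathSet D.tree {t | v ∈ bag t} := by
    intro v
    by_cases hv : v ∈ satellites H
    · have h6 : {t | v ∈ bag t} = {g v} := by
        ext t
        constructor
        · rintro (h | h)
          · exact absurd hv (h4 t h)
          · exact h.2.symm
        · rintro rfl
          exact Or.inr ⟨hv, rfl⟩
      rw [h6]
      exact isPathSet_singleton _ _
    · have h6 : {t | v ∈ bag t} = {t | v ∈ D.bag t} := by
        ext t
        exact ⟨fun h => h.resolve_right fun h => hv h.1, Or.inl⟩
      rw [h6]
      obtain ⟨c, hc, hvc⟩ := hbS.exists_mem_adj h2 hv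
      obtain ⟨t, ht⟩ := (Set.ncard_pos (Set.toFinite _)).1
        (lt_of_lt_of_le (by omega) (h5 v hv c hc hvc))
      refine D.path v ⟨t, ?_⟩
      rw [Set.mem_ofPred_eq, show D.bag t = _ from ht]
      exact Or.inl rfl
  have hsat : ∀ u ∈ satellites H, ∀ v, H.Adj u v → ∃ t, u ∈ bag t ∧ v ∈ bag t := by
    intro u hu v huv
    exact ⟨g u, Or.inr ⟨hu, rfl⟩, Or.inl (by rw [hg u hu]; exact huv)⟩
  refine ⟨⟨⟨D.ι, D.finι, D.tree, D.isTree, bag, fun v => ?_, fun u v huv => ?_,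
    fun v => (hpath v).1⟩, hpath⟩, fun t => ?_⟩
  · obtain ⟨t, ht⟩ := (hpath v).1.nonempty
    exact ⟨t, ht⟩
  · by_cases hu : u ∈ satellites H
    · exact hsat u hu v huv
    by_cases hv : v ∈ satellites H
    · obtain ⟨t, ht⟩ := hsat v hv u huv.symm
      exact ⟨t, ht.symm⟩
    obtain ⟨t, ht⟩ := (Set.ncard_pos (Set.toFinite _)).1
      (lt_of_lt_of_le (by omega) (h5 u hu v hv huv))
    have ht : D.bag t = {u, v} := ht
    exact ⟨t, Or.inl (by simp [ht]), Or.inl (by simp [ht])⟩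
  · change (bag t).ncard ≤ 3
    by_cases h : ∃ x ∈ satellites H, g x = t
    · obtain ⟨x, hx, rfl⟩ := h
      have h6 : {y | y ∈ satellites H ∧ g y = g x} ⊆ {x} := fun y hy => hinj y hy.1 x hx hy.2
      have h7 := Set.ncard_le_ncard h6
      have h8 := Set.ncard_union_le (D.bag (g x)) {y | y ∈ satellites H ∧ g y = g x}
      rw [hg x hx, (hN x hx).1] at h8
      rw [Set.ncard_singleton] at h7
      have h9 : bag (g x) = H.neighborSet x ∪ {y | y ∈ satellites H ∧ g y = g x} := by
        rw [← hg x hx]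
      rw [h9]
      omega
    · have h6 : bag t = D.bag t := by
        refine Set.union_eq_self_of_subset_right ?_
        exact fun x hx => absurd ⟨x, hx⟩ h
      rw [h6]
      exact D.ncard_bag t

end Satellites

section Main

variable {V : Type} {G : SimpleGraph V}

lemma TwoConnected.isChainTreeOfCycles [Finite V] (hG : TwoConnected G) (td : SpaghettiTD G)
    (hw : ∀ x, (td.bag x).ncard ≤ 3) : IsChainTreeOfCycles (cellCompletion G) := by
  have hb := hG.biConn.mono_graph (le_cellCompletion (G := G))
  let td' : SpaghettiTD (cellCompletion G) :=
    { toTreeDecomp := td.toTreeDecomp.ofAdj fun u v huv => by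
        obtain ⟨hne, h | h⟩ := cellCompletion_adj.1 huv
        · exact td.bag_edge h
        · exact td.toTreeDecomp.exists_common_bag hw hG.biConn hne h
      bag_path := td.bag_path }
  have hT : ToC (cellCompletion G) Set.univ := by
    refine hb.toC (by rw [Set.ncard_univ]; exact hG.1) (td'.toTreeDecomp.elim2 hw) ?_
    exact fun u _ v _ huv h h' => h (cellCompletion_adj_of_threeSep huv h')
  refine ⟨isTreeOfCycles_iff.2 hT, (hT.not_fatSep_iff hb
    fun u v => cellCompletion_adj_of_threeSep).1 fun u v huv h => ?_⟩
  exact td'.not_fatSep hw hb (cellCompletion_adj_of_threeSep huv h.threeSep) h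

lemma TwoConnected.exists_spaghettiTD [Finite V] (hG : TwoConnected G)
    (h : IsChainTreeOfCycles (cellCompletion G)) :
    ∃ td : SpaghettiTD G, ∀ x, (td.bag x).ncard ≤ 3 := by
  have hb := hG.biConn.mono_graph (le_cellCompletion (G := G))
  have hT := isTreeOfCycles_iff.1 h.1
  have hcell : ∀ u v, u ≠ v → ThreeSep (cellCompletion G) Set.univ {u, v} →
      (cellCompletion G).Adj u v := fun u v => cellCompletion_adj_of_threeSep
  obtain ⟨td, hw⟩ := hb.exists_spaghettiTD hG.1 hT.elim2 hcell
    ((hT.not_fatSep_iff hb hcell).2 h.2)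
  exact ⟨⟨td.toTreeDecomp.ofAdj fun u v huv => td.bag_edge (le_cellCompletion huv),
    td.bag_path⟩, hw⟩

lemma TwoConnected.sptw_eq_two_iff [Finite V] (hG : TwoConnected G) :
    sptw G = 2 ↔ ∃ td : SpaghettiTD G, ∀ x, (td.bag x).ncard ≤ 3 := by
  constructor
  · intro h
    have hne : {k | ∃ td : SpaghettiTD G, ∀ x, (td.bag x).ncard ≤ k + 1}.Nonempty :=
      Nat.nonempty_of_pos_sInf (by change 0 < sptw G; omega)
    have := Nat.sInf_mem hne
    rwa [show sInf _ = 2 from h] at this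
  · intro h
    refine le_antisymm (Nat.sInf_le h) (le_csInf ⟨2, h⟩ ?_)
    rintro k ⟨td, hk⟩
    by_contra hlt
    exact td.toTreeDecomp.not_ncard_le_two hG.biConn hG.1 fun x => (hk x).trans (by omega)

end Main

/-- A 2-connected finite simple graph has spaghetti treewidth equal to two iff its
cell completion is a chain tree of cycles. -/
theorem statement1 {V : Type} [Fintype V] (G : SimpleGraph V) (hG : TwoConnected G) :
    sptw G = 2 ↔ IsChainTreeOfCycles (cellCompletion G) := by
  rw [hG.sptw_eq_two_iff]
  exact ⟨fun ⟨td, hw⟩ => hG.isChainTreeOfCycles td hw, hG.exists_spaghettiTD⟩
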